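/- arXiv:2605.18307 — 2 statements merged into one kernel-verified Lean document; each statement's English description precedes it below -/
import Mathlib

section
/- Let ρ ∈ (0,1] and γ ∈ (0,1]. There exist constants C ≥ 1 and h ∈ (0,1), depending only on ρ and γ, with the following property: for every a ∈ ℝ, every s > 0, every M > 0, every infinitely differentiable function g : ℝ → ℝ satisfying |g^{(k)}(x)| ≤ M k! (sρ)^{−k} for all x ∈ [a, a+s] and all k ∈ ℕ, and every Lebesgue-measurable set F ⊆ [a, a+s] with measure |F| ≥ γ s, one has sup_{x ∈ [a,a+s]} |g(x)| ≤ C M^{1−h} ( (1/|F|) ∫_F |g(x)| dx )^{h}. -/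
open MeasureTheory

/-- A Taylor polynomial of degree at most `n` approximates `g` geometrically well. -/
theorem exists_polynomial_near {c d M R : ℝ} (hcd : c < d) (hM : 0 ≤ M) (hR : 0 < R)
    (hdR : d - c ≤ R) {g : ℝ → ℝ} (hg : ContDiff ℝ (⊤ : ℕ∞) g)
    (hb : ∀ x ∈ Set.Icc c d, ∀ k : ℕ, |iteratedDeriv k g x| ≤ M * (Nat.factorial k) / R ^ k)
    (n : ℕ) :
    ∃ P : Polynomial ℝ, P.degree < (n + 1 : ℕ) ∧
      ∀ x ∈ Set.Icc c d, |g x - P.eval x| ≤ M * (2 * (d - c) / R) ^ n := by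
  have hgn : ∀ k : ℕ, ContDiff ℝ k g := fun k => hg.of_le (by exact_mod_cast le_top)
  refine ⟨∑ k ∈ Finset.range (n + 1),
    Polynomial.C ((k.factorial : ℝ)⁻¹ * iteratedDerivWithin k g (Set.Icc c d) c) *
      (Polynomial.X - Polynomial.C c) ^ k, ?_, fun x hx => ?_⟩
  · refine (Polynomial.degree_sum_le _ _).trans_lt ?_
    refine (Finset.sup_lt_iff (WithBot.bot_lt_coe _)).2 fun k hk => ?_
    refine ((Polynomial.degree_mul_le _ _).trans
      (add_le_add Polynomial.degree_C_le le_rfl)).trans_lt ?_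
    rw [zero_add, Polynomial.degree_pow, Polynomial.degree_X_sub_C, nsmul_one]
    exact_mod_cast Finset.mem_range.1 hk
  · have hT := taylor_mean_remainder_bound (n := n) hcd.le (hgn (n + 1)).contDiffOn hx
      (C := M * (Nat.factorial (n + 1)) / R ^ (n + 1)) (fun y hy => by
        rw [iteratedDerivWithin_eq_iteratedDeriv (uniqueDiffOn_Icc hcd) (hgn _).contDiffAt hy]
        exact hb y hy (n + 1))
    have he : Polynomial.eval x (∑ k ∈ Finset.range (n + 1),
        Polynomial.C ((k.factorial : ℝ)⁻¹ * iteratedDerivWithin k g (Set.Icc c d) c) *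
          (Polynomial.X - Polynomial.C c) ^ k) = taylorWithinEval g n (Set.Icc c d) c x := by
      rw [taylor_within_apply, Polynomial.eval_finsetSum]
      refine Finset.sum_congr rfl fun k _ => ?_
      simp only [Polynomial.eval_mul, Polynomial.eval_C, Polynomial.eval_pow, Polynomial.eval_sub,
        Polynomial.eval_X, smul_eq_mul]
      ring
    rw [he]
    refine hT.trans ?_
    have hx0 : 0 ≤ x - c := by linarith [hx.1]
    have h1 : M * (Nat.factorial (n + 1)) / R ^ (n + 1) * (x - c) ^ (n + 1) / (Nat.factorial n)
        = M * ((n + 1 : ℝ) * ((x - c) / R) ^ n * ((x - c) / R)) := by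
      rw [Nat.factorial_succ]
      push_cast
      have : (Nat.factorial n : ℝ) ≠ 0 := by positivity
      rw [mul_assoc (n + 1 : ℝ), ← pow_succ, div_pow]
      field_simp
    rw [h1]
    have h2 : ((n : ℝ) + 1) ≤ 2 ^ n := by exact_mod_cast Nat.lt_two_pow_self (n := n)
    have h3 : (x - c) / R ≤ 1 := by rw [div_le_one hR]; linarith [hx.2]
    have h4 : (x - c) / R ≤ (d - c) / R := by gcongr; exact hx.2
    calc _ ≤ M * (2 ^ n * ((d - c) / R) ^ n * 1) := by gcongr
      _ = _ := by rw [mul_one, ← mul_pow, mul_div_assoc]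

/-- A compact set of measure larger than `n * m` contains `n + 1` points spaced by at least `m`. -/
theorem exists_separated_nodes {m : ℝ} (hm : 0 ≤ m) (n : ℕ) :
    ∀ E : Set ℝ, IsCompact E → ENNReal.ofReal (n * m) < volume E →
      ∃ v : ℕ → ℝ, (∀ i ≤ n, v i ∈ E) ∧ ∀ i j, i ≤ j → j ≤ n → (j - i : ℝ) * m ≤ v j - v i := by
  induction n with
  | zero =>
    intro E _ hE
    obtain ⟨x, hx⟩ := nonempty_of_measure_ne_zero (ne_of_gt (lt_of_le_of_lt (zero_le) hE))
    refine ⟨fun _ => x, fun _ _ => hx, fun i j hij hj => ?_⟩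
    obtain rfl : j = 0 := by omega
    obtain rfl : i = 0 := by omega
    simp
  | succ n ih =>
    intro E hE hvol
    have hne : E.Nonempty := nonempty_of_measure_ne_zero (ne_of_gt (lt_of_le_of_lt (zero_le) hvol))
    obtain ⟨x₀, hx₀, hmin⟩ := hE.exists_isLeast hne
    have hsub : E ⊆ Set.Ico x₀ (x₀ + m) ∪ E ∩ Set.Ici (x₀ + m) := by
      intro y hy
      rcases lt_or_ge y (x₀ + m) with h | h
      · exact Or.inl ⟨hmin hy, h⟩
      · exact Or.inr ⟨hy, h⟩
    have hE' : ENNReal.ofReal (n * m) < volume (E ∩ Set.Ici (x₀ + m)) := by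
      have h1 := (measure_mono hsub).trans (measure_union_le (μ := volume) _ _)
      rw [Real.volume_Ico, add_sub_cancel_left] at h1
      have h2 := hvol.trans_le h1
      have h3 : (((n + 1 : ℕ) : ℝ) * m) = m + n * m := by push_cast; ring
      rw [h3, ENNReal.ofReal_add hm (by positivity)] at h2
      exact (ENNReal.add_lt_add_iff_left ENNReal.ofReal_ne_top).1 h2
    obtain ⟨v, hv, hsep⟩ := ih _ (hE.inter_right isClosed_Ici) hE'
    refine ⟨fun i => if i = 0 then x₀ else v (i - 1), fun i hi => ?_, fun i j hij hj => ?_⟩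
    · by_cases h : i = 0
      · simpa [h] using hx₀
      · simpa [h] using (hv (i - 1) (by omega)).1
    · rcases j with _ | j
      · obtain rfl : i = 0 := by omega
        simp
      rcases i with _ | i
      · have h1 := hsep 0 j (by omega) (by omega)
        have h2 : x₀ + m ≤ v 0 := (hv 0 (by omega)).2
        simp only [Nat.add_eq_zero_iff, one_ne_zero, and_false, if_false, if_true,
          Nat.add_sub_cancel]
        push_cast at h1 ⊢
        linarith
      · have h1 := hsep i j (by omega) (by omega)
        simp only [Nat.add_eq_zero_iff, one_ne_zero, and_false, if_false, Nat.add_sub_cancel]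
        push_cast
        linarith

theorem prod_erase_abs_sub (n i : ℕ) (hi : i ≤ n) :
    ∏ j ∈ (Finset.range (n + 1)).erase i, |(i : ℝ) - j| =
      (i.factorial : ℝ) * ((n - i).factorial : ℝ) := by
  have hs : (Finset.range (n + 1)).erase i = Finset.range i ∪ Finset.Ico (i + 1) (n + 1) := by
    ext j
    simp only [Finset.mem_erase, Finset.mem_range, Finset.mem_union, Finset.mem_Ico]
    omega
  rw [hs, Finset.prod_union]
  · congr 1
    · rw [← Finset.prod_range_add_one_eq_factorial, ← Finset.prod_range_reflect]
      push_cast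
      refine Finset.prod_congr rfl fun j hj => ?_
      have hj' := Finset.mem_range.1 hj
      rw [show i - 1 - j = i - (j + 1) by omega, Nat.cast_sub (by omega)]
      push_cast
      rw [abs_of_nonneg (by linarith)]
      ring
    · rw [← Finset.prod_range_add_one_eq_factorial, Finset.prod_Ico_eq_prod_range,
        show n + 1 - (i + 1) = n - i by omega]
      push_cast
      refine Finset.prod_congr rfl fun j _ => ?_
      rw [show (i : ℝ) - (i + 1 + j) = -(j + 1) by ring, abs_neg, abs_of_nonneg (by positivity)]
  · rw [Finset.disjoint_left]
    intro j
    simp only [Finset.mem_range, Finset.mem_Ico]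
    omega

/-- A Remez-type bound: a polynomial of degree at most `n` is controlled by its values at `n + 1`
separated nodes. -/
theorem abs_eval_le_of_separated_nodes {P : Polynomial ℝ} {n : ℕ} (hP : P.degree < (n + 1 : ℕ))
    {m ℓ B x : ℝ} (hm : 0 < m) {v : ℕ → ℝ}
    (hsep : ∀ i j, i ≤ j → j ≤ n → (j - i : ℝ) * m ≤ v j - v i)
    (hB : ∀ i ≤ n, |P.eval (v i)| ≤ B) (hx : ∀ i ≤ n, |x - v i| ≤ ℓ) :
    |P.eval x| ≤ B * ((2 * ℓ / m) ^ n / n.factorial) := by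
  have hB0 : 0 ≤ B := (abs_nonneg _).trans (hB 0 (Nat.zero_le _))
  have hℓ : 0 ≤ ℓ := (abs_nonneg _).trans (hx 0 (Nat.zero_le _))
  have habs : ∀ i ≤ n, ∀ j ≤ n, |(i : ℝ) - j| * m ≤ |v i - v j| := by
    intro i hi j hj
    rcases le_total i j with h | h
    · have h1 := hsep i j h hj
      have h2 : (i : ℝ) ≤ j := by exact_mod_cast h
      rw [abs_sub_comm, abs_sub_comm (v i), abs_of_nonneg (by linarith)]
      exact h1.trans (le_abs_self _)
    · have h1 := hsep j i h hi
      have h2 : (j : ℝ) ≤ i := by exact_mod_cast h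
      rw [abs_of_nonneg (by linarith)]
      exact h1.trans (le_abs_self _)
  have hinj : Set.InjOn v (Finset.range (n + 1) : Set ℕ) := by
    intro i hi j hj hij
    simp only [Finset.coe_range, Set.mem_Iio] at hi hj
    have h1 := habs i (by omega) j (by omega)
    rw [hij, sub_self, abs_zero] at h1
    have h2 : |(i : ℝ) - j| ≤ 0 := by
      by_contra h
      push Not at h
      nlinarith [mul_pos h hm]
    have h3 : (i : ℝ) = j := by linarith [abs_eq_zero.1 (le_antisymm h2 (abs_nonneg _))]
    exact_mod_cast h3
  have hbasis : ∀ i ∈ Finset.range (n + 1),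
      |(Lagrange.basis (Finset.range (n + 1)) v i).eval x| ≤
        (ℓ / m) ^ n / (i.factorial * (n - i).factorial) := by
    intro i hi
    have hi' : i ≤ n := by simpa [Nat.lt_succ_iff] using hi
    rw [Lagrange.basis, Polynomial.eval_prod, Finset.abs_prod, ← prod_erase_abs_sub n i hi']
    have hcard : ((Finset.range (n + 1)).erase i).card = n := by
      rw [Finset.card_erase_of_mem hi, Finset.card_range, Nat.add_sub_cancel]
    have hpow : (ℓ / m) ^ n = ∏ _j ∈ (Finset.range (n + 1)).erase i, (ℓ / m) := by
      rw [Finset.prod_const, hcard]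
    rw [hpow, ← Finset.prod_div_distrib]
    refine Finset.prod_le_prod (fun _ _ => abs_nonneg _) fun j hj => ?_
    have hj' : j ≤ n := by simpa [Nat.lt_succ_iff] using Finset.mem_of_mem_erase hj
    have hne : (i : ℝ) - j ≠ 0 := by
      rw [sub_ne_zero]
      exact_mod_cast (Finset.ne_of_mem_erase hj).symm
    have hpos : 0 < |(i : ℝ) - j| := abs_pos.2 hne
    simp only [Lagrange.basisDivisor, Polynomial.eval_mul, Polynomial.eval_C, Polynomial.eval_sub,
      Polynomial.eval_X, abs_mul, abs_inv]
    rw [div_div, mul_comm m, inv_mul_eq_div]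
    exact div_le_div₀ hℓ (hx j hj') (mul_pos hpos hm) (habs i hi' j hj')
  have hinterp := Lagrange.eq_interpolate_of_eval_eq (f := P) (s := Finset.range (n + 1)) (v := v)
    (fun i => P.eval (v i)) hinj (by simpa using hP) (fun i _ => rfl)
  have hsum : ∑ i ∈ Finset.range (n + 1), (ℓ / m) ^ n / ((i.factorial : ℝ) * (n - i).factorial) =
      (2 * ℓ / m) ^ n / n.factorial := by
    have h2 : ((2 : ℝ) ^ n) = ∑ i ∈ Finset.range (n + 1), (n.choose i : ℝ) := by
      exact_mod_cast (Nat.sum_range_choose n).symm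
    rw [mul_div_assoc, mul_pow, h2, Finset.sum_mul, Finset.sum_div]
    refine Finset.sum_congr rfl fun i hi => ?_
    rw [Nat.cast_choose ℝ (by simpa [Nat.lt_succ_iff] using hi)]
    have : (n.factorial : ℝ) ≠ 0 := by positivity
    field_simp
  rw [hinterp, Lagrange.interpolate_apply, Polynomial.eval_finsetSum, ← hsum, Finset.mul_sum]
  refine (Finset.abs_sum_le_sum_abs _ _).trans (Finset.sum_le_sum fun i hi => ?_)
  rw [Polynomial.eval_mul, Polynomial.eval_C, abs_mul]
  exact mul_le_mul (hB i (by simpa [Nat.lt_succ_iff] using hi)) (hbasis i hi) (abs_nonneg _) hB0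

/-- Optimizing over `n` in a bound of the form `δ * K ^ n + 2 ^ (-n)` gives a power of `δ`. -/
theorem le_rpow_of_forall_nat {K δ u : ℝ} (hK : 1 < K) (hδ : 0 ≤ δ) (hu1 : u ≤ 1)
    (hu : ∀ n : ℕ, u ≤ 4 * (δ * K ^ n + (1 / 2) ^ n)) :
    u ≤ 16 * δ ^ Real.logb (2 * K) 2 := by
  have hh : 0 < Real.logb (2 * K) 2 := Real.logb_pos (by linarith) (by norm_num)
  rcases le_or_gt 1 δ with h1 | h1
  · linarith [Real.one_le_rpow h1 hh.le]
  rcases hδ.eq_or_lt with rfl | hpos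
  · rw [Real.zero_rpow hh.ne', mul_zero]
    refine ge_of_tendsto' (f := fun n : ℕ => 4 * (1 / 2 : ℝ) ^ n) (x := Filter.atTop) ?_
      fun n => by simpa using hu n
    simpa using (tendsto_pow_atTop_nhds_zero_of_lt_one (r := (1 / 2 : ℝ)) (by norm_num)
      (by norm_num)).const_mul 4
  · obtain ⟨n, hn, hn'⟩ := exists_nat_pow_near (x := δ⁻¹) (y := 2 * K)
      ((one_le_inv₀ hpos).2 h1.le) (by linarith)
    have h2 : δ * K ^ n ≤ (1 / 2) ^ n := by
      have := mul_le_mul_of_nonneg_left hn hpos.le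
      rw [mul_inv_cancel₀ hpos.ne', mul_pow] at this
      rw [one_div, inv_pow, ← one_div, le_div_iff₀ (by positivity)]
      linarith
    have h3 : (1 / 2 : ℝ) ^ (n + 1) ≤ δ ^ Real.logb (2 * K) 2 := by
      have h4 : (δ⁻¹) ^ Real.logb (2 * K) 2 ≤ 2 ^ (n + 1) := by
        refine (Real.rpow_le_rpow (by positivity) hn'.le hh.le).trans_eq ?_
        rw [← Real.rpow_natCast, ← Real.rpow_mul (by linarith),
          mul_comm ((n + 1 : ℕ) : ℝ), Real.rpow_mul (by linarith),
          Real.rpow_logb (by linarith) (by linarith) (by norm_num),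
          Real.rpow_natCast]
      rw [Real.inv_rpow hpos.le] at h4
      rw [one_div, inv_pow]
      exact inv_le_of_inv_le₀ (Real.rpow_pos_of_pos hpos _) h4
    have h5 := hu n
    rw [pow_succ] at h3
    linarith

/-- Propagation of smallness from a sublevel set to an interval short compared with `R`. -/
theorem abs_le_rpow_of_sublevel {η c d M R δ : ℝ} (hη : 0 < η) (hη1 : η ≤ 1) (hcd : c < d)
    (hM : 0 < M) (hR : 24 / η * (d - c) ≤ R) (hδ : 0 ≤ δ) {g : ℝ → ℝ}
    (hg : ContDiff ℝ (⊤ : ℕ∞) g)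
    (hb : ∀ x ∈ Set.Icc c d, ∀ k : ℕ, |iteratedDeriv k g x| ≤ M * (Nat.factorial k) / R ^ k)
    (hE : ENNReal.ofReal (η * (d - c)) ≤ volume {x ∈ Set.Icc c d | |g x| ≤ M * δ}) :
    ∀ x ∈ Set.Icc c d, |g x| ≤ M * (16 * δ ^ Real.logb (2 * (6 / η)) 2) := by
  intro x hx
  have hℓ : 0 < d - c := sub_pos.2 hcd
  have hK : 6 ≤ 6 / η := by rw [le_div_iff₀ hη]; linarith
  have hRpos : 0 < R := lt_of_lt_of_le (by positivity) hR
  have hdR : d - c ≤ R := by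
    have : 24 / η = 4 * (6 / η) := by ring
    nlinarith
  suffices h : |g x| / M ≤ 16 * δ ^ Real.logb (2 * (6 / η)) 2 by
    rwa [div_le_iff₀' hM] at h
  refine le_rpow_of_forall_nat (by linarith) hδ ?_ fun n => ?_
  · rw [div_le_one hM]
    simpa using hb x hx 0
  obtain ⟨P, hdeg, hP⟩ := exists_polynomial_near hcd hM.le hRpos hdR hg hb n
  have hcomp : IsCompact {x ∈ Set.Icc c d | |g x| ≤ M * δ} :=
    isCompact_Icc.inter_right (isClosed_le hg.continuous.abs continuous_const)
  have hm : 0 < η * (d - c) / (n + 1) := by positivity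
  have hlt : ENNReal.ofReal (n * (η * (d - c) / (n + 1))) <
      volume {x ∈ Set.Icc c d | |g x| ≤ M * δ} := by
    refine lt_of_lt_of_le ((ENNReal.ofReal_lt_ofReal_iff (by positivity)).2 ?_) hE
    rw [mul_div_assoc', div_lt_iff₀ (by positivity)]
    nlinarith [mul_pos hη hℓ]
  obtain ⟨v, hv, hsep⟩ := exists_separated_nodes hm.le n _ hcomp hlt
  set τ := 2 * (d - c) / R with hτ
  have hτ0 : 0 ≤ τ := by positivity
  have hKτ : 6 / η * τ ≤ 1 / 2 := by
    rw [hτ, mul_div_assoc', div_le_iff₀ hRpos]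
    have : 24 / η = 4 * (6 / η) := by ring
    rw [this] at hR
    linarith
  have hbound := abs_eval_le_of_separated_nodes hdeg hm hsep (B := M * δ + M * τ ^ n)
    (ℓ := d - c) (x := x) (fun i hi => by
      have h1 := (hv i hi).2
      have h2 := hP _ (hv i hi).1
      have h3 := abs_sub_abs_le_abs_sub (P.eval (v i)) (g (v i))
      rw [abs_sub_comm] at h3
      linarith) (fun i hi => by
      have h1 := (hv i hi).1
      rw [abs_le]
      constructor <;> linarith [h1.1, h1.2, hx.1, hx.2])
  have hfac : (2 * (d - c) / (η * (d - c) / (n + 1))) ^ n / n.factorial ≤ 3 * (6 / η) ^ n := by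
    have h1 : 2 * (d - c) / (η * (d - c) / (n + 1)) = 2 / η * (n + 1) := by
      field_simp
    have h2 : ((n : ℝ) + 1) ^ n / n.factorial ≤ 3 * 3 ^ n := by
      refine (Real.pow_div_factorial_le_exp _ (by positivity) n).trans ?_
      rw [← pow_succ', show ((n : ℝ) + 1) = ((n + 1 : ℕ) : ℝ) * 1 by push_cast; ring,
        Real.exp_nat_mul]
      gcongr
      exact (Real.exp_one_lt_d9.trans (by norm_num)).le
    rw [h1, mul_pow, mul_div_assoc]
    calc _ ≤ (2 / η) ^ n * (3 * 3 ^ n) := by gcongr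
      _ = 3 * (2 / η * 3) ^ n := by rw [mul_pow]; ring
      _ = _ := by congr 2; ring
  have h1 : |g x| ≤ M * τ ^ n + (M * δ + M * τ ^ n) * (3 * (6 / η) ^ n) := by
    have h2 := hP x hx
    have h3 := abs_sub_abs_le_abs_sub (g x) (P.eval x)
    have h4 := hbound.trans (mul_le_mul_of_nonneg_left hfac (by positivity))
    linarith
  have h2 : τ ^ n ≤ (6 / η * τ) ^ n := by
    gcongr
    nlinarith
  have h3 : (6 / η * τ) ^ n ≤ (1 / 2) ^ n := by gcongr
  have h5 : 0 ≤ δ * (6 / η) ^ n := by positivity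
  have h6 : (6 / η * τ) ^ n = (6 / η) ^ n * τ ^ n := mul_pow _ _ _
  rw [div_le_iff₀' hM]
  calc |g x| ≤ M * (τ ^ n + 3 * (δ * (6 / η) ^ n) + 3 * (6 / η * τ) ^ n) := by
        rw [h6]; linarith
    _ ≤ M * (4 * (δ * (6 / η) ^ n + (1 / 2) ^ n)) := by
        gcongr
        linarith

/-- Propagation of smallness from one interval of length `L` to a translate by at most `k * L`,
by chaining `k` short steps. -/
theorem exists_rpow_bound_translate {η : ℝ} (hη : 0 < η) (hη1 : η ≤ 1 / 2) (k : ℕ) :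
    ∃ C : ℝ, 1 ≤ C ∧ ∃ h : ℝ, h ∈ Set.Ioo (0 : ℝ) 1 ∧
      ∀ a b L M R δ c c' : ℝ, 0 < L → 0 < M → 24 / η * (2 * L) ≤ R → 0 ≤ δ →
        ∀ g : ℝ → ℝ, ContDiff ℝ (⊤ : ℕ∞) g →
          (∀ x ∈ Set.Icc a b, ∀ k : ℕ,
            |iteratedDeriv k g x| ≤ M * (Nat.factorial k) / R ^ k) →
          a ≤ c → c + L ≤ b → a ≤ c' → c' + L ≤ b → |c' - c| ≤ k * L →
          ENNReal.ofReal (η * L) ≤ volume {x ∈ Set.Icc c (c + L) | |g x| ≤ M * δ} →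
          ∀ x ∈ Set.Icc c' (c' + L), |g x| ≤ M * (C * δ ^ h) := by
  have hK : 6 ≤ 6 / η := by rw [le_div_iff₀ hη]; linarith
  set h₀ := Real.logb (2 * (6 / η)) 2 with hh₀
  have hh₀0 : 0 < h₀ := Real.logb_pos (by linarith) (by norm_num)
  have hh₀1 : h₀ < 1 := by
    rw [hh₀, Real.logb_lt_iff_lt_rpow (by linarith) (by norm_num), Real.rpow_one]
    linarith
  have hmul : 0 < 24 / η := by positivity
  induction k with
  | zero =>
    refine ⟨16, by norm_num, h₀, ⟨hh₀0, hh₀1⟩, ?_⟩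
    intro a b L M R δ c c' hL hM hR hδ g hg hb hac hcb _ _ hcc hE
    obtain rfl : c' = c := by
      simpa [sub_eq_zero] using hcc
    refine abs_le_rpow_of_sublevel hη (by linarith) (by linarith) hM ?_ hδ hg
      (fun x hx => hb x ⟨hac.trans hx.1, hx.2.trans hcb⟩) (by simpa using hE)
    rw [add_sub_cancel_left]
    nlinarith
  | succ k ih =>
    obtain ⟨C, hC, h, hh, H⟩ := ih
    refine ⟨16 * C ^ h₀, ?_, h * h₀, ⟨mul_pos hh.1 hh₀0, ?_⟩, ?_⟩
    · linarith [Real.one_le_rpow hC hh₀0.le]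
    · nlinarith [hh.1, hh.2]
    intro a b L M R δ c c' hL hM hR hδ g hg hb hac hcb hac' hcb' hcc hE
    have hk : (0 : ℝ) < k + 1 := by positivity
    set t : ℝ := 1 / (k + 1) with ht
    have ht0 : 0 < t := by positivity
    have ht1 : t ≤ 1 := by rw [ht, div_le_one hk]; linarith [(Nat.cast_nonneg k : (0 : ℝ) ≤ k)]
    have htk : t * (k + 1) = 1 := by rw [ht]; field_simp
    push_cast at hcc
    obtain ⟨e, he⟩ : ∃ e, e = c' + t * (c - c') := ⟨_, rfl⟩
    have hec' : |e - c'| ≤ L := by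
      rw [he, add_sub_cancel_left, abs_mul, abs_of_pos ht0, abs_sub_comm]
      calc _ ≤ t * ((k + 1) * L) := by gcongr
        _ = L := by rw [← mul_assoc, htk, one_mul]
    have hec : |e - c| ≤ k * L := by
      rw [he, show c' + t * (c - c') - c = (1 - t) * (c' - c) by ring, abs_mul,
        abs_of_nonneg (by linarith)]
      calc _ ≤ (1 - t) * ((k + 1) * L) := by gcongr
        _ = ((k + 1) - t * (k + 1)) * L := by ring
        _ = k * L := by rw [htk]; ring
    have hae : a ≤ e := by rw [he]; nlinarith
    have heb : e + L ≤ b := by rw [he]; nlinarith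
    have hprev := H a b L M R δ c e hL hM hR hδ g hg hb hac hcb hae heb hec hE
    have hCδ : 0 ≤ C * δ ^ h := by positivity
    obtain ⟨p, hp⟩ : ∃ p, p = min c' e := ⟨_, rfl⟩
    obtain ⟨q, hq⟩ : ∃ q, q = max c' e + L := ⟨_, rfl⟩
    have hpq : L ≤ q - p ∧ q - p ≤ 2 * L := by
      have := max_sub_min_eq_abs c' e
      rw [← hp] at this
      constructor <;> linarith [abs_nonneg (e - c')]
    have hpc : p ≤ c' := hp ▸ min_le_left _ _
    have hpe : p ≤ e := hp ▸ min_le_right _ _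
    have hqc : c' + L ≤ q := by linarith [le_max_left c' e]
    have hqe : e + L ≤ q := by linarith [le_max_right c' e]
    have hap : a ≤ p := hp ▸ le_min hac' hae
    have hqb : q ≤ b := by
      rw [hq, max_add]
      exact max_le hcb' heb
    have hvol : ENNReal.ofReal (η * (q - p)) ≤
        volume {x ∈ Set.Icc p q | |g x| ≤ M * (C * δ ^ h)} := by
      have hsub : Set.Icc e (e + L) ⊆ {x ∈ Set.Icc p q | |g x| ≤ M * (C * δ ^ h)} :=
        fun x hx => ⟨⟨hpe.trans hx.1, hx.2.trans hqe⟩, hprev x hx⟩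
      refine le_trans ?_ (measure_mono hsub)
      rw [Real.volume_Icc, add_sub_cancel_left]
      exact ENNReal.ofReal_le_ofReal (by nlinarith [hpq.1, hpq.2])
    intro x hx
    have hfin := abs_le_rpow_of_sublevel hη (by linarith) (by linarith [hpq.1]) hM
      ((mul_le_mul_of_nonneg_left hpq.2 hmul.le).trans hR) hCδ hg
      (fun x hx => hb x ⟨hap.trans hx.1, hx.2.trans hqb⟩) hvol x
      ⟨hpc.trans hx.1, hx.2.trans hqc⟩
    rwa [Real.mul_rpow (by linarith) (by positivity), ← Real.rpow_mul hδ, ← hh₀,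
      ← mul_assoc 16] at hfin

/-- A point of `[a, a + s]` lies in one of its `N` equal subintervals. -/
theorem exists_cell_mem {a s x : ℝ} (hs : 0 < s) {N : ℕ} (hN : 0 < N)
    (hx : x ∈ Set.Icc a (a + s)) :
    ∃ i < N, x ∈ Set.Icc (a + i * (s / N)) (a + i * (s / N) + s / N) := by
  have hN' : (0 : ℝ) < N := by exact_mod_cast hN
  have hL : 0 < s / N := by positivity
  have hNL : N * (s / N) = s := by field_simp
  rcases hx.2.lt_or_eq with hlt | heq
  · have h0 : 0 ≤ (x - a) / (s / N) := div_nonneg (by linarith [hx.1]) hL.le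
    have h1 := Nat.floor_le h0
    have h2 := Nat.lt_floor_add_one ((x - a) / (s / N))
    rw [le_div_iff₀ hL] at h1
    rw [div_lt_iff₀ hL] at h2
    refine ⟨⌊(x - a) / (s / N)⌋₊, (Nat.floor_lt h0).2 ?_, by linarith, by linarith⟩
    rw [div_lt_iff₀ hL, hNL]
    linarith
  · have h1 : ((N - 1 : ℕ) : ℝ) = N - 1 := by rw [Nat.cast_sub hN]; simp
    refine ⟨N - 1, by omega, ?_, ?_⟩ <;> rw [h1] <;> linarith

/-- Some cell of an equipartition carries at least the average density of `G`. -/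
theorem exists_cell_measure_ge {a s η : ℝ} (hs : 0 < s) {N : ℕ} (hN : 0 < N)
    {G : Set ℝ} (hG : G ⊆ Set.Icc a (a + s)) (hvol : ENNReal.ofReal (η * s) ≤ volume G) :
    ∃ i < N, ENNReal.ofReal (η * (s / N)) ≤
      volume (G ∩ Set.Icc (a + i * (s / N)) (a + i * (s / N) + s / N)) := by
  by_contra! hcon
  have hN' : (0 : ℝ) < N := by exact_mod_cast hN
  have hNL : N * (s / N) = s := by field_simp
  have hcover : G ⊆ ⋃ i ∈ Finset.range N,
      G ∩ Set.Icc (a + i * (s / N)) (a + i * (s / N) + s / N) := by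
    intro x hx
    obtain ⟨i, hi, hxi⟩ := exists_cell_mem hs hN (hG hx)
    simp only [Finset.mem_range, Set.mem_iUnion, exists_prop]
    exact ⟨i, hi, hx, hxi⟩
  have hlt : volume G < ENNReal.ofReal (η * s) := by
    calc volume G ≤ ∑ i ∈ Finset.range N,
          volume (G ∩ Set.Icc (a + i * (s / N)) (a + i * (s / N) + s / N)) :=
          (measure_mono hcover).trans (measure_biUnion_finset_le _ _)
      _ < ∑ _i ∈ Finset.range N, ENNReal.ofReal (η * (s / N)) :=
          ENNReal.sum_lt_sum_of_nonempty (Finset.nonempty_range_iff.2 hN.ne')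
            fun i hi => hcon i (Finset.mem_range.1 hi)
      _ = ENNReal.ofReal (η * s) := by
          rw [Finset.sum_const, Finset.card_range, nsmul_eq_mul, ← ENNReal.ofReal_natCast,
            ← ENNReal.ofReal_mul hN'.le]
          congr 1
          rw [mul_left_comm, hNL]
  exact absurd hvol (not_le.2 hlt)

/-- A nonnegative function is at most twice its mean on at least half of `F`. -/
theorem half_measure_le_sublevel {F : Set ℝ} (hF : MeasurableSet F) (hpos : volume F ≠ 0)
    (hfin : volume F ≠ ⊤) {f : ℝ → ℝ} (hf0 : ∀ x, 0 ≤ f x) (hfm : Measurable f)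
    (hf : IntegrableOn f F) :
    volume F / 2 ≤
      volume {x ∈ F | f x ≤ 2 * ((1 / (volume F).toReal) * ∫ y in F, f y)} := by
  set A := (1 / (volume F).toReal) * ∫ y in F, f y with hA
  have hFr : 0 < (volume F).toReal := ENNReal.toReal_pos hpos hfin
  have hI0 : 0 ≤ ∫ y in F, f y := integral_nonneg hf0
  have hA0 : 0 ≤ A := by positivity
  have hbad : volume {x ∈ F | 2 * A < f x} ≤ volume F / 2 := by
    rcases hA0.eq_or_lt with h | h
    · have hI : ∫ y in F, f y = 0 := by
        rcases mul_eq_zero.1 h.symm with h1 | h1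
        · exact absurd h1 (by positivity)
        · exact h1
      have hae := (integral_eq_zero_iff_of_nonneg hf0 hf).1 hI
      rw [Filter.EventuallyEq, ae_restrict_iff' hF] at hae
      have : volume {x ∈ F | 2 * A < f x} = 0 := by
        refine measure_mono_null ?_ (ae_iff.1 hae)
        rintro x ⟨hx, hlt⟩ hc
        rw [hc hx, ← h] at hlt
        simp at hlt
      rw [this]
      exact zero_le
    · have hm := mul_meas_ge_le_integral_of_nonneg (μ := volume.restrict F)
        (Filter.Eventually.of_forall hf0) hf (2 * A)
      have hIA : ∫ y in F, f y = A * (volume F).toReal := by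
        rw [hA]; field_simp
      rw [hIA] at hm
      have hr : (volume.restrict F).real {x | 2 * A ≤ f x} ≤ (volume F).toReal / 2 := by
        have : 0 < 2 * A := by positivity
        nlinarith
      have hle : volume {x ∈ F | 2 * A < f x} ≤ volume.restrict F {x | 2 * A ≤ f x} := by
        rw [Measure.restrict_apply (measurableSet_le measurable_const hfm)]
        exact measure_mono fun x hx => ⟨hx.2.le, hx.1⟩
      refine hle.trans ?_
      have hfin' : volume.restrict F {x | 2 * A ≤ f x} ≠ ⊤ :=
        ne_top_of_le_ne_top hfin ((measure_mono (Set.subset_univ _)).trans_eq (by simp))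
      rw [← ENNReal.toReal_le_toReal hfin' (ENNReal.div_ne_top hfin two_ne_zero),
        ENNReal.toReal_div]
      exact hr
  have hsplit : volume F ≤ volume {x ∈ F | f x ≤ 2 * A} + volume F / 2 := by
    refine le_trans ?_ (add_le_add_right hbad _)
    refine (measure_mono fun x hx => ?_).trans (measure_union_le _ _)
    rcases le_or_gt (f x) (2 * A) with h | h
    · exact Or.inl ⟨hx, h⟩
    · exact Or.inr ⟨hx, h⟩
  have hne : volume F / 2 ≠ ⊤ := ENNReal.div_ne_top hfin two_ne_zero
  nth_rewrite 1 [← ENNReal.add_halves (volume F)] at hsplit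
  exact (ENNReal.add_le_add_iff_right hne).1 hsplit

/-- **Propagation of smallness for real-analytic functions of one variable from a
measurable set** (Lemma 5.1 of the paper, after Apraiz–Escauriaza–Wang–Zhang).
`|F|` is one-dimensional Lebesgue measure; the sup bound is stated pointwise on
`[a, a+s]`. -/
theorem stmt_8 (ρ γ : ℝ) (hρ : ρ ∈ Set.Ioc (0 : ℝ) 1) (hγ : γ ∈ Set.Ioc (0 : ℝ) 1) :
    ∃ C : ℝ, 1 ≤ C ∧ ∃ h : ℝ, h ∈ Set.Ioo (0 : ℝ) 1 ∧
      ∀ a s M : ℝ, 0 < s → 0 < M →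
        ∀ g : ℝ → ℝ, ContDiff ℝ (⊤ : ℕ∞) g →
          (∀ x ∈ Set.Icc a (a + s), ∀ k : ℕ,
            |iteratedDeriv k g x| ≤ M * (Nat.factorial k) / (s * ρ) ^ k) →
          ∀ F : Set ℝ, MeasurableSet F → F ⊆ Set.Icc a (a + s) →
            ENNReal.ofReal (γ * s) ≤ volume F →
            ∀ x ∈ Set.Icc a (a + s),
              |g x| ≤ C * M ^ (1 - h) *
                ((1 / (volume F).toReal) * ∫ y in F, |g y|) ^ h := by
  obtain ⟨hρ0, hρ1⟩ := hρ
  obtain ⟨hγ0, hγ1⟩ := hγ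
  obtain ⟨N, hN⟩ := exists_nat_ge (24 / (γ / 2) * 2 / ρ)
  have hNpos : (0 : ℝ) < N := lt_of_lt_of_le (by positivity) hN
  have hNnat : 0 < N := by exact_mod_cast hNpos
  obtain ⟨C, hC, h, hh, H⟩ :=
    exists_rpow_bound_translate (η := γ / 2) (by linarith) (by linarith) N
  refine ⟨C * 2 ^ h, ?_, h, hh, ?_⟩
  · nlinarith [Real.one_le_rpow (x := 2) (by norm_num) hh.1.le]
  intro a s M hs hM g hg hb F hF hFs hFvol x hx
  have hcont : Continuous fun y => |g y| := hg.continuous.abs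
  have hfin : volume F ≠ ⊤ := ne_top_of_le_ne_top (by simp) (measure_mono hFs)
  have hpos : volume F ≠ 0 :=
    (lt_of_lt_of_le (ENNReal.ofReal_pos.2 (by positivity)) hFvol).ne'
  have hhalf := half_measure_le_sublevel hF hpos hfin (fun y => abs_nonneg (g y))
    hcont.measurable (hcont.continuousOn.integrableOn_Icc.mono_set hFs)
  set A := (1 / (volume F).toReal) * ∫ y in F, |g y| with hA
  have hA0 : 0 ≤ A := mul_nonneg (by positivity) (integral_nonneg fun y => abs_nonneg _)
  have hGvol : ENNReal.ofReal (γ / 2 * s) ≤ volume {y ∈ F | |g y| ≤ 2 * A} := by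
    refine le_trans ?_ hhalf
    rw [show γ / 2 * s = γ * s / 2 by ring, ENNReal.ofReal_div_of_pos (by norm_num)]
    simpa using ENNReal.div_le_div_right hFvol 2
  have hsubF : {y ∈ F | |g y| ≤ 2 * A} ⊆ Set.Icc a (a + s) := fun y hy => hFs hy.1
  obtain ⟨i, hi, hcell⟩ := exists_cell_measure_ge hs hNnat hsubF hGvol
  obtain ⟨j, hj, hxj⟩ := exists_cell_mem hs hNnat hx
  have hL : 0 < s / N := by positivity
  have hNL : N * (s / N) = s := by field_simp
  have hend : ∀ k < N, a ≤ a + k * (s / N) ∧ a + k * (s / N) + s / N ≤ a + s := by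
    intro k hk
    have hk' : (k : ℝ) + 1 ≤ N := by exact_mod_cast hk
    exact ⟨by linarith [mul_nonneg k.cast_nonneg hL.le], by nlinarith⟩
  have hMA : M * (2 * A / M) = 2 * A := by field_simp
  have hfinal := H a (a + s) (s / N) M (s * ρ) (2 * A / M) (a + i * (s / N)) (a + j * (s / N))
    hL hM (by
      rw [div_le_iff₀ hρ0] at hN
      rw [show 24 / (γ / 2) * (2 * (s / N)) = 24 / (γ / 2) * 2 * s / N by ring,
        div_le_iff₀ hNpos]
      nlinarith) (by positivity) g hg hb (hend i hi).1 (hend i hi).2 (hend j hj).1 (hend j hj).2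
    (by
      have h1 : |(j : ℝ) - i| ≤ N := by
        have hi' : (i : ℝ) ≤ N := by exact_mod_cast hi.le
        have hj' : (j : ℝ) ≤ N := by exact_mod_cast hj.le
        rw [abs_le]
        have hi0 : (0 : ℝ) ≤ i := i.cast_nonneg
        have hj0 : (0 : ℝ) ≤ j := j.cast_nonneg
        constructor <;> linarith
      rw [show a + j * (s / N) - (a + i * (s / N)) = (j - i) * (s / N) by ring, abs_mul,
        abs_of_pos hL]
      gcongr)
    (hcell.trans (measure_mono fun y hy => ⟨hy.2, by rw [hMA]; exact hy.1.2⟩)) x hxj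
  refine hfinal.trans_eq ?_
  rw [Real.div_rpow (by positivity) hM.le, Real.mul_rpow (by norm_num) hA0,
    Real.rpow_sub hM, Real.rpow_one]
  ring
end

section
/- Let α ∈ (0,1), 0 < a < b ≤ 1, and let η : (0,1] → ℝ be a three-times continuously differentiable function such that η(r) = r^{2−α} for r ∈ (0, (2a+b)/3], η(r) > 0 for r ∈ ((2a+b)/3, (a+2b)/3), and η(r) = (1−r) r^{−α} for r ∈ [(a+2b)/3, 1]. Set γ = sup_{r ∈ (0,1]} |η(r)| + 1 and, for T > 0, Θ(t) = (t(T−t))^{−4} and ξ(r,t) = Θ(t)(γ − η(r)) for (r,t) ∈ (0,1) × (0,T). Then there exist constants C > 0 and s₀ ≥ 1, depending only on α, a, b and η, such that for every T > 0, every n ∈ ℕ, every s ≥ s₀·max{1, T^{16}}, every f ∈ L²((0,1) × (0,T)), and every smooth function φ : [0,1] × [0,T] → ℝ with φ(0,t) = φ(1,t) = 0 for all t ∈ [0,T] and satisfying ∂_t φ − ∂_r(r^α ∂_r φ) + n² φ = f on (0,1) × (0,T), one has: s ∬_{(0,1)×(0,T)} Θ r^{α} (∂_r φ)² e^{−2sξ}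 dr dt + s³ ∬_{(0,1)×(0,T)} Θ³ r^{2−α} φ² e^{−2sξ} dr dt ≤ C ∬_{(0,1)×(0,T)} f² e^{−2sξ} dr dt + C s³ ∬_{(a,b)×(0,T)} Θ³ φ² e^{−2sξ} dr dt. -/
open MeasureTheory

/-- The time weight `Θ(t) = (t(T−t))^{−4}` of the Carleman estimate. -/
noncomputable def thetaWeight (T t : ℝ) : ℝ := ((t * (T - t)) ^ 4)⁻¹

/-- `γ = sup_{r ∈ (0,1]} |η(r)| + 1`. -/
noncomputable def gammaConst (η : ℝ → ℝ) : ℝ :=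
  sSup ((fun r => |η r|) '' Set.Ioc (0 : ℝ) 1) + 1

/-- The space-time Carleman weight `ξ(r,t) = Θ(t)(γ − η(r))`. -/
noncomputable def xiWeight (η : ℝ → ℝ) (T r t : ℝ) : ℝ :=
  thetaWeight T t * (gammaConst η - η r)

section

open Set Filter Topology

/-- The divergence theorem on an inner box, with the boundary terms estimated. -/
lemma setIntegral_Icc_le_of_divergence {T α : ℝ} {X Y P N : ℝ × ℝ → ℝ} {M r₂ ε : ℝ}
    (hM : 0 ≤ M) (hε : 0 < ε) (hε₁ : ε < 1 / 2) (hεT : ε < T / 2) (hε₂ : ε < 1 - r₂)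
    (hX : ContDiffOn ℝ 1 X (Ioo 0 1 ×ˢ Ioo 0 T)) (hY : ContDiffOn ℝ 1 Y (Ioo 0 1 ×ˢ Ioo 0 T))
    (hP : IntegrableOn P (Ioo 0 1 ×ˢ Ioo 0 T)) (hN : IntegrableOn N (Ioo 0 1 ×ˢ Ioo 0 T))
    (hN0 : ∀ x ∈ Ioo (0 : ℝ) 1 ×ˢ Ioo 0 T, 0 ≤ N x)
    (hdiv : ∀ x ∈ Ioo (0 : ℝ) 1 ×ˢ Ioo 0 T,
      fderiv ℝ X x (0, 1) + fderiv ℝ Y x (1, 0) + P x ≤ N x)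
    (hXb : ∀ x ∈ Ioo (0 : ℝ) 1 ×ˢ Ioo 0 T, |X x| ≤ M * (x.2 * (T - x.2)))
    (hY0 : ∀ x ∈ Ioo (0 : ℝ) 1 ×ˢ Ioo 0 T, Y x ≤ M * x.1 ^ α)
    (hY1 : ∀ x ∈ Ioo (0 : ℝ) 1 ×ˢ Ioo 0 T, r₂ < x.1 → -(M * (1 - x.1)) ≤ Y x) :
    ∫ x in Icc (ε, ε) (1 - ε, T - ε), P x ≤
      (∫ x in Ioo (0 : ℝ) 1 ×ˢ Ioo 0 T, N x) + M * T * (3 * ε + ε ^ α) := by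
  have hsub : Icc (ε, ε) (1 - ε, T - ε) ⊆ Ioo (0 : ℝ) 1 ×ˢ Ioo 0 T := by
    rintro ⟨r, t⟩ ⟨⟨h1, h2⟩, h3, h4⟩
    simp only at h1 h2 h3 h4
    exact ⟨⟨by linarith, by linarith⟩, by linarith, by linarith⟩
  have hopen : IsOpen (Ioo (0 : ℝ) 1 ×ˢ Ioo 0 T) := isOpen_Ioo.prod isOpen_Ioo
  have hmem : ∀ r t, ε ≤ r → r ≤ 1 - ε → ε ≤ t → t ≤ T - ε →
      (r, t) ∈ Ioo (0 : ℝ) 1 ×ˢ Ioo 0 T :=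
    fun r t h1 h2 h3 h4 => hsub ⟨⟨h1, h3⟩, h2, h4⟩
  have hcX := hX.continuousOn_fderiv_of_isOpen hopen le_rfl
  have hcY := hY.continuousOn_fderiv_of_isOpen hopen le_rfl
  have hcd : ContinuousOn (fun x => fderiv ℝ Y x (1, 0) + fderiv ℝ X x (0, 1))
      (Icc (ε, ε) (1 - ε, T - ε)) :=
    ((hcY.clm_apply continuousOn_const).add (hcX.clm_apply continuousOn_const)).mono hsub
  have hint := hcd.integrableOn_compact (μ := volume) isCompact_Icc
  have hmain := integral_divergence_prod_Icc_of_hasFDerivAt_of_le Y X (fderiv ℝ Y) (fderiv ℝ X)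
    (ε, ε) (1 - ε, T - ε) ⟨by simp only; linarith, by simp only; linarith⟩
    (hY.continuousOn.mono hsub) (hX.continuousOn.mono hsub)
    (fun x hx => ((hY.contDiffAt (hopen.mem_nhds (hmem x.1 x.2 hx.1.1.le hx.1.2.le hx.2.1.le
      hx.2.2.le))).differentiableAt one_ne_zero).hasFDerivAt)
    (fun x hx => ((hX.contDiffAt (hopen.mem_nhds (hmem x.1 x.2 hx.1.1.le hx.1.2.le hx.2.1.le
      hx.2.2.le))).differentiableAt one_ne_zero).hasFDerivAt) hint
  simp only at hmain
  have h1 : ∫ x in Icc (ε, ε) (1 - ε, T - ε), P x ≤ (∫ x in Icc (ε, ε) (1 - ε, T - ε), N x)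
      - ∫ x in Icc (ε, ε) (1 - ε, T - ε), (fderiv ℝ Y x (1, 0) + fderiv ℝ X x (0, 1)) := by
    rw [← integral_sub (hN.mono_set hsub) hint]
    refine setIntegral_mono_on (hP.mono_set hsub) ((hN.mono_set hsub).sub hint)
      measurableSet_Icc fun x hx => ?_
    have := hdiv x (hsub hx)
    linarith
  have h2 : ∫ x in Icc (ε, ε) (1 - ε, T - ε), N x ≤ ∫ x in Ioo (0 : ℝ) 1 ×ˢ Ioo 0 T, N x :=
    setIntegral_mono_set hN (ae_restrict_of_forall_mem (measurableSet_Ioo.prod measurableSet_Ioo)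
      hN0) (Filter.Eventually.of_forall hsub)
  have hXε : ∀ t, (t = ε ∨ t = T - ε) → |∫ r in ε..(1 - ε), X (r, t)| ≤ M * T * ε := by
    intro t ht
    have := intervalIntegral.norm_integral_le_of_norm_le_const (a := ε) (b := 1 - ε)
      (f := fun r => X (r, t)) (C := M * T * ε) (fun r hr => by
        rw [uIoc_of_le (by linarith)] at hr
        have hm := hmem r t hr.1.le hr.2 (by rcases ht with h | h <;> linarith)
          (by rcases ht with h | h <;> linarith)
        have h' := hXb _ hm
        rw [Real.norm_eq_abs]
        refine h'.trans ?_
        simp only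
        have : t * (T - t) ≤ T * ε := by rcases ht with h | h <;> subst h <;> nlinarith
        nlinarith)
    rw [Real.norm_eq_abs] at this
    refine this.trans ?_
    rw [abs_of_nonneg (by linarith)]
    have : 0 ≤ M * T * ε := by have : 0 ≤ T := by linarith
                               positivity
    nlinarith
  have hYi : ∀ r, ε ≤ r → r ≤ 1 - ε → IntervalIntegrable (fun t => Y (r, t)) volume ε (T - ε) := by
    intro r hr hr'
    refine ContinuousOn.intervalIntegrable_of_Icc (by linarith) ?_
    exact hY.continuousOn.comp (by fun_prop) fun t ht => hmem r t hr hr' ht.1 ht.2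
  have hYε : ∫ t in ε..(T - ε), Y (ε, t) ≤ M * T * ε ^ α := by
    refine (intervalIntegral.integral_mono_on (by linarith) (hYi ε le_rfl (by linarith))
      (intervalIntegrable_const (c := M * ε ^ α)) fun t ht =>
      hY0 _ (hmem ε t le_rfl (by linarith) ht.1 ht.2)).trans ?_
    rw [intervalIntegral.integral_const, smul_eq_mul]
    have : 0 ≤ M * ε ^ α := by positivity
    nlinarith
  have hY1ε : -(M * T * ε) ≤ ∫ t in ε..(T - ε), Y (1 - ε, t) := by
    have := intervalIntegral.integral_mono_on (by linarith)
      (intervalIntegrable_const (c := -(M * ε))) (hYi (1 - ε) (by linarith) le_rfl) fun t ht => by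
        have := hY1 _ (hmem (1 - ε) t (by linarith) le_rfl ht.1 ht.2) (by simp only; linarith)
        simp only [sub_sub_cancel] at this
        exact this
    refine le_trans ?_ this
    rw [intervalIntegral.integral_const, smul_eq_mul]
    have : 0 ≤ M * ε := by positivity
    nlinarith
  have hXa := abs_le.1 (hXε ε (Or.inl rfl))
  have hXc := abs_le.1 (hXε (T - ε) (Or.inr rfl))
  linarith [hXa.1, hXa.2, hXc.1, hXc.2]

/-- Integration of a pointwise divergence inequality over the open space-time rectangle, when the
boundary fluxes vanish or have a favourable sign in the limit. -/
lemma setIntegral_le_of_divergence {T α : ℝ} (hT : 0 < T) (hα : 0 < α)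
    {X Y P N : ℝ × ℝ → ℝ} {M r₂ : ℝ} (hM : 0 ≤ M) (hr₂ : r₂ < 1)
    (hX : ContDiffOn ℝ 1 X (Ioo 0 1 ×ˢ Ioo 0 T)) (hY : ContDiffOn ℝ 1 Y (Ioo 0 1 ×ˢ Ioo 0 T))
    (hP : IntegrableOn P (Ioo 0 1 ×ˢ Ioo 0 T)) (hN : IntegrableOn N (Ioo 0 1 ×ˢ Ioo 0 T))
    (hN0 : ∀ x ∈ Ioo (0 : ℝ) 1 ×ˢ Ioo 0 T, 0 ≤ N x)
    (hdiv : ∀ x ∈ Ioo (0 : ℝ) 1 ×ˢ Ioo 0 T,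
      fderiv ℝ X x (0, 1) + fderiv ℝ Y x (1, 0) + P x ≤ N x)
    (hXb : ∀ x ∈ Ioo (0 : ℝ) 1 ×ˢ Ioo 0 T, |X x| ≤ M * (x.2 * (T - x.2)))
    (hY0 : ∀ x ∈ Ioo (0 : ℝ) 1 ×ˢ Ioo 0 T, Y x ≤ M * x.1 ^ α)
    (hY1 : ∀ x ∈ Ioo (0 : ℝ) 1 ×ˢ Ioo 0 T, r₂ < x.1 → -(M * (1 - x.1)) ≤ Y x) :
    ∫ x in Ioo (0 : ℝ) 1 ×ˢ Ioo 0 T, P x ≤ ∫ x in Ioo (0 : ℝ) 1 ×ˢ Ioo 0 T, N x := by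
  obtain ⟨δ, hδ, hδ'⟩ : ∃ δ, 0 < δ ∧ δ < min (1 / 2) (min (T / 2) (1 - r₂)) :=
    exists_between (by simp only [lt_min_iff]; exact ⟨by norm_num, by linarith, by linarith⟩)
  simp only [lt_min_iff] at hδ'
  obtain ⟨hδ₁, hδT, hδ₂⟩ := hδ'
  set ε : ℕ → ℝ := fun k => δ * (1 / ((k : ℝ) + 1)) with hεdef
  have hεpos : ∀ k, 0 < ε k := fun k => by simp only [hεdef]; positivity
  have hεle : ∀ k, ε k ≤ δ := fun k => by
    have : 1 / ((k : ℝ) + 1) ≤ 1 := by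
      rw [div_le_one (by positivity)]; linarith [(Nat.cast_nonneg k : (0 : ℝ) ≤ k)]
    simp only [hεdef]; nlinarith
  have hεanti : Antitone ε := fun i j hij => by
    simp only [hεdef]
    gcongr
  have hεlim : Tendsto ε atTop (𝓝 0) := by
    simpa [hεdef] using (tendsto_one_div_add_atTop_nhds_zero_nat (𝕜 := ℝ)).const_mul δ
  have hmono : Monotone fun k => Icc (ε k, ε k) (1 - ε k, T - ε k) := by
    intro i j hij
    have := hεanti hij
    exact Icc_subset_Icc ⟨this, this⟩ ⟨by simp only; linarith, by simp only; linarith⟩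
  have hUnion : ⋃ k, Icc (ε k, ε k) (1 - ε k, T - ε k) = Ioo (0 : ℝ) 1 ×ˢ Ioo 0 T := by
    ext ⟨r, t⟩
    simp only [mem_iUnion, mem_Icc, Prod.mk_le_mk, mem_prod, mem_Ioo]
    constructor
    · rintro ⟨k, ⟨h1, h2⟩, h3, h4⟩
      have := hεpos k
      exact ⟨⟨by linarith, by linarith⟩, by linarith, by linarith⟩
    · rintro ⟨⟨h1, h2⟩, h3, h4⟩
      have hev := ((hεlim.eventually (gt_mem_nhds h1)).and (hεlim.eventually (gt_mem_nhds h3))).and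
        ((hεlim.eventually (gt_mem_nhds (sub_pos.2 h2))).and
          (hεlim.eventually (gt_mem_nhds (sub_pos.2 h4))))
      obtain ⟨k, ⟨h5, h6⟩, h7, h8⟩ := hev.exists
      exact ⟨k, ⟨h5.le, h6.le⟩, by linarith, by linarith⟩
  have hlim := tendsto_setIntegral_of_monotone (μ := volume) (f := P)
    (fun k => (measurableSet_Icc : MeasurableSet (Icc (ε k, ε k) (1 - ε k, T - ε k)))) hmono
    (by rw [hUnion]; exact hP)
  rw [hUnion] at hlim
  have herr : Tendsto (fun k => (∫ x in Ioo (0 : ℝ) 1 ×ˢ Ioo 0 T, N x)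
      + M * T * (3 * ε k + ε k ^ α)) atTop (𝓝 (∫ x in Ioo (0 : ℝ) 1 ×ˢ Ioo 0 T, N x)) := by
    have h1 : Tendsto (fun k => ε k ^ α) atTop (𝓝 0) := by
      have := hεlim.rpow_const (p := α) (Or.inr hα.le)
      rwa [Real.zero_rpow hα.ne'] at this
    simpa using (((hεlim.const_mul 3).add h1).const_mul (M * T)).const_add
      (∫ x in Ioo (0 : ℝ) 1 ×ˢ Ioo 0 T, N x)
  exact le_of_tendsto_of_tendsto' hlim herr fun k =>
    setIntegral_Icc_le_of_divergence hM (hεpos k) ((hεle k).trans_lt hδ₁)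
      ((hεle k).trans_lt hδT) ((hεle k).trans_lt hδ₂) hX hY hP hN hN0 hdiv hXb hY0 hY1

/-- Coercivity of the Carleman quadratic form in `(z, ∂_r z)`, including a Hardy term. Here `w`,
`v`, `wm`, `w2` stand for the powers `r^α`, `r^(α-1)`, `r^(α-2)`, `r^(2-α)`. -/
lemma carleman_quadratic_form_lower_bound {α w v wm w2 z y th th1 th2 ε e g p q p2 h χ χ1 B D ι N : ℝ}
    (hα : α ∈ Ioo (0 : ℝ) 1) (hw : 0 < w) (hwm : 0 < wm) (hw2 : 0 < w2) (hv : v ^ 2 = w * wm)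
    (hww : w2 * wm = 1) (hε : 0 < ε) (hε1 : ε ≤ 1) (hN : 0 ≤ N)
    (hth : 1 ≤ ε * th) (hth1 : |th1| ≤ ε * th ^ 2) (hth2 : |th2| ≤ ε * th ^ 2)
    (hB : 1 ≤ B) (hD : 0 ≤ D) (hι : 0 ≤ ι)
    (hh0 : 0 ≤ h) (hhB : h ≤ B) (hg : α ≤ g + B * χ) (hg2 : α * w2 ≤ 2 * w * e ^ 2 * g + D * ι)
    (hcr : w * (p2 + B * χ1) ^ 2 ≤ D * w2) (hq0 : 0 ≤ q) (hq : q ≤ D * w2)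
    (hχ0 : 0 ≤ χ) (hχι : χ ≤ ι) (hχp : |χ1 * p| ≤ B ^ 2 * ι) (hχq : χ * q ≤ B ^ 2 * ι)
    (hε2 : ε * (2 * D / α + 4 * D + B / 2) ≤ α / 2) (hε3 : ε * B / 2 ≤ α * (1 - α) ^ 2 / 8) :
    α * th * w * y ^ 2 + α / 2 * th ^ 3 * w2 * z ^ 2
        - (D + B + 4 * B ^ 3 + 2 * B ^ 2) * th ^ 3 * ι * z ^ 2 ≤
      y ^ 2 * (2 * th * w * (g + B * χ)) + 2 * th * w * (p2 + B * χ1) * z * y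
        + z ^ 2 * (-th2 * h + 4 * th * th1 * q + 2 * th ^ 3 * (w * e ^ 2 * g) - B * th1 * χ
          - 2 * B * th ^ 2 * (χ1 * p) + 2 * B * th * χ * (N + th1 * h - th ^ 2 * q))
        - α * (1 - α) / 4 * th * (-(1 - α) * wm * z ^ 2 + 2 * v * z * y) := by
  obtain ⟨hα0, hα1⟩ := hα
  have hth1' : 1 ≤ th := by
    have : 0 < th := pos_of_mul_pos_right (by linarith) hε.le
    nlinarith
  have hth0 : 0 < th := by linarith
  have hz : 0 ≤ z ^ 2 := sq_nonneg z
  have hβ : 0 < 1 - α := by linarith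
  -- gradient term
  have e1 : 2 * α * th * w * y ^ 2 ≤ y ^ 2 * (2 * th * w * (g + B * χ)) := by
    have : 0 ≤ 2 * th * w * y ^ 2 := by positivity
    linear_combination mul_le_mul_of_nonneg_left hg this
  -- cross term
  have e2 : -(α / 2 * th * w * y ^ 2) - ε * (2 * D / α) * th ^ 3 * w2 * z ^ 2 ≤
      2 * th * w * (p2 + B * χ1) * z * y := by
    set m := p2 + B * χ1
    have a1 : -(α / 2 * y ^ 2) - 2 / α * m ^ 2 * z ^ 2 ≤ 2 * m * z * y := by
      have : 0 ≤ (α / 2) * (y + 2 / α * (m * z)) ^ 2 := by positivity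
      have e : (α / 2) * (y + 2 / α * (m * z)) ^ 2 =
        α / 2 * y ^ 2 + 2 / α * m ^ 2 * z ^ 2 + 2 * m * z * y := by field_simp; ring
      linarith
    have a2 := mul_le_mul_of_nonneg_left a1 (by positivity : 0 ≤ th * w)
    have a3 := mul_le_mul_of_nonneg_left hcr (by positivity : 0 ≤ th * (2 / α) * z ^ 2)
    have a4 : th ≤ ε * th ^ 3 := by
      linear_combination mul_le_mul_of_nonneg_left hth hth0.le +
        mul_le_mul_of_nonneg_left hth1' (by positivity : 0 ≤ ε * th ^ 2)
    have a5 := mul_le_mul_of_nonneg_right a4 (by positivity : 0 ≤ (2 / α) * D * w2 * z ^ 2)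
    linear_combination a2 + a3 + a5
  -- second time derivative, through Hardy
  have hardy : 2 * th ^ 2 ≤ th * wm + th ^ 3 * w2 := by
    have : 0 ≤ th * wm * (1 - th * w2) ^ 2 := by positivity
    have e : th * wm * (1 - th * w2) ^ 2 = th * wm - 2 * th ^ 2 * (w2 * wm)
      + th ^ 3 * w2 * (w2 * wm) := by ring
    rw [hww] at e
    linarith
  have e3 : -(ε * B / 2 * th * wm * z ^ 2) - ε * (B / 2) * th ^ 3 * w2 * z ^ 2 ≤
      z ^ 2 * (-th2 * h) := by
    have a1 : th2 * h ≤ ε * th ^ 2 * B :=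
      (mul_le_mul_of_nonneg_right ((le_abs_self _).trans hth2) hh0).trans
        (mul_le_mul_of_nonneg_left hhB (by positivity))
    have a2 := mul_le_mul_of_nonneg_left a1 hz
    have a3 := mul_le_mul_of_nonneg_left hardy (by positivity : 0 ≤ ε * B / 2 * z ^ 2)
    linear_combination a2 + a3
  have e4 : -(ε * (4 * D) * th ^ 3 * w2 * z ^ 2) ≤ z ^ 2 * (4 * th * th1 * q) := by
    have a1 : -(ε * th ^ 2) ≤ th1 := (abs_le.1 hth1).1
    have a2 := mul_le_mul_of_nonneg_right a1 (by positivity : 0 ≤ 4 * th * q * z ^ 2)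
    have a3 := mul_le_mul_of_nonneg_left hq (by positivity : 0 ≤ 4 * ε * th ^ 3 * z ^ 2)
    linear_combination a2 + a3
  have e5 : α * th ^ 3 * w2 * z ^ 2 - D * th ^ 3 * ι * z ^ 2 ≤
      z ^ 2 * (2 * th ^ 3 * (w * e ^ 2 * g)) := by
    linear_combination mul_le_mul_of_nonneg_left hg2 (by positivity : 0 ≤ th ^ 3 * z ^ 2)
  have ht2 : |th1| ≤ th ^ 2 := hth1.trans (mul_le_of_le_one_left (sq_nonneg th) hε1)
  have ht23 : th ^ 2 ≤ th ^ 3 := pow_le_pow_right₀ hth1' (by norm_num)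
  have e6 : -(B * th ^ 3 * ι * z ^ 2) ≤ z ^ 2 * (-B * th1 * χ) := by
    have a1 : th1 * χ ≤ th ^ 3 * ι :=
      (mul_le_mul_of_nonneg_right (((le_abs_self _).trans ht2).trans ht23) hχ0).trans
        (mul_le_mul_of_nonneg_left hχι (by positivity))
    linear_combination mul_le_mul_of_nonneg_left a1 (by positivity : 0 ≤ B * z ^ 2)
  have e7 : -(2 * B ^ 3 * th ^ 3 * ι * z ^ 2) ≤ z ^ 2 * (-2 * B * th ^ 2 * (χ1 * p)) := by
    have a1 : χ1 * p ≤ B ^ 2 * ι := (le_abs_self _).trans hχp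
    have a2 := mul_le_mul_of_nonneg_left a1 (by positivity : 0 ≤ 2 * B * th ^ 2 * z ^ 2)
    have a3 := mul_le_mul_of_nonneg_right ht23 (by positivity : 0 ≤ 2 * B ^ 3 * ι * z ^ 2)
    linear_combination a2 + a3
  have e8 : -(2 * B ^ 2 * th ^ 3 * ι * z ^ 2) - 2 * B ^ 3 * th ^ 3 * ι * z ^ 2 ≤
      z ^ 2 * (2 * B * th * χ * (N + th1 * h - th ^ 2 * q)) := by
    have b0 : 0 ≤ z ^ 2 * (2 * B * th * χ * N) := by positivity
    have a1 : -(th ^ 2 * B) ≤ th1 * h := by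
      have : |th1 * h| ≤ th ^ 2 * B := by
        rw [abs_mul, abs_of_nonneg hh0]
        exact mul_le_mul ht2 hhB hh0 (by positivity)
      exact (abs_le.1 this).1
    have a2 := mul_le_mul_of_nonneg_left a1 (by positivity : 0 ≤ z ^ 2 * (2 * B * th * χ))
    have a3 := mul_le_mul_of_nonneg_left hχι (by positivity : 0 ≤ z ^ 2 * (2 * B ^ 2 * th ^ 3))
    have a4 := mul_le_mul_of_nonneg_left hχq (by positivity : 0 ≤ z ^ 2 * (2 * B * th ^ 3))
    linear_combination a2 + a3 + a4 + b0
  have e9 : α * (1 - α) ^ 2 / 8 * th * wm * z ^ 2 - α / 2 * th * w * y ^ 2 ≤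
      -(α * (1 - α) / 4 * th * (-(1 - α) * wm * z ^ 2 + 2 * v * z * y)) := by
    have a1 : 2 * v * z * y ≤ (1 - α) / 2 * wm * z ^ 2 + 2 / (1 - α) * w * y ^ 2 := by
      have : 0 ≤ (1 - α) / 2 * wm * (z - 2 / (1 - α) * (w2 * v) * y) ^ 2 := by positivity
      have e : (1 - α) / 2 * wm * (z - 2 / (1 - α) * (w2 * v) * y) ^ 2 =
          (1 - α) / 2 * wm * z ^ 2 - 2 * v * z * y * (w2 * wm)
          + 2 / (1 - α) * (w2 * wm) * w2 * v ^ 2 * y ^ 2 := by field_simp; ring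
      rw [hv, hww] at e
      have e' : 2 / (1 - α) * 1 * w2 * (w * wm) * y ^ 2 =
        2 / (1 - α) * w * y ^ 2 * (w2 * wm) := by ring
      rw [hww] at e'
      linarith
    have a2 := mul_le_mul_of_nonneg_left a1 (by positivity : 0 ≤ α * (1 - α) / 4 * th)
    have e : α * (1 - α) / 4 * th * ((1 - α) / 2 * wm * z ^ 2 + 2 / (1 - α) * w * y ^ 2) =
      α * (1 - α) ^ 2 / 8 * th * wm * z ^ 2 + α / 2 * th * w * y ^ 2 := by field_simp; ring
    rw [e] at a2
    linear_combination a2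
  have f1 := mul_le_mul_of_nonneg_right hε2 (by positivity : 0 ≤ th ^ 3 * w2 * z ^ 2)
  have f2 := mul_le_mul_of_nonneg_right hε3 (by positivity : 0 ≤ th * wm * z ^ 2)
  linear_combination e1 + e2 + e3 + e4 + e5 + e6 + e7 + e8 + e9 + f1 + f2

/-- Spatial data of the Carleman estimate: `h` is the (positive) spatial weight, `-e`, `-e₁`, `-e₂`
are its derivatives, and `χ` is a cut-off function supported in the observation region. -/
structure SpatialWeight (α a b r₂ B D : ℝ) (h e e₁ e₂ χ χ₁ : ℝ → ℝ) : Prop where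
  one_le_B : 1 ≤ B
  D_nonneg : 0 ≤ D
  r₂_lt : r₂ < 1
  a_pos : 0 < a
  hasDerivAt_h : ∀ r ∈ Ioo (0 : ℝ) 1, HasDerivAt h (-e r) r
  hasDerivAt_e : ∀ r ∈ Ioo (0 : ℝ) 1, HasDerivAt e (e₁ r) r
  hasDerivAt_e₁ : ∀ r ∈ Ioo (0 : ℝ) 1, HasDerivAt e₁ (e₂ r) r
  hasDerivAt_χ : ∀ r ∈ Ioo (0 : ℝ) 1, HasDerivAt χ (χ₁ r) r
  contDiffOn_h : ContDiffOn ℝ 2 h (Ioo 0 1)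
  contDiffOn_e : ContDiffOn ℝ 2 e (Ioo 0 1)
  contDiffOn_e₁ : ContDiffOn ℝ 1 e₁ (Ioo 0 1)
  contDiffOn_χ : ContDiffOn ℝ 1 χ (Ioo 0 1)
  one_le_h : ∀ r ∈ Ioo (0 : ℝ) 1, 1 ≤ h r
  h_le : ∀ r ∈ Ioo (0 : ℝ) 1, h r ≤ B
  abs_e_le : ∀ r ∈ Ioo (0 : ℝ) 1, |e r| ≤ B
  abs_flux_deriv_le : ∀ r ∈ Ioo (0 : ℝ) 1, |α * r ^ (α - 1) * e r + r ^ α * e₁ r| ≤ B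
  coercive : ∀ r ∈ Ioo (0 : ℝ) 1,
    α ≤ α * r ^ (α - 1) * e r + 2 * r ^ α * e₁ r + B * χ r
  coercive_zeroth : ∀ r ∈ Ioo (0 : ℝ) 1, α * r ^ (2 - α) ≤
    2 * r ^ α * e r ^ 2 * (α * r ^ (α - 1) * e r + 2 * r ^ α * e₁ r)
      + D * (Ioo a b).indicator 1 r
  cross_le : ∀ r ∈ Ioo (0 : ℝ) 1,
    r ^ α * (α * (α - 1) * r ^ (α - 2) * e r + 2 * α * r ^ (α - 1) * e₁ r + r ^ α * e₂ r
      + B * χ₁ r) ^ 2 ≤ D * r ^ (2 - α)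
  sq_le : ∀ r ∈ Ioo (0 : ℝ) 1, r ^ α * e r ^ 2 ≤ D * r ^ (2 - α)
  χ_nonneg : ∀ r ∈ Ioo (0 : ℝ) 1, 0 ≤ χ r
  χ_le : ∀ r ∈ Ioo (0 : ℝ) 1, χ r ≤ (Ioo a b).indicator 1 r
  abs_χ₁_le : ∀ r ∈ Ioo (0 : ℝ) 1, |χ₁ r| ≤ B * (Ioo a b).indicator 1 r
  e_nonpos : ∀ r ∈ Ioo (0 : ℝ) 1, r₂ < r → e r ≤ 0

/-- Temporal data of the Carleman estimate: the large singular weight `θ` and its two derivatives. -/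
structure TemporalWeight (T ε m : ℝ) (θ θ₁ θ₂ : ℝ → ℝ) : Prop where
  T_pos : 0 < T
  ε_pos : 0 < ε
  ε_le : ε ≤ 1
  m_nonneg : 0 ≤ m
  hasDerivAt_θ : ∀ t ∈ Ioo (0 : ℝ) T, HasDerivAt θ (θ₁ t) t
  hasDerivAt_θ₁ : ∀ t ∈ Ioo (0 : ℝ) T, HasDerivAt θ₁ (θ₂ t) t
  contDiffOn_θ : ContDiffOn ℝ 2 θ (Ioo 0 T)
  contDiffOn_θ₁ : ContDiffOn ℝ 1 θ₁ (Ioo 0 T)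
  one_le : ∀ t ∈ Ioo (0 : ℝ) T, 1 ≤ ε * θ t
  abs_θ₁_le : ∀ t ∈ Ioo (0 : ℝ) T, |θ₁ t| ≤ ε * θ t ^ 2
  abs_θ₂_le : ∀ t ∈ Ioo (0 : ℝ) T, |θ₂ t| ≤ ε * θ t ^ 2
  decay : ∀ t ∈ Ioo (0 : ℝ) T, 1 ≤ m * (t * (T - t)) * θ t

lemma TemporalWeight.one_le_θ {T ε m : ℝ} {θ θ₁ θ₂ : ℝ → ℝ} (ht : TemporalWeight T ε m θ θ₁ θ₂)
    {t : ℝ} (h : t ∈ Ioo (0 : ℝ) T) : 1 ≤ θ t := by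
  have h1 := ht.one_le t h
  have h2 := ht.ε_pos
  have : 0 < θ t := pos_of_mul_pos_right (by linarith) h2.le
  nlinarith [ht.ε_le]

lemma hasDerivAt_rpow_const_of_pos {r : ℝ} (hr : 0 < r) (p : ℝ) :
    HasDerivAt (fun x : ℝ => x ^ p) (p * r ^ (p - 1)) r := by
  simpa using Real.hasDerivAt_rpow_const (x := r) (p := p) (Or.inl hr.ne')

/-- The time component of the Carleman flux. -/
noncomputable def timeFlux (α B N : ℝ) (h e χ θ θ₁ : ℝ → ℝ) (z zr : ℝ → ℝ → ℝ) (r t : ℝ) : ℝ :=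
  r ^ α * zr r t ^ 2 + (N + θ₁ t * h r - θ t ^ 2 * (r ^ α * e r ^ 2)) * z r t ^ 2
    + B * θ t * χ r * z r t ^ 2

/-- The space component of the Carleman flux. -/
noncomputable def spaceFlux (α B N : ℝ) (h e e₁ χ θ θ₁ : ℝ → ℝ) (z zr zt : ℝ → ℝ → ℝ)
    (r t : ℝ) : ℝ :=
  -(2 * (r ^ α * zr r t * zt r t)) - 2 * θ t * (r ^ α * e r) * (r ^ α * zr r t ^ 2)
    - 2 * θ t * (r ^ α * (α * r ^ (α - 1) * e r + r ^ α * e₁ r) * (z r t * zr r t))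
    + 2 * θ t * ((N + θ₁ t * h r - θ t ^ 2 * (r ^ α * e r ^ 2)) * (r ^ α * e r) * z r t ^ 2)
    - 2 * B * θ t * (χ r * r ^ α * (z r t * zr r t))
    + 2 * B * θ t ^ 2 * (χ r * (r ^ α * e r) * z r t ^ 2)
    + α * (1 - α) / 4 * θ t * (r ^ (α - 1) * z r t ^ 2)

/-- The pointwise Carleman inequality in divergence form. -/
lemma carleman_pointwise {α a b r₂ B D T ε m N : ℝ} {h e e₁ e₂ χ χ₁ θ θ₁ θ₂ : ℝ → ℝ}
    (hα : α ∈ Ioo (0 : ℝ) 1) (hs : SpatialWeight α a b r₂ B D h e e₁ e₂ χ χ₁)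
    (ht : TemporalWeight T ε m θ θ₁ θ₂) (hN : 0 ≤ N)
    (hε2 : ε * (2 * D / α + 4 * D + B / 2) ≤ α / 2) (hε3 : ε * B / 2 ≤ α * (1 - α) ^ 2 / 8)
    {r t : ℝ} (hr : r ∈ Ioo (0 : ℝ) 1) (htt : t ∈ Ioo 0 T)
    {z zr zt : ℝ → ℝ → ℝ} {zrr zrt F : ℝ}
    (hz_r : HasDerivAt (fun x => z x t) (zr r t) r) (hz_t : HasDerivAt (fun τ => z r τ) (zt r t) t)
    (hzr_r : HasDerivAt (fun x => zr x t) zrr r) (hzr_t : HasDerivAt (fun τ => zr r τ) zrt t)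
    (hzt_r : HasDerivAt (fun x => zt x t) zrt r)
    (hF : F = -(r ^ α * zrr + α * r ^ (α - 1) * zr r t)
      + (N + θ₁ t * h r - θ t ^ 2 * (r ^ α * e r ^ 2)) * z r t + zt r t
      + 2 * θ t * (r ^ α * e r) * zr r t
      + θ t * (α * r ^ (α - 1) * e r + r ^ α * e₁ r) * z r t) :
    ∃ X' Y', HasDerivAt (fun τ => timeFlux α B N h e χ θ θ₁ z zr r τ) X' t ∧
      HasDerivAt (fun x => spaceFlux α B N h e e₁ χ θ θ₁ z zr zt x t) Y' r ∧
      X' + Y' + (α * θ t * r ^ α * zr r t ^ 2 + α / 2 * θ t ^ 3 * r ^ (2 - α) * z r t ^ 2) ≤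
        2 * F ^ 2 + (D + B + 4 * B ^ 3 + 3 * B ^ 2) * θ t ^ 3 * (Ioo a b).indicator 1 r
          * z r t ^ 2 := by
  have hr0 : 0 < r := hr.1
  have hw := hasDerivAt_rpow_const_of_pos hr0 α
  have hv := hasDerivAt_rpow_const_of_pos hr0 (α - 1)
  rw [show α - 1 - 1 = α - 2 by ring] at hv
  have he := hs.hasDerivAt_e r hr
  have he1 := hs.hasDerivAt_e₁ r hr
  have hh := hs.hasDerivAt_h r hr
  have hχ := hs.hasDerivAt_χ r hr
  have hθ := ht.hasDerivAt_θ t htt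
  have hθ1 := ht.hasDerivAt_θ₁ t htt
  have hVt := ((hθ1.mul_const (h r)).const_add N).sub ((hθ.pow 2).mul_const (r ^ α * e r ^ 2))
  have hVr := ((hh.const_mul (θ₁ t)).const_add N).sub ((hw.mul (he.pow 2)).const_mul (θ t ^ 2))
  have hp := hw.mul he
  have hp1 := ((hv.const_mul α).mul he).add (hw.mul he1)
  have hX := (((hzr_t.pow 2).const_mul (r ^ α)).add (hVt.mul (hz_t.pow 2))).add
    (((hθ.const_mul B).mul_const (χ r)).mul (hz_t.pow 2))
  have hY := (((((((hw.mul hzr_r).mul hzt_r).const_mul 2).neg.sub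
    ((hp.const_mul (2 * θ t)).mul (hw.mul (hzr_r.pow 2)))).sub
    (((hw.mul hp1).mul (hz_r.mul hzr_r)).const_mul (2 * θ t))).add
    (((hVr.mul hp).mul (hz_r.pow 2)).const_mul (2 * θ t))).sub
    (((hχ.mul hw).mul (hz_r.mul hzr_r)).const_mul (2 * B * θ t))).add
    (((hχ.mul hp).mul (hz_r.pow 2)).const_mul (2 * B * θ t ^ 2)) |>.add
    ((hv.mul (hz_r.pow 2)).const_mul (α * (1 - α) / 4 * θ t))
  refine ⟨_, _, hX, hY, ?_⟩
  have hw0 : 0 < r ^ α := Real.rpow_pos_of_pos hr0 _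
  have hwm0 : 0 < r ^ (α - 2) := Real.rpow_pos_of_pos hr0 _
  have hw20 : 0 < r ^ (2 - α) := Real.rpow_pos_of_pos hr0 _
  have hvv : (r ^ (α - 1)) ^ 2 = r ^ α * r ^ (α - 2) := by
    rw [← Real.rpow_natCast, ← Real.rpow_mul hr0.le, ← Real.rpow_add hr0]
    congr 1; push_cast; ring
  have hww : r ^ (2 - α) * r ^ (α - 2) = 1 := by
    rw [← Real.rpow_add hr0]; simp
  have hw1 : r ^ α ≤ 1 := Real.rpow_le_one hr0.le hr.2.le hα.1.le
  have hι0 : 0 ≤ (Ioo a b).indicator (1 : ℝ → ℝ) r := indicator_nonneg (by simp) r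
  have hι1 : (Ioo a b).indicator (1 : ℝ → ℝ) r ≤ 1 := indicator_le_self' (by simp) r
  have hB := hs.one_le_B
  have heB := hs.abs_e_le r hr
  have he2B : e r ^ 2 ≤ B ^ 2 := sq_le_sq' (abs_le.1 heB).1 (abs_le.1 heB).2
  have hχp : |χ₁ r * (r ^ α * e r)| ≤ B ^ 2 * (Ioo a b).indicator 1 r := by
    have h1 : |r ^ α * e r| ≤ B := by
      rw [abs_mul, abs_of_pos hw0]
      calc r ^ α * |e r| ≤ 1 * B := by gcongr
        _ = B := one_mul B
    rw [abs_mul]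
    calc |χ₁ r| * |r ^ α * e r| ≤ (B * (Ioo a b).indicator 1 r) * B :=
          mul_le_mul (hs.abs_χ₁_le r hr) h1 (abs_nonneg _) (by positivity)
      _ = _ := by ring
  have hχq : χ r * (r ^ α * e r ^ 2) ≤ B ^ 2 * (Ioo a b).indicator 1 r := by
    calc χ r * (r ^ α * e r ^ 2) ≤ (Ioo a b).indicator 1 r * (1 * B ^ 2) := by
          have := hs.χ_le r hr
          gcongr
      _ = _ := by ring
  have key := carleman_quadratic_form_lower_bound (z := z r t) (y := zr r t) hα hw0 hwm0 hw20 hvv hww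
    ht.ε_pos ht.ε_le hN (ht.one_le t htt) (ht.abs_θ₁_le t htt) (ht.abs_θ₂_le t htt) hB hs.D_nonneg
    hι0 (zero_le_one.trans (hs.one_le_h r hr)) (hs.h_le r hr) (hs.coercive r hr)
    (hs.coercive_zeroth r hr) (hs.cross_le r hr) (by positivity) (hs.sq_le r hr)
    (hs.χ_nonneg r hr) (hs.χ_le r hr) hχp hχq hε2 hε3
  have hθ0 := ht.one_le_θ htt
  have hobs : 2 * B * θ t * χ r * z r t * F ≤
      F ^ 2 + B ^ 2 * θ t ^ 3 * (Ioo a b).indicator 1 r * z r t ^ 2 := by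
    have h1 : χ r ^ 2 ≤ (Ioo a b).indicator 1 r := by
      have := hs.χ_le r hr
      have := hs.χ_nonneg r hr
      nlinarith
    have h2 : θ t ^ 2 ≤ θ t ^ 3 := pow_le_pow_right₀ hθ0 (by norm_num)
    have h3 : θ t ^ 2 * χ r ^ 2 ≤ θ t ^ 3 * (Ioo a b).indicator 1 r := by gcongr
    have h4 := mul_le_mul_of_nonneg_left h3 (by positivity : 0 ≤ B ^ 2 * z r t ^ 2)
    linear_combination h4 + sq_nonneg (F - B * θ t * χ r * z r t)
  have hA2 := sq_nonneg (-(r ^ α * zrr + α * r ^ (α - 1) * zr r t)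
      + (N + θ₁ t * h r - θ t ^ 2 * (r ^ α * e r ^ 2)) * z r t)
  have hB2 := sq_nonneg (zt r t + 2 * θ t * (r ^ α * e r) * zr r t
      + θ t * (α * r ^ (α - 1) * e r + r ^ α * e₁ r) * z r t)
  simp only [Pi.mul_apply, Pi.add_apply, Pi.pow_apply, Pi.sub_apply]
  generalize r ^ α = w at *
  generalize r ^ (α - 1) = v at *
  generalize r ^ (α - 2) = wm at *
  generalize r ^ (2 - α) = w2 at *
  generalize (Ioo a b).indicator (1 : ℝ → ℝ) r = ι at *
  subst hF
  push_cast
  linear_combination key + hobs + hA2 + hB2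

lemma abs_mul_le_of_scaled {c y s C A : ℝ} (hs : 0 < s) (hc : |c| ≤ C * s)
    (hy : s * |y| ≤ A) : |c * y| ≤ C * A := by
  have hC : 0 ≤ C := nonneg_of_mul_nonneg_left ((abs_nonneg c).trans hc) hs
  rw [abs_mul]
  calc |c| * |y| ≤ C * s * |y| := by gcongr
    _ = C * (s * |y|) := by ring
    _ ≤ C * A := by gcongr

lemma abs_zeroth_coefficient_le {α a b r₂ B D T ε m N : ℝ} {h e e₁ e₂ χ χ₁ θ θ₁ θ₂ : ℝ → ℝ}
    (hα : α ∈ Ioo (0 : ℝ) 1) (hs : SpatialWeight α a b r₂ B D h e e₁ e₂ χ χ₁)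
    (ht : TemporalWeight T ε m θ θ₁ θ₂) (hN : 0 ≤ N)
    {r t : ℝ} (hr : r ∈ Ioo (0 : ℝ) 1) (htt : t ∈ Ioo 0 T) :
    |N + θ₁ t * h r - θ t ^ 2 * (r ^ α * e r ^ 2)| ≤ (N + B + B ^ 2) * θ t ^ 2 := by
  have hθ := ht.one_le_θ htt
  have hB := hs.one_le_B
  have hw0 : 0 < r ^ α := Real.rpow_pos_of_pos hr.1 _
  have hw1 : r ^ α ≤ 1 := Real.rpow_le_one hr.1.le hr.2.le hα.1.le
  have he := abs_le.1 (hs.abs_e_le r hr)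
  have h1 : |θ₁ t * h r| ≤ θ t ^ 2 * B := by
    rw [abs_mul]
    refine mul_le_mul ((ht.abs_θ₁_le t htt).trans (mul_le_of_le_one_left (sq_nonneg _) ht.ε_le)) ?_
      (abs_nonneg _) (sq_nonneg _)
    rw [abs_of_nonneg (zero_le_one.trans (hs.one_le_h r hr))]
    exact hs.h_le r hr
  have h2 : r ^ α * e r ^ 2 ≤ 1 * B ^ 2 := by
    have := sq_le_sq' he.1 he.2
    gcongr
  have h3 : 0 ≤ r ^ α * e r ^ 2 := by positivity
  have h4 : 1 ≤ θ t ^ 2 := one_le_pow₀ hθ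
  have h5 := abs_le.1 h1
  rw [abs_le]
  constructor <;> nlinarith [mul_le_mul_of_nonneg_left h2 (sq_nonneg (θ t)),
    mul_nonneg (sq_nonneg (θ t)) h3, mul_le_mul_of_nonneg_left h4 hN,
    mul_nonneg (sq_nonneg (θ t)) (sq_nonneg B)]

lemma abs_timeFlux_le {α a b r₂ B D T ε m N M : ℝ} {h e e₁ e₂ χ χ₁ θ θ₁ θ₂ : ℝ → ℝ}
    (hα : α ∈ Ioo (0 : ℝ) 1) (hs : SpatialWeight α a b r₂ B D h e e₁ e₂ χ χ₁)
    (ht : TemporalWeight T ε m θ θ₁ θ₂) (hN : 0 ≤ N)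
    {r t : ℝ} (hr : r ∈ Ioo (0 : ℝ) 1) (htt : t ∈ Ioo 0 T) {z zr : ℝ → ℝ → ℝ}
    (hz : θ t ^ 3 * |z r t| ≤ M) (hzr : θ t ^ 3 * |zr r t| ≤ M) :
    |timeFlux α B N h e χ θ θ₁ z zr r t| ≤
      (1 + (N + B + B ^ 2) + B) * M ^ 2 * m * (t * (T - t)) := by
  have hθ := ht.one_le_θ htt
  have hB := hs.one_le_B
  have hw0 : 0 < r ^ α := Real.rpow_pos_of_pos hr.1 _
  have hw1 : r ^ α ≤ 1 := Real.rpow_le_one hr.1.le hr.2.le hα.1.le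
  have hV := abs_zeroth_coefficient_le hα hs ht hN hr htt
  have hχ0 := hs.χ_nonneg r hr
  have hχ1 : χ r ≤ 1 := (hs.χ_le r hr).trans (indicator_le_self' (by simp) r)
  have hM : 0 ≤ M := le_trans (by positivity) hz
  have hτ : 0 ≤ m * (t * (T - t)) :=
    mul_nonneg ht.m_nonneg (mul_nonneg htt.1.le (by linarith [htt.2]))
  have hdecay := ht.decay t htt
  have sq_bound : ∀ y : ℝ, θ t ^ 3 * |y| ≤ M →
      θ t ^ 2 * |y ^ 2| ≤ M ^ 2 * m * (t * (T - t)) := by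
    intro y hy
    have h1 : (θ t ^ 3 * |y|) ^ 2 ≤ M ^ 2 := by gcongr
    rw [mul_pow, sq_abs] at h1
    rw [abs_of_nonneg (sq_nonneg y)]
    have h2 : θ t ^ 2 ≤ θ t ^ 5 := pow_le_pow_right₀ hθ (by norm_num)
    calc θ t ^ 2 * y ^ 2 ≤ θ t ^ 5 * y ^ 2 * 1 := by rw [mul_one]; gcongr
      _ ≤ θ t ^ 5 * y ^ 2 * (m * (t * (T - t)) * θ t) := by gcongr
      _ = (θ t ^ 3) ^ 2 * y ^ 2 * (m * (t * (T - t))) := by ring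
      _ ≤ M ^ 2 * (m * (t * (T - t))) := by gcongr
      _ = _ := by ring
  have hA : 0 ≤ M ^ 2 * m * (t * (T - t)) := by rw [mul_assoc]; positivity
  have hθ2 : 1 ≤ θ t ^ 2 := one_le_pow₀ hθ
  have hθ12 : θ t ≤ θ t ^ 2 := le_self_pow₀ hθ (by norm_num)
  have b1 := abs_mul_le_of_scaled (c := r ^ α) (C := 1) (by positivity)
    (by rw [abs_of_pos hw0]; linarith) (sq_bound _ hzr)
  have b2 := abs_mul_le_of_scaled (by positivity) hV (sq_bound _ hz)
  have b3 := abs_mul_le_of_scaled (c := B * θ t * χ r) (C := B) (by positivity) (by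
    rw [abs_of_nonneg (by positivity)]
    calc B * θ t * χ r ≤ B * θ t ^ 2 * 1 := by gcongr
      _ = _ := mul_one _) (sq_bound _ hz)
  unfold timeFlux
  refine (abs_add_le _ _).trans ((add_le_add ((abs_add_le _ _).trans (add_le_add b1 b2)) b3).trans
    (le_of_eq ?_))
  ring

lemma abs_spaceFlux_add_le {α a b r₂ B D T ε m N M ρ : ℝ} {h e e₁ e₂ χ χ₁ θ θ₁ θ₂ : ℝ → ℝ}
    (hα : α ∈ Ioo (0 : ℝ) 1) (hs : SpatialWeight α a b r₂ B D h e e₁ e₂ χ χ₁)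
    (ht : TemporalWeight T ε m θ θ₁ θ₂) (hN : 0 ≤ N)
    {r t : ℝ} (hr : r ∈ Ioo (0 : ℝ) 1) (htt : t ∈ Ioo 0 T) {z zr zt : ℝ → ℝ → ℝ}
    (hzρ : θ t ^ 3 * |z r t| ≤ M * ρ)
    (hz : θ t ^ 3 * |z r t| ≤ M * r) (hzr : θ t ^ 3 * |zr r t| ≤ M)
    (hzt : θ t ^ 3 * |zt r t| ≤ M * ρ) :
    |spaceFlux α B N h e e₁ χ θ θ₁ z zr zt r t
      + 2 * θ t * (r ^ α * e r) * (r ^ α * zr r t ^ 2)| ≤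
      (2 + 2 * B + 2 * (N + B + B ^ 2) * B + 2 * B + 2 * B ^ 2 + 1) * (r ^ α * (M ^ 2 * ρ)) := by
  have hr0 := hr.1
  have hθ := ht.one_le_θ htt
  have hB := hs.one_le_B
  have hw0 : 0 < r ^ α := Real.rpow_pos_of_pos hr.1 _
  have hv0 : 0 < r ^ (α - 1) := Real.rpow_pos_of_pos hr.1 _
  have hw1 : r ^ α ≤ 1 := Real.rpow_le_one hr.1.le hr.2.le hα.1.le
  have hvw : r ^ α = r ^ (α - 1) * r := by
    rw [← Real.rpow_add_one hr0.ne']; congr 1; ring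
  have hV := abs_zeroth_coefficient_le hα hs ht hN hr htt
  have hχ0 := hs.χ_nonneg r hr
  have hχ1 : χ r ≤ 1 := (hs.χ_le r hr).trans (indicator_le_self' (by simp) r)
  have hM : 0 ≤ M := le_trans (by positivity) hzr
  have hMρ : 0 ≤ M * ρ := le_trans (by positivity) hzρ
  have hMM : 0 ≤ M ^ 2 * ρ := by rw [sq, mul_assoc]; positivity
  have heB := hs.abs_e_le r hr
  have hp1 := hs.abs_flux_deriv_le r hr
  have hprod : ∀ x y A : ℝ, θ t ^ 3 * |x| ≤ A → θ t ^ 3 * |y| ≤ M * ρ →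
      θ t ^ 6 * |x * y| ≤ A * (M * ρ) := by
    intro x y A hx hy
    rw [abs_mul]
    calc θ t ^ 6 * (|x| * |y|) = (θ t ^ 3 * |x|) * (θ t ^ 3 * |y|) := by ring
      _ ≤ A * (M * ρ) := mul_le_mul hx hy (by positivity) (le_trans (by positivity) hx)
  have hzM : θ t ^ 3 * |z r t| ≤ M :=
    hz.trans (mul_le_of_le_one_right hM hr.2.le)
  have c1 : θ t ^ 6 * |zr r t * zt r t| ≤ M ^ 2 * ρ := by
    convert hprod _ _ _ hzr hzt using 1; ring
  have c2 : θ t ^ 6 * |z r t * zr r t| ≤ M ^ 2 * ρ := by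
    rw [mul_comm (z r t)]; convert hprod _ _ _ hzr hzρ using 1; ring
  have c3 : θ t ^ 6 * |z r t ^ 2| ≤ M ^ 2 * ρ := by
    rw [sq (z r t)]; convert hprod _ _ _ hzM hzρ using 1; ring
  have c4 : θ t ^ 6 * |z r t ^ 2| ≤ M ^ 2 * ρ * r := by
    rw [sq (z r t)]; convert hprod _ _ _ hz hzρ using 1; ring
  have hθ6 : 1 ≤ θ t ^ 6 := one_le_pow₀ hθ
  have hθ16 : θ t ≤ θ t ^ 6 := le_self_pow₀ hθ (by norm_num)
  have hθ26 : θ t ^ 2 ≤ θ t ^ 6 := pow_le_pow_right₀ hθ (by norm_num)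
  have hθ36 : θ t ^ 3 ≤ θ t ^ 6 := pow_le_pow_right₀ hθ (by norm_num)
  have hs6 : 0 < θ t ^ 6 := by positivity
  have hθ0 : 0 < θ t := by linarith
  have b1 := abs_mul_le_of_scaled (c := -(2 * r ^ α)) (C := 2 * r ^ α) hs6 (by
    rw [abs_neg, abs_of_pos (by positivity)]
    exact le_mul_of_one_le_right (by positivity) hθ6) c1
  have b3 := abs_mul_le_of_scaled
    (c := -(2 * θ t * (r ^ α * (α * r ^ (α - 1) * e r + r ^ α * e₁ r))))
    (C := 2 * B * r ^ α) hs6 (by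
      rw [abs_neg, abs_mul (2 * θ t), abs_mul (r ^ α), abs_of_pos hw0,
        abs_of_pos (by positivity : 0 < 2 * θ t)]
      calc 2 * θ t * (r ^ α * |α * r ^ (α - 1) * e r + r ^ α * e₁ r|)
          ≤ 2 * θ t ^ 6 * (r ^ α * B) := by gcongr
        _ = _ := by ring) c2
  have b4 := abs_mul_le_of_scaled
    (c := 2 * θ t * ((N + θ₁ t * h r - θ t ^ 2 * (r ^ α * e r ^ 2)) * (r ^ α * e r)))
    (C := 2 * (N + B + B ^ 2) * B * r ^ α) hs6 (by
      rw [abs_mul (2 * θ t), abs_mul (N + _ - _), abs_mul (r ^ α), abs_of_pos hw0,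
        abs_of_pos (by positivity : 0 < 2 * θ t)]
      calc 2 * θ t * (|N + θ₁ t * h r - θ t ^ 2 * (r ^ α * e r ^ 2)| * (r ^ α * |e r|))
          ≤ 2 * θ t * ((N + B + B ^ 2) * θ t ^ 2 * (r ^ α * B)) := by gcongr
        _ = 2 * (N + B + B ^ 2) * B * r ^ α * θ t ^ 3 := by ring
        _ ≤ _ := by gcongr) c3
  have b5 := abs_mul_le_of_scaled (c := -(2 * B * θ t * (χ r * r ^ α))) (C := 2 * B * r ^ α)
    hs6 (by
      rw [abs_neg, abs_of_nonneg (by positivity)]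
      calc 2 * B * θ t * (χ r * r ^ α) ≤ 2 * B * θ t ^ 6 * (1 * r ^ α) := by gcongr
        _ = _ := by ring) c2
  have b6 := abs_mul_le_of_scaled (c := 2 * B * θ t ^ 2 * (χ r * (r ^ α * e r)))
    (C := 2 * B ^ 2 * r ^ α) hs6 (by
      rw [abs_mul (2 * B * θ t ^ 2), abs_mul (χ r), abs_mul (r ^ α), abs_of_pos hw0,
        abs_of_nonneg hχ0, abs_of_pos (by positivity : 0 < 2 * B * θ t ^ 2)]
      calc 2 * B * θ t ^ 2 * (χ r * (r ^ α * |e r|)) ≤ 2 * B * θ t ^ 6 * (1 * (r ^ α * B)) := by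
            gcongr
        _ = _ := by ring) c3
  have b7 := abs_mul_le_of_scaled (c := α * (1 - α) / 4 * θ t * r ^ (α - 1))
    (C := r ^ (α - 1)) hs6 (by
      have hα1 := hα.1
      have hα2 : 0 < 1 - α := by linarith [hα.2]
      rw [abs_of_pos (by positivity)]
      have : α * (1 - α) / 4 ≤ 1 := by nlinarith
      calc α * (1 - α) / 4 * θ t * r ^ (α - 1) ≤ 1 * θ t ^ 6 * r ^ (α - 1) := by gcongr
        _ = _ := by ring) c4
  have e7 : r ^ (α - 1) * (M ^ 2 * ρ * r) = r ^ α * (M ^ 2 * ρ) := by rw [hvw]; ring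
  rw [e7] at b7
  have hsum := (abs_add_le _ _).trans (add_le_add ((abs_add_le _ _).trans (add_le_add
    ((abs_add_le _ _).trans (add_le_add ((abs_add_le _ _).trans (add_le_add
    ((abs_add_le _ _).trans (add_le_add b1 b3)) b4)) b5)) b6)) b7)
  unfold spaceFlux
  refine le_trans (le_of_eq ?_) (hsum.trans (le_of_eq ?_))
  · congr 1; ring
  · ring

/-- A function on the rectangle with the derivatives and bounds that a classical solution, smooth up
to the boundary and vanishing on the lateral boundary, has. -/
structure ClassicalData (T M : ℝ) (φ φr φt φrr φrt : ℝ → ℝ → ℝ) : Prop where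
  M_nonneg : 0 ≤ M
  hasDerivAt_r : ∀ r ∈ Ioo (0 : ℝ) 1, ∀ t ∈ Ioo 0 T, HasDerivAt (fun x => φ x t) (φr r t) r
  hasDerivAt_t : ∀ r ∈ Ioo (0 : ℝ) 1, ∀ t ∈ Ioo 0 T, HasDerivAt (fun τ => φ r τ) (φt r t) t
  hasDerivAt_rr : ∀ r ∈ Ioo (0 : ℝ) 1, ∀ t ∈ Ioo 0 T, HasDerivAt (fun x => φr x t) (φrr r t) r
  hasDerivAt_rt : ∀ r ∈ Ioo (0 : ℝ) 1, ∀ t ∈ Ioo 0 T, HasDerivAt (fun τ => φr r τ) (φrt r t) t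
  hasDerivAt_tr : ∀ r ∈ Ioo (0 : ℝ) 1, ∀ t ∈ Ioo 0 T, HasDerivAt (fun x => φt x t) (φrt r t) r
  contDiffOn : ContDiffOn ℝ 1 (fun x : ℝ × ℝ => φ x.1 x.2) (Ioo 0 1 ×ˢ Ioo 0 T)
  contDiffOn_r : ContDiffOn ℝ 1 (fun x : ℝ × ℝ => φr x.1 x.2) (Ioo 0 1 ×ˢ Ioo 0 T)
  contDiffOn_t : ContDiffOn ℝ 1 (fun x : ℝ × ℝ => φt x.1 x.2) (Ioo 0 1 ×ˢ Ioo 0 T)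
  abs_le_left : ∀ r ∈ Ioo (0 : ℝ) 1, ∀ t ∈ Ioo 0 T, |φ r t| ≤ M * r
  abs_le_right : ∀ r ∈ Ioo (0 : ℝ) 1, ∀ t ∈ Ioo 0 T, |φ r t| ≤ M * (1 - r)
  abs_r_le : ∀ r ∈ Ioo (0 : ℝ) 1, ∀ t ∈ Ioo 0 T, |φr r t| ≤ M
  abs_t_le : ∀ r ∈ Ioo (0 : ℝ) 1, ∀ t ∈ Ioo 0 T, |φt r t| ≤ M
  abs_t_le_right : ∀ r ∈ Ioo (0 : ℝ) 1, ∀ t ∈ Ioo 0 T, |φt r t| ≤ M * (1 - r)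

/-- The conjugated function `e^{-θ h} φ`. -/
noncomputable def conj (h θ : ℝ → ℝ) (φ : ℝ → ℝ → ℝ) (r t : ℝ) : ℝ :=
  Real.exp (-(θ t * h r)) * φ r t

/-- The space derivative of the conjugated function. -/
noncomputable def conjSpace (h e θ : ℝ → ℝ) (φ φr : ℝ → ℝ → ℝ) (r t : ℝ) : ℝ :=
  Real.exp (-(θ t * h r)) * (φr r t + θ t * e r * φ r t)

/-- The time derivative of the conjugated function. -/
noncomputable def conjTime (h θ θ₁ : ℝ → ℝ) (φ φt : ℝ → ℝ → ℝ) (r t : ℝ) : ℝ :=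
  Real.exp (-(θ t * h r)) * (φt r t - θ₁ t * h r * φ r t)

lemma pow_mul_exp_neg_le {x y : ℝ} (hx : 0 ≤ x) (hxy : x ≤ y) (k : ℕ) :
    x ^ k * Real.exp (-y) ≤ k.factorial := by
  have h1 := Real.pow_div_factorial_le_exp x hx k
  have hk : (0 : ℝ) < k.factorial := by positivity
  rw [div_le_iff₀ hk] at h1
  have h2 : Real.exp x * Real.exp (-y) ≤ 1 := by
    rw [← Real.exp_add]; exact Real.exp_le_one_iff.2 (by linarith)
  calc x ^ k * Real.exp (-y) ≤ Real.exp x * k.factorial * Real.exp (-y) := by gcongr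
    _ = (Real.exp x * Real.exp (-y)) * k.factorial := by ring
    _ ≤ 1 * k.factorial := by gcongr
    _ = _ := one_mul _

section
variable {α a b r₂ B D T ε m M N : ℝ} {h e e₁ e₂ χ χ₁ θ θ₁ θ₂ : ℝ → ℝ}
  {φ φr φt φrr φrt : ℝ → ℝ → ℝ} {r t : ℝ}

lemma exp_mul_pow_le (hs : SpatialWeight α a b r₂ B D h e e₁ e₂ χ χ₁)
    (ht : TemporalWeight T ε m θ θ₁ θ₂) (hr : r ∈ Ioo (0 : ℝ) 1) (htt : t ∈ Ioo 0 T) {k : ℕ}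
    (hk : k ≤ 5) : θ t ^ k * Real.exp (-(θ t * h r)) ≤ 120 := by
  have hθ := ht.one_le_θ htt
  have hh := hs.one_le_h r hr
  calc θ t ^ k * Real.exp (-(θ t * h r)) ≤ θ t ^ 5 * Real.exp (-(θ t * h r)) := by gcongr
    _ ≤ (Nat.factorial 5 : ℕ) := pow_mul_exp_neg_le (by linarith) (by nlinarith) 5
    _ = 120 := by norm_num [Nat.factorial]

lemma abs_conj_le {A : ℝ} (hs : SpatialWeight α a b r₂ B D h e e₁ e₂ χ χ₁)
    (ht : TemporalWeight T ε m θ θ₁ θ₂) (hr : r ∈ Ioo (0 : ℝ) 1) (htt : t ∈ Ioo 0 T)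
    (hA : |φ r t| ≤ M * A) : θ t ^ 3 * |conj h θ φ r t| ≤ 120 * M * (1 + B) * A := by
  have hθ := ht.one_le_θ htt
  have hMA : 0 ≤ M * A := (abs_nonneg _).trans hA
  rw [conj, abs_mul, abs_of_pos (Real.exp_pos _), ← mul_assoc]
  calc _ ≤ 120 * (M * A) := by
        gcongr
        exact exp_mul_pow_le hs ht hr htt (by norm_num)
    _ ≤ _ := by nlinarith [hs.one_le_B]

lemma abs_conjSpace_le (hs : SpatialWeight α a b r₂ B D h e e₁ e₂ χ χ₁)
    (ht : TemporalWeight T ε m θ θ₁ θ₂) (hφ : ClassicalData T M φ φr φt φrr φrt)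
    (hr : r ∈ Ioo (0 : ℝ) 1) (htt : t ∈ Ioo 0 T) :
    θ t ^ 3 * |conjSpace h e θ φ φr r t| ≤ 120 * M * (1 + B) := by
  have hθ := ht.one_le_θ htt
  have hM := hφ.M_nonneg
  have hB := hs.one_le_B
  have h1 : |φr r t + θ t * e r * φ r t| ≤ θ t * (M * (1 + B)) := by
    refine (abs_add_le _ _).trans ?_
    rw [abs_mul, abs_mul, abs_of_nonneg (by linarith : 0 ≤ θ t)]
    have h2 := hφ.abs_r_le r hr t htt
    have h3 : |φ r t| ≤ M :=
      (hφ.abs_le_left r hr t htt).trans (mul_le_of_le_one_right hM hr.2.le)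
    have h4 := hs.abs_e_le r hr
    calc |φr r t| + θ t * |e r| * |φ r t| ≤ M + θ t * B * M := by gcongr
      _ ≤ _ := by nlinarith
  rw [conjSpace, abs_mul, abs_of_pos (Real.exp_pos _), ← mul_assoc]
  calc _ ≤ θ t ^ 3 * Real.exp (-(θ t * h r)) * (θ t * (M * (1 + B))) := by gcongr
    _ = θ t ^ 4 * Real.exp (-(θ t * h r)) * (M * (1 + B)) := by ring
    _ ≤ 120 * (M * (1 + B)) := by
        gcongr
        exact exp_mul_pow_le hs ht hr htt (by norm_num)
    _ = _ := by ring

lemma abs_conjTime_le {A : ℝ} (hs : SpatialWeight α a b r₂ B D h e e₁ e₂ χ χ₁)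
    (ht : TemporalWeight T ε m θ θ₁ θ₂)
    (hr : r ∈ Ioo (0 : ℝ) 1) (htt : t ∈ Ioo 0 T) (hA : |φ r t| ≤ M * A) (hA' : |φt r t| ≤ M * A) :
    θ t ^ 3 * |conjTime h θ θ₁ φ φt r t| ≤ 120 * M * (1 + B) * A := by
  have hθ := ht.one_le_θ htt
  have hB := hs.one_le_B
  have hMA : 0 ≤ M * A := (abs_nonneg _).trans hA
  have h1 : |φt r t - θ₁ t * h r * φ r t| ≤ θ t ^ 2 * (M * A * (1 + B)) := by
    refine (abs_sub _ _).trans ?_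
    rw [abs_mul, abs_mul, abs_of_nonneg (zero_le_one.trans (hs.one_le_h r hr))]
    have h2 : |θ₁ t| ≤ θ t ^ 2 :=
      (ht.abs_θ₁_le t htt).trans (mul_le_of_le_one_left (sq_nonneg _) ht.ε_le)
    have h4 := hs.h_le r hr
    have h5 := hs.one_le_h r hr
    have h6 : 1 ≤ θ t ^ 2 := one_le_pow₀ hθ
    calc |φt r t| + |θ₁ t| * h r * |φ r t| ≤ M * A + θ t ^ 2 * B * (M * A) := by gcongr
      _ ≤ _ := by nlinarith
  rw [conjTime, abs_mul, abs_of_pos (Real.exp_pos _), ← mul_assoc]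
  calc _ ≤ θ t ^ 3 * Real.exp (-(θ t * h r)) * (θ t ^ 2 * (M * A * (1 + B))) := by gcongr
    _ = θ t ^ 5 * Real.exp (-(θ t * h r)) * (M * A * (1 + B)) := by ring
    _ ≤ 120 * (M * A * (1 + B)) := by
        gcongr
        exact exp_mul_pow_le hs ht hr htt le_rfl
    _ = _ := by ring

/-- The pointwise Carleman inequality for the conjugated solution. -/
lemma carleman_pointwise_solution (hα : α ∈ Ioo (0 : ℝ) 1)
    (hs : SpatialWeight α a b r₂ B D h e e₁ e₂ χ χ₁)
    (ht : TemporalWeight T ε m θ θ₁ θ₂) (hφ : ClassicalData T M φ φr φt φrr φrt) (hN : 0 ≤ N)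
    (hε2 : ε * (2 * D / α + 4 * D + B / 2) ≤ α / 2) (hε3 : ε * B / 2 ≤ α * (1 - α) ^ 2 / 8)
    (hr : r ∈ Ioo (0 : ℝ) 1) (htt : t ∈ Ioo 0 T) {f : ℝ}
    (hf : f = φt r t - (r ^ α * φrr r t + α * r ^ (α - 1) * φr r t) + N * φ r t) :
    ∃ X' Y',
      HasDerivAt (fun τ => timeFlux α B N h e χ θ θ₁ (conj h θ φ) (conjSpace h e θ φ φr) r τ) X' t ∧
      HasDerivAt (fun x => spaceFlux α B N h e e₁ χ θ θ₁ (conj h θ φ) (conjSpace h e θ φ φr)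
        (conjTime h θ θ₁ φ φt) x t) Y' r ∧
      X' + Y' + α / (2 * (2 * D + 1)) * (θ t * r ^ α * φr r t ^ 2
          + θ t ^ 3 * r ^ (2 - α) * φ r t ^ 2) * Real.exp (-(2 * (θ t * h r))) ≤
        (2 * f ^ 2 + (D + B + 4 * B ^ 3 + 3 * B ^ 2) *
          (θ t ^ 3 * (Ioo a b).indicator 1 r * φ r t ^ 2)) * Real.exp (-(2 * (θ t * h r))) := by
  have hE_r : ∀ x ∈ Ioo (0 : ℝ) 1, HasDerivAt (fun x => Real.exp (-(θ t * h x)))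
      (Real.exp (-(θ t * h x)) * (θ t * e x)) x := fun x hx => by
    exact ((hs.hasDerivAt_h x hx).const_mul (θ t)).neg.exp.congr_deriv (by simp)
  have hE_t : ∀ τ ∈ Ioo (0 : ℝ) T, HasDerivAt (fun τ => Real.exp (-(θ τ * h r)))
      (Real.exp (-(θ τ * h r)) * (-(θ₁ τ * h r))) τ := fun τ hτ =>
    ((ht.hasDerivAt_θ τ hτ).mul_const (h r)).neg.exp
  have d1 : HasDerivAt (fun x => conj h θ φ x t) (conjSpace h e θ φ φr r t) r := by
    refine ((hE_r r hr).mul (hφ.hasDerivAt_r r hr t htt)).congr_deriv ?_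
    unfold conjSpace; ring
  have d2 : HasDerivAt (fun τ => conj h θ φ r τ) (conjTime h θ θ₁ φ φt r t) t := by
    refine ((hE_t t htt).mul (hφ.hasDerivAt_t r hr t htt)).congr_deriv ?_
    unfold conjTime; ring
  have d3 := (hE_r r hr).mul ((hφ.hasDerivAt_rr r hr t htt).add
    (((hs.hasDerivAt_e r hr).const_mul (θ t)).mul (hφ.hasDerivAt_r r hr t htt)))
  have d4 := (hE_t t htt).mul ((hφ.hasDerivAt_rt r hr t htt).add
    (((ht.hasDerivAt_θ t htt).mul_const (e r)).mul (hφ.hasDerivAt_t r hr t htt)))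
  have d5 := (hE_r r hr).mul ((hφ.hasDerivAt_tr r hr t htt).sub
    (((hs.hasDerivAt_h r hr).const_mul (θ₁ t)).mul (hφ.hasDerivAt_r r hr t htt)))
  simp only [Pi.mul_apply, Pi.add_apply, Pi.sub_apply] at d3 d4 d5
  set E := Real.exp (-(θ t * h r)) with hE
  obtain ⟨X', Y', hX, hY, hXY⟩ := carleman_pointwise (z := conj h θ φ)
    (zr := conjSpace h e θ φ φr) (zt := conjTime h θ θ₁ φ φt) (F := E * f)
    hα hs ht hN hε2 hε3 hr htt d1 d2 d3 d4
    (d5.congr_deriv (by ring)) (by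
      rw [hf]; unfold conjTime conjSpace conj; rw [← hE]; ring)
  refine ⟨X', Y', hX, hY, ?_⟩
  have hE2 : Real.exp (-(2 * (θ t * h r))) = E ^ 2 := by
    rw [hE, ← Real.exp_nat_mul]; congr 1; push_cast; ring
  rw [hE2]
  have hα0 := hα.1
  have hD := hs.D_nonneg
  have hθ := ht.one_le_θ htt
  have hw0 : 0 < r ^ α := Real.rpow_pos_of_pos hr.1 _
  have hw20 : 0 < r ^ (2 - α) := Real.rpow_pos_of_pos hr.1 _
  have hback : α / (2 * (2 * D + 1)) * (θ t * r ^ α * φr r t ^ 2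
      + θ t ^ 3 * r ^ (2 - α) * φ r t ^ 2) * E ^ 2 ≤
      α * θ t * r ^ α * conjSpace h e θ φ φr r t ^ 2
        + α / 2 * θ t ^ 3 * r ^ (2 - α) * conj h θ φ r t ^ 2 := by
    set z := conj h θ φ r t with hz
    set y := conjSpace h e θ φ φr r t with hy
    have e1 : E * φr r t = y - θ t * e r * z := by
      rw [hy, hz]; unfold conjSpace conj; rw [← hE]; ring
    have e2 : E * φ r t = z := by rw [hz]; rfl
    have e3 : (θ t * r ^ α * φr r t ^ 2 + θ t ^ 3 * r ^ (2 - α) * φ r t ^ 2) * E ^ 2 =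
        θ t * r ^ α * (y - θ t * e r * z) ^ 2 + θ t ^ 3 * r ^ (2 - α) * z ^ 2 := by
      rw [← e1, ← e2]; ring
    have e4 : θ t * r ^ α * (y - θ t * e r * z) ^ 2 + θ t ^ 3 * r ^ (2 - α) * z ^ 2 ≤
        2 * (2 * D + 1) * (θ t * r ^ α * y ^ 2) +
          (2 * D + 1) * (θ t ^ 3 * r ^ (2 - α) * z ^ 2) := by
      have g1 := mul_le_mul_of_nonneg_left (hs.sq_le r hr)
        (by positivity : 0 ≤ 2 * θ t ^ 3 * z ^ 2)
      have g2 : 0 ≤ θ t * r ^ α * (y + θ t * e r * z) ^ 2 := by positivity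
      have g3 : 0 ≤ D * (θ t * r ^ α * y ^ 2) := by positivity
      linear_combination g1 + g2 + 4 * g3
    rw [mul_assoc, e3]
    calc _ ≤ α / (2 * (2 * D + 1)) * (2 * (2 * D + 1) * (θ t * r ^ α * y ^ 2) +
          (2 * D + 1) * (θ t ^ 3 * r ^ (2 - α) * z ^ 2)) := by gcongr
      _ = _ := by field_simp
  have hz2 : conj h θ φ r t ^ 2 = φ r t ^ 2 * E ^ 2 := by unfold conj; rw [← hE]; ring
  rw [hz2] at hXY hback
  linear_combination hXY + hback

end

section
variable {α a b r₂ B D T ε m M N : ℝ} {h e e₁ e₂ χ χ₁ θ θ₁ θ₂ : ℝ → ℝ}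
  {φ φr φt φrr φrt : ℝ → ℝ → ℝ}

lemma contDiffOn_comp_fst {n : WithTop ℕ∞} {g : ℝ → ℝ} {s t : Set ℝ} (hg : ContDiffOn ℝ n g s) :
    ContDiffOn ℝ n (fun x : ℝ × ℝ => g x.1) (s ×ˢ t) :=
  hg.comp contDiffOn_fst fun _ hx => hx.1

lemma contDiffOn_comp_snd {n : WithTop ℕ∞} {g : ℝ → ℝ} {s t : Set ℝ} (hg : ContDiffOn ℝ n g t) :
    ContDiffOn ℝ n (fun x : ℝ × ℝ => g x.2) (s ×ˢ t) :=
  hg.comp contDiffOn_snd fun _ hx => hx.2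

lemma contDiffOn_rpow_const_Ioo (p : ℝ) :
    ContDiffOn ℝ 1 (fun x : ℝ => x ^ p) (Ioo 0 1) :=
  contDiffOn_id.rpow_const_of_ne fun _ hx => hx.1.ne'

lemma integrableOn_weighted (hs : SpatialWeight α a b r₂ B D h e e₁ e₂ χ χ₁)
    (ht : TemporalWeight T ε m θ θ₁ θ₂) {k : ℕ} (hk : k ≤ 5) {g : ℝ × ℝ → ℝ} {K : ℝ}
    (hg : ContinuousOn g (Ioo 0 1 ×ˢ Ioo 0 T)) (hK : ∀ x ∈ Ioo (0 : ℝ) 1 ×ˢ Ioo 0 T, |g x| ≤ K) :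
    IntegrableOn (fun x : ℝ × ℝ => θ x.2 ^ k * g x * Real.exp (-(2 * (θ x.2 * h x.1))))
      (Ioo 0 1 ×ˢ Ioo 0 T) := by
  have hU : MeasurableSet (Ioo (0 : ℝ) 1 ×ˢ Ioo 0 T) := measurableSet_Ioo.prod measurableSet_Ioo
  have hθc := (contDiffOn_comp_snd (s := Ioo 0 1) ht.contDiffOn_θ).continuousOn
  have hhc := (contDiffOn_comp_fst (t := Ioo 0 T) hs.contDiffOn_h).continuousOn
  refine IntegrableOn.of_bound (C := 120 * K) ?_ ?_ ?_
  · rw [Measure.volume_eq_prod, Measure.prod_prod]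
    exact ENNReal.mul_lt_top (by simp) (by simp)
  · exact (((hθc.pow k).mul hg).mul
      (((hθc.mul hhc).const_mul 2).neg.rexp)).aestronglyMeasurable hU
  · refine (ae_restrict_iff' hU).2 (ae_of_all _ fun x hx => ?_)
    have hθ := ht.one_le_θ hx.2
    have hh := hs.one_le_h x.1 hx.1
    have hK0 := (abs_nonneg _).trans (hK x hx)
    have h1 : Real.exp (-(2 * (θ x.2 * h x.1))) ≤ Real.exp (-(θ x.2 * h x.1)) := by
      apply Real.exp_le_exp.2
      nlinarith
    have h2 := exp_mul_pow_le hs ht hx.1 hx.2 hk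
    rw [Real.norm_eq_abs, abs_mul, abs_mul, abs_of_pos (Real.exp_pos _),
      abs_of_nonneg (by positivity : 0 ≤ θ x.2 ^ k)]
    calc _ ≤ θ x.2 ^ k * K * Real.exp (-(θ x.2 * h x.1)) := by
          gcongr
          exact hK x hx
      _ = θ x.2 ^ k * Real.exp (-(θ x.2 * h x.1)) * K := by ring
      _ ≤ _ := by gcongr

lemma integrableOn_mul_exp_neg {F : ℝ × ℝ → ℝ} (hs : SpatialWeight α a b r₂ B D h e e₁ e₂ χ χ₁)
    (ht : TemporalWeight T ε m θ θ₁ θ₂) (hF : IntegrableOn F (Ioo 0 1 ×ˢ Ioo 0 T)) :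
    IntegrableOn (fun x : ℝ × ℝ => F x * Real.exp (-(2 * (θ x.2 * h x.1))))
      (Ioo 0 1 ×ˢ Ioo 0 T) := by
  have hU : MeasurableSet (Ioo (0 : ℝ) 1 ×ˢ Ioo 0 T) := measurableSet_Ioo.prod measurableSet_Ioo
  have hθc := (contDiffOn_comp_snd (s := Ioo 0 1) ht.contDiffOn_θ).continuousOn
  have hhc := (contDiffOn_comp_fst (t := Ioo 0 T) hs.contDiffOn_h).continuousOn
  refine Integrable.mul_bdd (c := 1) hF
    ((((hθc.mul hhc).const_mul 2).neg.rexp).aestronglyMeasurable hU) ?_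
  refine (ae_restrict_iff' hU).2 (ae_of_all _ fun x hx => ?_)
  have hθ := ht.one_le_θ hx.2
  have hh := hs.one_le_h x.1 hx.1
  rw [Real.norm_eq_abs, abs_of_pos (Real.exp_pos _), Real.exp_le_one_iff]
  nlinarith

lemma contDiffOn_timeFlux {z zr : ℝ → ℝ → ℝ} (hs : SpatialWeight α a b r₂ B D h e e₁ e₂ χ χ₁)
    (ht : TemporalWeight T ε m θ θ₁ θ₂)
    (hz : ContDiffOn ℝ 1 (fun x : ℝ × ℝ => z x.1 x.2) (Ioo 0 1 ×ˢ Ioo 0 T))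
    (hzr : ContDiffOn ℝ 1 (fun x : ℝ × ℝ => zr x.1 x.2) (Ioo 0 1 ×ˢ Ioo 0 T)) :
    ContDiffOn ℝ 1 (fun x : ℝ × ℝ => timeFlux α B N h e χ θ θ₁ z zr x.1 x.2)
      (Ioo 0 1 ×ˢ Ioo 0 T) := by
  have hw := contDiffOn_comp_fst (t := Ioo 0 T) (contDiffOn_rpow_const_Ioo α)
  have hh := contDiffOn_comp_fst (t := Ioo 0 T) (hs.contDiffOn_h.of_le one_le_two)
  have he := contDiffOn_comp_fst (t := Ioo 0 T) (hs.contDiffOn_e.of_le one_le_two)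
  have hχ := contDiffOn_comp_fst (t := Ioo 0 T) hs.contDiffOn_χ
  have hθ := contDiffOn_comp_snd (s := Ioo 0 1) (ht.contDiffOn_θ.of_le one_le_two)
  have hθ1 := contDiffOn_comp_snd (s := Ioo 0 1) ht.contDiffOn_θ₁
  unfold timeFlux
  exact ((hw.mul (hzr.pow 2)).add (((contDiffOn_const.add (hθ1.mul hh)).sub
    ((hθ.pow 2).mul (hw.mul (he.pow 2)))).mul (hz.pow 2))).add
    (((contDiffOn_const.mul hθ).mul hχ).mul (hz.pow 2))

lemma contDiffOn_spaceFlux {z zr zt : ℝ → ℝ → ℝ} (hs : SpatialWeight α a b r₂ B D h e e₁ e₂ χ χ₁)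
    (ht : TemporalWeight T ε m θ θ₁ θ₂)
    (hz : ContDiffOn ℝ 1 (fun x : ℝ × ℝ => z x.1 x.2) (Ioo 0 1 ×ˢ Ioo 0 T))
    (hzr : ContDiffOn ℝ 1 (fun x : ℝ × ℝ => zr x.1 x.2) (Ioo 0 1 ×ˢ Ioo 0 T))
    (hzt : ContDiffOn ℝ 1 (fun x : ℝ × ℝ => zt x.1 x.2) (Ioo 0 1 ×ˢ Ioo 0 T)) :
    ContDiffOn ℝ 1 (fun x : ℝ × ℝ => spaceFlux α B N h e e₁ χ θ θ₁ z zr zt x.1 x.2)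
      (Ioo 0 1 ×ˢ Ioo 0 T) := by
  have hw := contDiffOn_comp_fst (t := Ioo 0 T) (contDiffOn_rpow_const_Ioo α)
  have hv := contDiffOn_comp_fst (t := Ioo 0 T) (contDiffOn_rpow_const_Ioo (α - 1))
  have hh := contDiffOn_comp_fst (t := Ioo 0 T) (hs.contDiffOn_h.of_le one_le_two)
  have he := contDiffOn_comp_fst (t := Ioo 0 T) (hs.contDiffOn_e.of_le one_le_two)
  have he1 := contDiffOn_comp_fst (t := Ioo 0 T) hs.contDiffOn_e₁
  have hχ := contDiffOn_comp_fst (t := Ioo 0 T) hs.contDiffOn_χ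
  have hθ := contDiffOn_comp_snd (s := Ioo 0 1) (ht.contDiffOn_θ.of_le one_le_two)
  have hθ1 := contDiffOn_comp_snd (s := Ioo 0 1) ht.contDiffOn_θ₁
  have hV := ((contDiffOn_const (c := N)).add (hθ1.mul hh)).sub
    ((hθ.pow 2).mul (hw.mul (he.pow 2)))
  have h2θ := (contDiffOn_const (c := (2 : ℝ))).mul hθ
  have hBB := (contDiffOn_const (𝕜 := ℝ) (n := 1) (s := Ioo (0 : ℝ) 1 ×ˢ Ioo 0 T) (c := 2 * B))
  unfold spaceFlux
  exact ((((((contDiffOn_const.mul ((hw.mul hzr).mul hzt)).neg.sub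
    ((h2θ.mul (hw.mul he)).mul (hw.mul (hzr.pow 2)))).sub
    (h2θ.mul ((hw.mul (((contDiffOn_const.mul hv).mul he).add (hw.mul he1))).mul
      (hz.mul hzr)))).add
    (h2θ.mul ((hV.mul (hw.mul he)).mul (hz.pow 2)))).sub
    ((hBB.mul hθ).mul ((hχ.mul hw).mul (hz.mul hzr)))).add
    ((hBB.mul (hθ.pow 2)).mul ((hχ.mul (hw.mul he)).mul (hz.pow 2)))).add
    ((contDiffOn_const.mul hθ).mul (hv.mul (hz.pow 2)))

lemma fderiv_eq_of_hasDerivAt_slices {G : ℝ → ℝ → ℝ} {U : Set (ℝ × ℝ)} (hU : IsOpen U)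
    (hG : ContDiffOn ℝ 1 (fun x : ℝ × ℝ => G x.1 x.2) U) {x : ℝ × ℝ} (hx : x ∈ U) :
    (∀ G', HasDerivAt (fun r => G r x.2) G' x.1 →
      fderiv ℝ (fun x : ℝ × ℝ => G x.1 x.2) x (1, 0) = G') ∧
    ∀ G', HasDerivAt (fun t => G x.1 t) G' x.2 →
      fderiv ℝ (fun x : ℝ × ℝ => G x.1 x.2) x (0, 1) = G' := by
  have hd := ((hG.contDiffAt (hU.mem_nhds hx)).differentiableAt one_ne_zero).hasFDerivAt
  constructor
  · intro G' hG'
    exact (HasFDerivAt.comp_hasDerivAt (f := fun r => (r, x.2)) x.1 hd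
      ((hasDerivAt_id x.1).prodMk (hasDerivAt_const x.1 x.2))).unique hG'
  · intro G' hG'
    exact (HasFDerivAt.comp_hasDerivAt (f := fun t => (x.1, t)) x.2 hd
      ((hasDerivAt_const x.2 x.1).prodMk (hasDerivAt_id x.2))).unique hG'

lemma contDiffOn_conj (hs : SpatialWeight α a b r₂ B D h e e₁ e₂ χ χ₁)
    (ht : TemporalWeight T ε m θ θ₁ θ₂) (hφ : ClassicalData T M φ φr φt φrr φrt) :
    ContDiffOn ℝ 1 (fun x : ℝ × ℝ => conj h θ φ x.1 x.2) (Ioo 0 1 ×ˢ Ioo 0 T) ∧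
    ContDiffOn ℝ 1 (fun x : ℝ × ℝ => conjSpace h e θ φ φr x.1 x.2) (Ioo 0 1 ×ˢ Ioo 0 T) ∧
    ContDiffOn ℝ 1 (fun x : ℝ × ℝ => conjTime h θ θ₁ φ φt x.1 x.2) (Ioo 0 1 ×ˢ Ioo 0 T) := by
  have hh := contDiffOn_comp_fst (t := Ioo 0 T) (hs.contDiffOn_h.of_le one_le_two)
  have he := contDiffOn_comp_fst (t := Ioo 0 T) (hs.contDiffOn_e.of_le one_le_two)
  have hθ := contDiffOn_comp_snd (s := Ioo 0 1) (ht.contDiffOn_θ.of_le one_le_two)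
  have hθ1 := contDiffOn_comp_snd (s := Ioo 0 1) ht.contDiffOn_θ₁
  have hE := (hθ.mul hh).neg.exp
  unfold conj conjSpace conjTime
  exact ⟨hE.mul hφ.contDiffOn, hE.mul (hφ.contDiffOn_r.add ((hθ.mul he).mul hφ.contDiffOn)),
    hE.mul (hφ.contDiffOn_t.sub ((hθ1.mul hh).mul hφ.contDiffOn))⟩

end

/-- The integrals of the Carleman estimate which involve the solution converge. -/
lemma integrableOn_carleman_terms {α a b r₂ B D T ε m M : ℝ}
    {h e e₁ e₂ χ χ₁ θ θ₁ θ₂ : ℝ → ℝ} {φ φr φt φrr φrt : ℝ → ℝ → ℝ}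
    (hα : α ∈ Ioo (0 : ℝ) 1) (hs : SpatialWeight α a b r₂ B D h e e₁ e₂ χ χ₁)
    (ht : TemporalWeight T ε m θ θ₁ θ₂) (hφ : ClassicalData T M φ φr φt φrr φrt) :
    IntegrableOn (fun x : ℝ × ℝ =>
      θ x.2 * x.1 ^ α * φr x.1 x.2 ^ 2 * Real.exp (-(2 * (θ x.2 * h x.1))))
      (Ioo 0 1 ×ˢ Ioo 0 T) ∧
    IntegrableOn (fun x : ℝ × ℝ =>
      θ x.2 ^ 3 * x.1 ^ (2 - α) * φ x.1 x.2 ^ 2 * Real.exp (-(2 * (θ x.2 * h x.1))))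
      (Ioo 0 1 ×ˢ Ioo 0 T) ∧
    IntegrableOn (fun x : ℝ × ℝ =>
      θ x.2 ^ 3 * φ x.1 x.2 ^ 2 * Real.exp (-(2 * (θ x.2 * h x.1)))) (Ioo 0 1 ×ˢ Ioo 0 T) := by
  have hM := hφ.M_nonneg
  have habs : ∀ x ∈ Ioo (0 : ℝ) 1 ×ˢ Ioo 0 T, |φ x.1 x.2| ≤ M := fun x hx =>
    (hφ.abs_le_left x.1 hx.1 x.2 hx.2).trans (mul_le_of_le_one_right hM hx.1.2.le)
  have hsq : ∀ y : ℝ, |y| ≤ M → y ^ 2 ≤ M ^ 2 := fun y hy => by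
    rw [← sq_abs]; gcongr
  have hw : ∀ p : ℝ, 0 ≤ p → ∀ x ∈ Ioo (0 : ℝ) 1 ×ˢ Ioo 0 T, ∀ y : ℝ, |y| ≤ M →
      |x.1 ^ p * y ^ 2| ≤ M ^ 2 := by
    intro p hp x hx y hy
    have h0 : 0 ≤ x.1 ^ p := Real.rpow_nonneg hx.1.1.le _
    have h1 : x.1 ^ p ≤ 1 := Real.rpow_le_one hx.1.1.le hx.1.2.le hp
    rw [abs_of_nonneg (by positivity)]
    calc x.1 ^ p * y ^ 2 ≤ 1 * M ^ 2 := by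
          have := hsq y hy
          gcongr
      _ = M ^ 2 := one_mul _
  have hwc : ∀ p : ℝ, ContinuousOn (fun x : ℝ × ℝ => x.1 ^ p) (Ioo 0 1 ×ˢ Ioo 0 T) := fun p =>
    (contDiffOn_comp_fst (contDiffOn_rpow_const_Ioo p)).continuousOn
  refine ⟨?_, ?_, ?_⟩
  · refine (integrableOn_weighted hs ht (k := 1) (by norm_num)
      ((hwc α).mul (hφ.contDiffOn_r.continuousOn.pow 2)) fun x hx =>
        hw α hα.1.le x hx _ (hφ.abs_r_le x.1 hx.1 x.2 hx.2)).congr (ae_of_all _ fun x => ?_)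
    simp only [Pi.mul_apply, Pi.pow_apply]; ring
  · refine (integrableOn_weighted hs ht (k := 3) (by norm_num)
      ((hwc (2 - α)).mul (hφ.contDiffOn.continuousOn.pow 2)) fun x hx =>
        hw (2 - α) (by linarith [hα.2]) x hx _ (habs x hx)).congr (ae_of_all _ fun x => ?_)
    simp only [Pi.mul_apply, Pi.pow_apply]; ring
  · exact integrableOn_weighted hs ht (k := 3) (by norm_num)
        (hφ.contDiffOn.continuousOn.pow 2) (K := M ^ 2) fun x hx => by
          rw [abs_of_nonneg (sq_nonneg _)]; exact hsq _ (habs x hx)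

/-- The Carleman estimate for abstract spatial and temporal weights. -/
theorem carleman_estimate_of_weights {α a b r₂ B D T ε m M N : ℝ}
    {h e e₁ e₂ χ χ₁ θ θ₁ θ₂ : ℝ → ℝ} {φ φr φt φrr φrt f : ℝ → ℝ → ℝ}
    (hα : α ∈ Ioo (0 : ℝ) 1) (hb : b ≤ 1)
    (hs : SpatialWeight α a b r₂ B D h e e₁ e₂ χ χ₁)
    (ht : TemporalWeight T ε m θ θ₁ θ₂) (hφ : ClassicalData T M φ φr φt φrr φrt) (hN : 0 ≤ N)
    (hε2 : ε * (2 * D / α + 4 * D + B / 2) ≤ α / 2) (hε3 : ε * B / 2 ≤ α * (1 - α) ^ 2 / 8)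
    (hf : ∀ r ∈ Ioo (0 : ℝ) 1, ∀ t ∈ Ioo 0 T,
      f r t = φt r t - (r ^ α * φrr r t + α * r ^ (α - 1) * φr r t) + N * φ r t)
    (hfi : IntegrableOn (fun x : ℝ × ℝ => f x.1 x.2 ^ 2) (Ioo 0 1 ×ˢ Ioo 0 T)) :
    α / (2 * (2 * D + 1)) *
      ((∫ x in Ioo (0 : ℝ) 1 ×ˢ Ioo 0 T,
          θ x.2 * x.1 ^ α * φr x.1 x.2 ^ 2 * Real.exp (-(2 * (θ x.2 * h x.1))))
        + ∫ x in Ioo (0 : ℝ) 1 ×ˢ Ioo 0 T,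
          θ x.2 ^ 3 * x.1 ^ (2 - α) * φ x.1 x.2 ^ 2 * Real.exp (-(2 * (θ x.2 * h x.1)))) ≤
      2 * (∫ x in Ioo (0 : ℝ) 1 ×ˢ Ioo 0 T,
          f x.1 x.2 ^ 2 * Real.exp (-(2 * (θ x.2 * h x.1))))
        + (D + B + 4 * B ^ 3 + 3 * B ^ 2) * ∫ x in Ioo a b ×ˢ Ioo 0 T,
          θ x.2 ^ 3 * φ x.1 x.2 ^ 2 * Real.exp (-(2 * (θ x.2 * h x.1))) := by
  have hUo : IsOpen (Ioo (0 : ℝ) 1 ×ˢ Ioo 0 T) := isOpen_Ioo.prod isOpen_Ioo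
  have hB := hs.one_le_B
  have hM := hφ.M_nonneg
  have hD := hs.D_nonneg
  have hα0 := hα.1
  have hm := ht.m_nonneg
  have habs : ∀ x ∈ Ioo (0 : ℝ) 1 ×ˢ Ioo 0 T, |φ x.1 x.2| ≤ M := fun x hx =>
    (hφ.abs_le_left x.1 hx.1 x.2 hx.2).trans (mul_le_of_le_one_right hM hx.1.2.le)
  obtain ⟨i1, i2, i4⟩ := integrableOn_carleman_terms hα hs ht hφ
  have i3 := integrableOn_mul_exp_neg hs ht hfi
  have hm4 : MeasurableSet (Ioo a b ×ˢ Ioo 0 T) := measurableSet_Ioo.prod measurableSet_Ioo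
  have hU := hUo.measurableSet
  have i5 := i4.indicator hm4
  obtain ⟨c1, c2, c3⟩ := contDiffOn_conj hs ht hφ
  have hX := contDiffOn_timeFlux (N := N) hs ht c1 c2
  have hY := contDiffOn_spaceFlux (N := N) hs ht c1 c2 c3
  have hκ : 0 < α / (2 * (2 * D + 1)) := by positivity
  set κ := α / (2 * (2 * D + 1))
  set C := D + B + 4 * B ^ 3 + 3 * B ^ 2 with hC
  have hC0 : 0 ≤ C := by positivity
  set M₀ := 120 * M * (1 + B) with hM₀
  have hM₀0 : 0 ≤ M₀ := by positivity
  have hconj : ∀ x ∈ Ioo (0 : ℝ) 1 ×ˢ Ioo 0 T, θ x.2 ^ 3 * |conj h θ φ x.1 x.2| ≤ M₀ * 1 :=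
    fun x hx => abs_conj_le hs ht hx.1 hx.2 (by simpa using habs x hx)
  set K₁ := (2 + 2 * B + 2 * (N + B + B ^ 2) * B + 2 * B + 2 * B ^ 2 + 1) * M₀ ^ 2 with hK₁
  set K₂ := (1 + (N + B + B ^ 2) + B) * M₀ ^ 2 * m with hK₂
  set K₃ := 2 * B * M₀ ^ 2 with hK₃
  have hK₁0 : 0 ≤ K₁ := by positivity
  have hK₂0 : 0 ≤ K₂ := by positivity
  have hK₃0 : 0 ≤ K₃ := by positivity
  have key := setIntegral_le_of_divergence ht.T_pos hα0 (M := K₁ + K₂ + K₃) (r₂ := r₂)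
    (by positivity) hs.r₂_lt hX hY ((i1.add i2).const_mul κ)
    ((i3.const_mul 2).add (i5.const_mul C)) ?_ ?_ ?_ ?_ ?_
  · rw [integral_const_mul, integral_add' i1 i2, integral_add' (i3.const_mul 2) (i5.const_mul C),
      integral_const_mul, integral_const_mul, setIntegral_indicator hm4, inter_eq_self_of_subset_right
        (prod_mono (Ioo_subset_Ioo hs.a_pos.le hb) subset_rfl)] at key
    exact key
  · intro x hx
    have hθ := ht.one_le_θ hx.2
    refine add_nonneg (by positivity) (mul_nonneg hC0 (indicator_nonneg (fun y hy => ?_) x))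
    have := ht.one_le_θ hy.2
    positivity
  · intro x hx
    obtain ⟨X', Y', hX', hY', hle⟩ := carleman_pointwise_solution hα hs ht hφ hN hε2 hε3 hx.1 hx.2
      (hf x.1 hx.1 x.2 hx.2)
    rw [(fderiv_eq_of_hasDerivAt_slices hUo hX hx).2 X' hX',
      (fderiv_eq_of_hasDerivAt_slices hUo hY hx).1 Y' hY']
    refine le_trans (le_of_eq ?_) (hle.trans (le_of_eq ?_))
    · simp only [Pi.add_apply]; ring
    · have : (Ioo a b ×ˢ Ioo 0 T).indicator (fun x : ℝ × ℝ =>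
          θ x.2 ^ 3 * φ x.1 x.2 ^ 2 * Real.exp (-(2 * (θ x.2 * h x.1)))) x =
          (Ioo a b).indicator 1 x.1 *
            (θ x.2 ^ 3 * φ x.1 x.2 ^ 2 * Real.exp (-(2 * (θ x.2 * h x.1)))) := by
        by_cases hxa : x.1 ∈ Ioo a b
        · rw [indicator_of_mem (mk_mem_prod hxa hx.2), indicator_of_mem hxa]; simp
        · rw [indicator_of_notMem fun h => hxa h.1, indicator_of_notMem hxa]; simp
      simp only [Pi.add_apply]
      rw [this]; ring
  · intro x hx
    have hτ : 0 ≤ x.2 * (T - x.2) := mul_nonneg hx.2.1.le (by linarith [hx.2.2])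
    refine (abs_timeFlux_le hα hs ht hN hx.1 hx.2 (M := M₀) ?_
      (abs_conjSpace_le hs ht hφ hx.1 hx.2)).trans ?_
    · simpa using hconj x hx
    · gcongr
      linarith
  · intro x hx
    have h1 := abs_spaceFlux_add_le hα hs ht hN hx.1 hx.2 (ρ := 1) (M := M₀)
      (hconj x hx) (abs_conj_le hs ht hx.1 hx.2 (hφ.abs_le_left x.1 hx.1 x.2 hx.2))
      (abs_conjSpace_le hs ht hφ hx.1 hx.2)
      (abs_conjTime_le hs ht hx.1 hx.2 (by simpa using habs x hx)
        (by simpa using hφ.abs_t_le x.1 hx.1 x.2 hx.2))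
    have hθ := ht.one_le_θ hx.2
    have hw0 : 0 < x.1 ^ α := Real.rpow_pos_of_pos hx.1.1 _
    have hw1 : x.1 ^ α ≤ 1 := Real.rpow_le_one hx.1.1.le hx.1.2.le hα0.le
    have h2 : θ x.2 * conjSpace h e θ φ φr x.1 x.2 ^ 2 ≤ M₀ ^ 2 := by
      have h3 : (θ x.2 ^ 3 * |conjSpace h e θ φ φr x.1 x.2|) ^ 2 ≤ M₀ ^ 2 := by
        have := abs_conjSpace_le hs ht hφ hx.1 hx.2
        gcongr
      rw [mul_pow, sq_abs, ← pow_mul] at h3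
      refine le_trans ?_ h3
      gcongr
      exact le_self_pow₀ hθ (by norm_num)
    have h4 : -(e x.1) ≤ B := by linarith [(abs_le.1 (hs.abs_e_le x.1 hx.1)).1]
    have h5 : -(2 * θ x.2 * (x.1 ^ α * e x.1) * (x.1 ^ α * conjSpace h e θ φ φr x.1 x.2 ^ 2)) ≤
        K₃ * x.1 ^ α := by
      calc _ = 2 * x.1 ^ α * (-(e x.1)) *
            (x.1 ^ α * (θ x.2 * conjSpace h e θ φ φr x.1 x.2 ^ 2)) := by ring
        _ ≤ 2 * x.1 ^ α * B * (1 * M₀ ^ 2) := by gcongr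
        _ = _ := by rw [hK₃]; ring
    have h6 := (abs_le.1 h1).2
    rw [mul_one] at h6
    have h7 : K₁ * x.1 ^ α + K₃ * x.1 ^ α ≤ (K₁ + K₂ + K₃) * x.1 ^ α := by
      rw [← add_mul]; gcongr; linarith
    have h8 : K₁ * x.1 ^ α = (2 + 2 * B + 2 * (N + B + B ^ 2) * B + 2 * B + 2 * B ^ 2 + 1) *
      (x.1 ^ α * M₀ ^ 2) := by rw [hK₁]; ring
    linarith
  · intro x hx hx2
    have h1 := abs_spaceFlux_add_le hα hs ht hN hx.1 hx.2 (ρ := 1 - x.1) (M := M₀)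
      (abs_conj_le hs ht hx.1 hx.2 (hφ.abs_le_right x.1 hx.1 x.2 hx.2))
      (abs_conj_le hs ht hx.1 hx.2 (hφ.abs_le_left x.1 hx.1 x.2 hx.2))
      (abs_conjSpace_le hs ht hφ hx.1 hx.2)
      (abs_conjTime_le hs ht hx.1 hx.2 (hφ.abs_le_right x.1 hx.1 x.2 hx.2)
        (hφ.abs_t_le_right x.1 hx.1 x.2 hx.2))
    have hθ := ht.one_le_θ hx.2
    have hw0 : 0 < x.1 ^ α := Real.rpow_pos_of_pos hx.1.1 _
    have hw1 : x.1 ^ α ≤ 1 := Real.rpow_le_one hx.1.1.le hx.1.2.le hα0.le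
    have h5 : 0 ≤ 2 * θ x.2 * (x.1 ^ α * -(e x.1)) *
        (x.1 ^ α * conjSpace h e θ φ φr x.1 x.2 ^ 2) := by
      have : 0 ≤ -(e x.1) := by linarith [hs.e_nonpos x.1 hx.1 hx2]
      positivity
    have h6 := (abs_le.1 h1).1
    have h1x : 0 ≤ 1 - x.1 := by linarith [hx.1.2]
    have h7 : (2 + 2 * B + 2 * (N + B + B ^ 2) * B + 2 * B + 2 * B ^ 2 + 1) *
        (x.1 ^ α * (M₀ ^ 2 * (1 - x.1))) ≤ (K₁ + K₂ + K₃) * (1 - x.1) := by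
      calc _ = K₁ * (1 - x.1) * x.1 ^ α := by rw [hK₁]; ring
        _ ≤ K₁ * (1 - x.1) * 1 := by gcongr
        _ ≤ _ := by rw [mul_one]; gcongr; linarith
    linarith

lemma hasDerivAt_slices {G : ℝ × ℝ → ℝ} {r t : ℝ} (hG : DifferentiableAt ℝ G (r, t)) :
    HasDerivAt (fun x => G (x, t)) (fderiv ℝ G (r, t) (1, 0)) r ∧
      HasDerivAt (fun τ => G (r, τ)) (fderiv ℝ G (r, t) (0, 1)) t :=
  ⟨HasFDerivAt.comp_hasDerivAt (f := fun x => (x, t)) r hG.hasFDerivAt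
    ((hasDerivAt_id r).prodMk (hasDerivAt_const r t)),
  HasFDerivAt.comp_hasDerivAt (f := fun τ => (r, τ)) t hG.hasFDerivAt
    ((hasDerivAt_const t r).prodMk (hasDerivAt_id t))⟩

/-- On a compact convex set, a function with continuous derivative is Lipschitz. -/
lemma exists_lipschitz_bound {G : ℝ × ℝ → ℝ} {K : Set (ℝ × ℝ)} (hK : IsCompact K)
    (hKc : Convex ℝ K) (hKu : UniqueDiffOn ℝ K) (hG : ContDiffOn ℝ 1 G K) :
    ∃ C : ℝ, 0 ≤ C ∧ (∀ x ∈ K, ‖fderivWithin ℝ G K x‖ ≤ C) ∧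
      ∀ x ∈ K, ∀ y ∈ K, |G y - G x| ≤ C * ‖y - x‖ := by
  obtain ⟨C, hC⟩ := hK.exists_bound_of_continuousOn (hG.continuousOn_fderivWithin hKu le_rfl)
  refine ⟨max C 0, le_max_right _ _, fun x hx => (hC x hx).trans (le_max_left _ _), ?_⟩
  intro x hx y hy
  exact hKc.norm_image_sub_le_of_norm_fderivWithin_le (hG.differentiableOn one_ne_zero)
    (fun z hz => (hC z hz).trans (le_max_left _ _)) hx hy

theorem exists_classicalData {T : ℝ} (hT : 0 < T) {φ : ℝ → ℝ → ℝ}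
    (hφ : ContDiffOn ℝ 3 (fun x : ℝ × ℝ => φ x.1 x.2) (Icc 0 1 ×ˢ Icc 0 T))
    (hb : ∀ t ∈ Icc (0 : ℝ) T, φ 0 t = 0 ∧ φ 1 t = 0) :
    ∃ M φr φt φrr φrt, ClassicalData T M φ φr φt φrr φrt := by
  set Φ : ℝ × ℝ → ℝ := fun x => φ x.1 x.2 with hΦ
  set K : Set (ℝ × ℝ) := Icc 0 1 ×ˢ Icc 0 T with hKdef
  have hK : IsCompact K := isCompact_Icc.prod isCompact_Icc
  have hKc : Convex ℝ K := (convex_Icc 0 1).prod (convex_Icc 0 T)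
  have hKu : UniqueDiffOn ℝ K := (uniqueDiffOn_Icc zero_lt_one).prod (uniqueDiffOn_Icc hT)
  have hUo : IsOpen (Ioo (0 : ℝ) 1 ×ˢ Ioo 0 T) := isOpen_Ioo.prod isOpen_Ioo
  have hUK : Ioo (0 : ℝ) 1 ×ˢ Ioo 0 T ⊆ K := prod_mono Ioo_subset_Icc_self Ioo_subset_Icc_self
  have hΦU := hφ.mono hUK
  have hfd : ContDiffOn ℝ 2 (fderiv ℝ Φ) (Ioo 0 1 ×ˢ Ioo 0 T) :=
    hΦU.fderiv_of_isOpen hUo (by norm_num)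
  have hdir : ∀ v, ContDiffOn ℝ 2 (fun x => fderiv ℝ Φ x v) (Ioo 0 1 ×ˢ Ioo 0 T) := fun v =>
    hfd.clm_apply contDiffOn_const
  have hdiff : ∀ v, ∀ x ∈ Ioo (0 : ℝ) 1 ×ˢ Ioo 0 T,
      DifferentiableAt ℝ (fun x => fderiv ℝ Φ x v) x := fun v x hx =>
    ((hdir v).contDiffAt (hUo.mem_nhds hx)).differentiableAt two_ne_zero
  have hsymm : ∀ x ∈ Ioo (0 : ℝ) 1 ×ˢ Ioo 0 T, ∀ v w,
      fderiv ℝ (fun x => fderiv ℝ Φ x v) x w = fderiv ℝ (fun x => fderiv ℝ Φ x w) x v := by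
    intro x hx v w
    have h2 : DifferentiableAt ℝ (fderiv ℝ Φ) x :=
      (hfd.contDiffAt (hUo.mem_nhds hx)).differentiableAt two_ne_zero
    have h3 : ∀ v w, fderiv ℝ (fun x => fderiv ℝ Φ x v) x w = fderiv ℝ (fderiv ℝ Φ) x w v := by
      intro v w
      rw [fderiv_clm_apply h2 (differentiableAt_const v)]
      simp
    rw [h3, h3]
    exact ((hΦU.contDiffAt (hUo.mem_nhds hx)).isSymmSndFDerivAt (by simp; norm_num)).eq w v
  obtain ⟨C, hC0, hC, hCL⟩ := exists_lipschitz_bound hK hKc hKu (hφ.of_le (by norm_num))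
  have hg : ContDiffOn ℝ 2 (fun x => fderivWithin ℝ Φ K x (0, 1)) K :=
    (hφ.fderivWithin hKu (by norm_num)).clm_apply contDiffOn_const
  obtain ⟨C', hC'0, -, hCL'⟩ := exists_lipschitz_bound hK hKc hKu (hg.of_le one_le_two)
  have hg1 : ∀ t ∈ Icc (0 : ℝ) T, fderivWithin ℝ Φ K (1, t) (0, 1) = 0 := by
    intro t ht
    have h1 : HasFDerivWithinAt Φ (fderivWithin ℝ Φ K (1, t)) K (1, t) :=
      (hφ.differentiableOn (by norm_num) (1, t) ⟨by simp, ht⟩).hasFDerivWithinAt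
    have h2 := HasFDerivWithinAt.comp_hasDerivWithinAt (f := fun τ => ((1 : ℝ), τ)) t h1
      ((hasDerivWithinAt_const t (Icc 0 T) (1 : ℝ)).prodMk (hasDerivWithinAt_id t (Icc 0 T)))
      (fun τ hτ => ⟨by simp, hτ⟩)
    refine (uniqueDiffOn_Icc hT t ht).eq_deriv _ h2 ?_
    exact (hasDerivWithinAt_const t (Icc 0 T) (0 : ℝ)).congr (fun τ hτ => (hb τ hτ).2) (hb t ht).2
  have heq : ∀ x ∈ Ioo (0 : ℝ) 1 ×ˢ Ioo 0 T, fderivWithin ℝ Φ K x = fderiv ℝ Φ x := fun x hx =>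
    fderivWithin_of_mem_nhds (mem_of_superset (hUo.mem_nhds hx) hUK)
  have hdirC : ∀ x ∈ Ioo (0 : ℝ) 1 ×ˢ Ioo 0 T, ∀ v : ℝ × ℝ, ‖v‖ ≤ 1 →
      |fderiv ℝ Φ x v| ≤ C + C' := by
    intro x hx v hv
    have h1 := (fderiv ℝ Φ x).le_opNorm v
    have h2 := hC x (hUK hx)
    rw [heq x hx] at h2
    rw [Real.norm_eq_abs] at h1
    calc _ ≤ ‖fderiv ℝ Φ x‖ * ‖v‖ := h1
      _ ≤ C * 1 := by gcongr
      _ ≤ _ := by linarith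
  refine ⟨C + C', fun r t => fderiv ℝ Φ (r, t) (1, 0), fun r t => fderiv ℝ Φ (r, t) (0, 1),
    fun r t => fderiv ℝ (fun x => fderiv ℝ Φ x (1, 0)) (r, t) (1, 0),
    fun r t => fderiv ℝ (fun x => fderiv ℝ Φ x (1, 0)) (r, t) (0, 1), ?_⟩
  have hΦd : ∀ x ∈ Ioo (0 : ℝ) 1 ×ˢ Ioo 0 T, DifferentiableAt ℝ Φ x := fun x hx =>
    (hΦU.contDiffAt (hUo.mem_nhds hx)).differentiableAt three_ne_zero
  constructor
  · positivity
  · exact fun r hr t ht => (hasDerivAt_slices (hΦd (r, t) ⟨hr, ht⟩)).1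
  · exact fun r hr t ht => (hasDerivAt_slices (hΦd (r, t) ⟨hr, ht⟩)).2
  · exact fun r hr t ht => (hasDerivAt_slices (hdiff _ (r, t) ⟨hr, ht⟩)).1
  · exact fun r hr t ht => (hasDerivAt_slices (hdiff _ (r, t) ⟨hr, ht⟩)).2
  · intro r hr t ht
    rw [hsymm (r, t) ⟨hr, ht⟩]
    exact (hasDerivAt_slices (hdiff _ (r, t) ⟨hr, ht⟩)).1
  · exact hΦU.of_le (by norm_num)
  · exact (hdir (1, 0)).of_le one_le_two
  · exact (hdir (0, 1)).of_le one_le_two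
  · intro r hr t ht
    have := hCL (0, t) ⟨by simp, Ioo_subset_Icc_self ht⟩ (r, t) (hUK ⟨hr, ht⟩)
    simp only [hΦ, (hb t (Ioo_subset_Icc_self ht)).1, Prod.mk_sub_mk, sub_zero, sub_self,
      Prod.norm_mk, norm_zero, Real.norm_eq_abs, abs_of_pos hr.1, max_eq_left hr.1.le] at this
    nlinarith [hr.1]
  · intro r hr t ht
    have := hCL (1, t) ⟨by simp, Ioo_subset_Icc_self ht⟩ (r, t) (hUK ⟨hr, ht⟩)
    have h1 : |r - 1| = 1 - r := by rw [abs_sub_comm, abs_of_nonneg (by linarith [hr.2])]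
    simp only [hΦ, (hb t (Ioo_subset_Icc_self ht)).2, Prod.mk_sub_mk, sub_zero, sub_self,
      Prod.norm_mk, norm_zero, Real.norm_eq_abs, h1, max_eq_left (sub_nonneg.2 hr.2.le)] at this
    nlinarith [hr.2]
  · exact fun r hr t ht => hdirC (r, t) ⟨hr, ht⟩ _ (by simp)
  · exact fun r hr t ht => hdirC (r, t) ⟨hr, ht⟩ _ (by simp)
  · intro r hr t ht
    have := hCL' (1, t) ⟨by simp, Ioo_subset_Icc_self ht⟩ (r, t) (hUK ⟨hr, ht⟩)
    have h1 : |r - 1| = 1 - r := by rw [abs_sub_comm, abs_of_nonneg (by linarith [hr.2])]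
    simp only [hg1 t (Ioo_subset_Icc_self ht), heq (r, t) ⟨hr, ht⟩, Prod.mk_sub_mk, sub_zero,
      sub_self, Prod.norm_mk, norm_zero, Real.norm_eq_abs, h1,
      max_eq_left (sub_nonneg.2 hr.2.le)] at this
    nlinarith [hr.2]

/-- The degenerate operator in non-divergence form. -/
lemma ClassicalData.deriv_rpow_mul_deriv {T M α : ℝ} {φ φr φt φrr φrt : ℝ → ℝ → ℝ}
    (hφ : ClassicalData T M φ φr φt φrr φrt) {r t : ℝ} (hr : r ∈ Ioo (0 : ℝ) 1)
    (ht : t ∈ Ioo 0 T) :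
    deriv (fun x => x ^ α * deriv (fun y => φ y t) x) r =
      r ^ α * φrr r t + α * r ^ (α - 1) * φr r t := by
  have h1 : (fun x => x ^ α * deriv (fun y => φ y t) x) =ᶠ[𝓝 r] fun x => x ^ α * φr x t := by
    filter_upwards [isOpen_Ioo.mem_nhds hr] with x hx
    rw [(hφ.hasDerivAt_r x hx t ht).deriv]
  rw [h1.deriv_eq]
  refine (((hasDerivAt_rpow_const_of_pos hr.1 α).mul (hφ.hasDerivAt_rr r hr t ht)).congr_deriv
    ?_).deriv
  ring

lemma temporalWeight_mul_thetaWeight {T ε s : ℝ} (hT : 0 < T) (hε : 0 < ε) (hε1 : ε ≤ 1)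
    (hs : 100 / ε * max 1 (T ^ 16) ≤ s) :
    TemporalWeight T ε (T ^ 6 / s) (fun t => s * thetaWeight T t)
      (fun t => s * (-4 * (T - 2 * t) / (t * (T - t)) ^ 5))
      (fun t => s * (8 / (t * (T - t)) ^ 5 + 20 * (T - 2 * t) ^ 2 / (t * (T - t)) ^ 6)) := by
  have hτ0 : ∀ t ∈ Ioo (0 : ℝ) T, 0 < t * (T - t) := fun t ht => mul_pos ht.1 (sub_pos.2 ht.2)
  have hτ1 : ∀ t ∈ Ioo (0 : ℝ) T, t * (T - t) ≤ T ^ 2 / 4 := fun t _ => by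
    nlinarith [sq_nonneg (T - 2 * t)]
  have hT2 : ∀ t ∈ Ioo (0 : ℝ) T, |T - 2 * t| ≤ T := fun t ht => by
    rw [abs_le]; constructor <;> linarith [ht.1, ht.2]
  set R := max 1 (T ^ 16) with hR
  have hR1 : 1 ≤ R := le_max_left _ _
  have hεs : 100 * R ≤ ε * s := by
    calc 100 * R = ε * (100 / ε * R) := by field_simp
      _ ≤ ε * s := by gcongr
  have hs0 : 0 < s := pos_of_mul_pos_right (by linarith) hε.le
  have hpow : ∀ k ≤ 16, T ^ k ≤ R := by
    intro k hk
    rcases le_total T 1 with h | h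
    · exact (pow_le_one₀ hT.le h).trans hR1
    · exact (pow_le_pow_right₀ h hk).trans (le_max_right _ _)
  have hτd : ∀ t, HasDerivAt (fun t => t * (T - t)) (T - 2 * t) t := fun t =>
    ((hasDerivAt_id t).mul ((hasDerivAt_id t).const_sub T)).congr_deriv (by simp; ring)
  have hτc : ∀ n : WithTop ℕ∞, ContDiffOn ℝ n (fun t : ℝ => t * (T - t)) (Ioo 0 T) := fun n =>
    contDiffOn_id.mul (contDiffOn_const.sub contDiffOn_id)
  unfold thetaWeight
  refine ⟨hT, hε, hε1, by positivity, ?_, ?_, ?_, ?_, ?_, ?_, ?_, ?_⟩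
  · intro t ht
    have h0 := hτ0 t ht
    refine ((((hτd t).pow 4).inv (pow_pos h0 4).ne').const_mul s).congr_deriv ?_
    simp only [Pi.pow_apply]
    generalize t * (T - t) = τ at h0 ⊢
    field_simp
    ring
  · intro t ht
    have h0 := hτ0 t ht
    refine (((((hasDerivAt_id t).const_mul 2).const_sub T).const_mul (-4)).div ((hτd t).pow 5)
      (pow_pos h0 5).ne').const_mul s |>.congr_deriv ?_
    simp only [Pi.pow_apply, id]
    generalize t * (T - t) = τ at h0 ⊢
    field_simp
    ring
  · exact contDiffOn_const.mul (((hτc 2).pow 4).inv fun t ht => (pow_pos (hτ0 t ht) 4).ne')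
  · exact contDiffOn_const.mul ((contDiffOn_const.mul (contDiffOn_const.sub
      (contDiffOn_const.mul contDiffOn_id))).div ((hτc 1).pow 5)
        fun t ht => (pow_pos (hτ0 t ht) 5).ne')
  all_goals intro t ht; have h0 := hτ0 t ht; have h1 := hτ1 t ht; have h2 := hT2 t ht
  all_goals generalize t * (T - t) = τ at h0 h1 ⊢
  · have h3 : τ ^ 4 ≤ (T ^ 2 / 4) ^ 4 := by gcongr
    rw [← mul_assoc, ← div_eq_mul_inv, one_le_div (by positivity)]
    nlinarith [hpow 8 (by norm_num)]
  · have h3 : τ ^ 3 ≤ (T ^ 2 / 4) ^ 3 := by gcongr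
    have h4 : 4 * T * τ ^ 3 ≤ ε * s := by
      calc 4 * T * τ ^ 3 ≤ 4 * T * (T ^ 2 / 4) ^ 3 := by gcongr
        _ = T ^ 7 / 16 := by ring
        _ ≤ ε * s := by linarith [hpow 7 (by norm_num)]
    rw [abs_mul, abs_of_pos hs0, abs_div, abs_mul, abs_of_pos (by positivity : 0 < τ ^ 5)]
    norm_num
    calc s * (4 * |T - 2 * t| / τ ^ 5) ≤ s * (4 * T / τ ^ 5) := by gcongr
      _ = s * (4 * T * τ ^ 3) * (τ ^ 8)⁻¹ := by field_simp
      _ ≤ s * (ε * s) * (τ ^ 8)⁻¹ := by gcongr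
      _ = _ := by field_simp
  · have h3 : 8 * τ ^ 3 + 20 * T ^ 2 * τ ^ 2 ≤ ε * s := by
      calc 8 * τ ^ 3 + 20 * T ^ 2 * τ ^ 2
          ≤ 8 * (T ^ 2 / 4) ^ 3 + 20 * T ^ 2 * (T ^ 2 / 4) ^ 2 := by gcongr
        _ = 11 / 8 * T ^ 6 := by ring
        _ ≤ ε * s := by linarith [hpow 6 (by norm_num)]
    have h4 : (T - 2 * t) ^ 2 ≤ T ^ 2 := sq_le_sq' (abs_le.1 h2).1 (abs_le.1 h2).2
    rw [abs_of_nonneg (by positivity)]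
    calc s * (8 / τ ^ 5 + 20 * (T - 2 * t) ^ 2 / τ ^ 6)
        ≤ s * (8 / τ ^ 5 + 20 * T ^ 2 / τ ^ 6) := by gcongr
      _ = s * (8 * τ ^ 3 + 20 * T ^ 2 * τ ^ 2) * (τ ^ 8)⁻¹ := by field_simp
      _ ≤ s * (ε * s) * (τ ^ 8)⁻¹ := by gcongr
      _ = _ := by field_simp
  · have h3 : τ ^ 3 ≤ (T ^ 2) ^ 3 := by gcongr; linarith [sq_nonneg T]
    have h4 : T ^ 6 / s * τ * (s * (τ ^ 4)⁻¹) = T ^ 6 / τ ^ 3 := by field_simp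
    rw [h4, one_le_div (by positivity)]
    linarith

lemma exists_cutoff {a b : ℝ} (hab : a < b) :
    ∃ (χ : ℝ → ℝ) (L : ℝ), 0 ≤ L ∧ ContDiff ℝ 1 χ ∧ (∀ r, 0 ≤ χ r) ∧
      (∀ r, χ r ≤ (Ioo a b).indicator 1 r) ∧
      (∀ r ∈ Icc ((2 * a + b) / 3) ((a + 2 * b) / 3), χ r = 1) ∧
      ∀ r, |deriv χ r| ≤ L * (Ioo a b).indicator 1 r := by
  let f : ContDiffBump ((a + b) / 2) := ⟨(b - a) / 6, (b - a) / 2, by linarith, by linarith⟩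
  have hball : Metric.ball ((a + b) / 2) ((b - a) / 2) = Ioo a b := by
    rw [Real.ball_eq_Ioo]; congr 1 <;> ring
  have hzero : ∀ r ∉ Ioo a b, f r = 0 := fun r hr => by
    rw [← hball] at hr
    exact Function.notMem_support.1 (f.support_eq ▸ hr)
  obtain ⟨L, hL⟩ := Continuous.bounded_above_of_compact_support
    ((f.contDiff (n := 1)).continuous_deriv le_rfl) f.hasCompactSupport.deriv
  refine ⟨f, max L 0, le_max_right _ _, f.contDiff, fun r => f.nonneg, fun r => ?_, fun r hr => ?_,
    fun r => ?_⟩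
  · by_cases hr : r ∈ Ioo a b
    · rw [indicator_of_mem hr]; exact f.le_one
    · rw [indicator_of_notMem hr, hzero r hr]
  · apply f.one_of_mem_closedBall
    rw [Real.closedBall_eq_Icc]
    constructor
    · change (a + b) / 2 - (b - a) / 6 ≤ r
      linarith [hr.1]
    · change r ≤ (a + b) / 2 + (b - a) / 6
      linarith [hr.2]
  · by_cases hr : r ∈ Ioo a b
    · rw [indicator_of_mem hr]
      simpa using Or.inl (hL r)
    · rw [indicator_of_notMem hr, mul_zero]
      have : IsLocalMin f r := Eventually.of_forall fun x => by
        rw [hzero r hr]; exact f.nonneg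
      rw [this.deriv_eq_zero, abs_zero]

lemma eqOn_of_hasDerivAt {f g f' g' : ℝ → ℝ} {s : Set ℝ} (hs : IsOpen s) (hfg : EqOn f g s)
    (hf : ∀ x ∈ s, HasDerivAt f (f' x) x) (hg : ∀ x ∈ s, HasDerivAt g (g' x) x) :
    EqOn f' g' s := fun x hx =>
  (hf x hx).unique ((hg x hx).congr_of_eventuallyEq (hfg.eventuallyEq_of_mem (hs.mem_nhds hx)))

/-- The identities satisfied by the derivatives of `r ^ (2 - α)`. -/
lemma power_weight_identities {α r : ℝ} (hr : 0 < r) {e e₁ e₂ : ℝ}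
    (he : e = (2 - α) * r ^ (1 - α)) (he₁ : e₁ = (2 - α) * ((1 - α) * r ^ (-α)))
    (he₂ : e₂ = (2 - α) * ((1 - α) * (-α * r ^ (-α - 1)))) :
    α * r ^ (α - 1) * e + r ^ α * e₁ = 2 - α ∧
      α * r ^ (α - 1) * e + 2 * r ^ α * e₁ = (2 - α) ^ 2 ∧
      r ^ α * e ^ 2 = (2 - α) ^ 2 * r ^ (2 - α) ∧
      α * (α - 1) * r ^ (α - 2) * e + 2 * α * r ^ (α - 1) * e₁ + r ^ α * e₂ = 0 := by
  have h1 : r ^ (α - 1) * r ^ (1 - α) = 1 := by rw [← Real.rpow_add hr]; simp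
  have h2 : r ^ α * r ^ (-α) = 1 := by rw [← Real.rpow_add hr]; simp
  have h3 : r ^ α * (r ^ (1 - α)) ^ 2 = r ^ (2 - α) := by
    rw [← Real.rpow_natCast, ← Real.rpow_mul hr.le, ← Real.rpow_add hr]
    congr 1; push_cast; ring
  have h4 : r ^ (α - 2) * r ^ (1 - α) = r ^ (-1 : ℝ) := by
    rw [← Real.rpow_add hr]; congr 1; ring
  have h5 : r ^ (α - 1) * r ^ (-α) = r ^ (-1 : ℝ) := by
    rw [← Real.rpow_add hr]; congr 1; ring
  have h6 : r ^ α * r ^ (-α - 1) = r ^ (-1 : ℝ) := by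
    rw [← Real.rpow_add hr]; congr 1; ring
  subst he he₁ he₂
  refine ⟨?_, ?_, ?_, ?_⟩
  · linear_combination α * (2 - α) * h1 + (2 - α) * (1 - α) * h2
  · linear_combination α * (2 - α) * h1 + 2 * (2 - α) * (1 - α) * h2
  · linear_combination (2 - α) ^ 2 * h3
  · linear_combination α * (α - 1) * (2 - α) * h4 + 2 * α * (2 - α) * (1 - α) * h5
      - (2 - α) * (1 - α) * α * h6

/-- The bounds satisfied by the derivatives of `(1 - r) * r ^ (-α)`. -/
lemma boundary_weight_bounds {α r : ℝ} (hα : α ∈ Ioo (0 : ℝ) 1) (hr : r ∈ Ioo (0 : ℝ) 1) {e e₁ : ℝ}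
    (he : e = -r ^ (-α) - α * (1 - r) * r ^ (-α - 1))
    (he₁ : e₁ = 2 * α * r ^ (-α - 1) + α * (α + 1) * (1 - r) * r ^ (-α - 2)) :
    e ≤ -1 ∧ 3 * α ≤ α * r ^ (α - 1) * e + 2 * r ^ α * e₁ := by
  obtain ⟨hr0, hr1⟩ := hr
  have hα0 := hα.1
  have h1r : 0 < 1 - r := sub_pos.2 hr1
  have h1 : r ^ (α - 1) * r ^ (-α) = r⁻¹ := by
    rw [← Real.rpow_add hr0, ← Real.rpow_neg_one]; congr 1; ring
  have h2 : r ^ (α - 1) * r ^ (-α - 1) = r⁻¹ ^ 2 := by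
    rw [← Real.rpow_add hr0, inv_pow, ← Real.rpow_natCast, ← Real.rpow_neg hr0.le]
    congr 1; push_cast; ring
  have h3 : r ^ α * r ^ (-α - 1) = r⁻¹ := by
    rw [← Real.rpow_add hr0, ← Real.rpow_neg_one]; congr 1; ring
  have h4 : r ^ α * r ^ (-α - 2) = r⁻¹ ^ 2 := by
    rw [← Real.rpow_add hr0, inv_pow, ← Real.rpow_natCast, ← Real.rpow_neg hr0.le]
    congr 1; push_cast; ring
  constructor
  · have h5 : 1 ≤ r ^ (-α) :=
      Real.one_le_rpow_of_pos_of_le_one_of_nonpos hr0 hr1.le (by linarith)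
    have h6 : 0 < r ^ (-α - 1) := Real.rpow_pos_of_pos hr0 _
    have : 0 ≤ α * (1 - r) * r ^ (-α - 1) := by positivity
    linarith
  · have h7 : 1 ≤ r⁻¹ := (one_le_inv₀ hr0).2 hr1.le
    have h8 : α * r ^ (α - 1) * e + 2 * r ^ α * e₁ =
        3 * α * r⁻¹ + (α ^ 2 + 2 * α) * (1 - r) * r⁻¹ ^ 2 := by
      subst he he₁
      linear_combination -α * h1 - α ^ 2 * (1 - r) * h2 + 4 * α * h3 + 2 * α * (α + 1) * (1 - r) * h4
    rw [h8]
    have h9 : 0 ≤ (α ^ 2 + 2 * α) * (1 - r) * r⁻¹ ^ 2 := by positivity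
    nlinarith

lemma exists_derivs_of_contDiffOn {η : ℝ → ℝ} (hη : ContDiffOn ℝ 3 η (Ioc 0 1)) {r₁ : ℝ}
    (hr₁ : 0 < r₁) : ∃ (e e₁ e₂ : ℝ → ℝ) (L : ℝ), 0 ≤ L ∧
      (∀ r ∈ Ioo (0 : ℝ) 1, HasDerivAt η (e r) r) ∧
      (∀ r ∈ Ioo (0 : ℝ) 1, HasDerivAt e (e₁ r) r) ∧
      (∀ r ∈ Ioo (0 : ℝ) 1, HasDerivAt e₁ (e₂ r) r) ∧
      ContDiffOn ℝ 2 e (Ioo 0 1) ∧ ContDiffOn ℝ 1 e₁ (Ioo 0 1) ∧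
      ∀ r ∈ Icc r₁ 1, |η r| ≤ L ∧ |e r| ≤ L ∧ |e₁ r| ≤ L ∧ |e₂ r| ≤ L := by
  have hu : UniqueDiffOn ℝ (Ioc (0 : ℝ) 1) := uniqueDiffOn_Ioc 0 1
  have hsub : Ioo (0 : ℝ) 1 ⊆ Ioc 0 1 := Ioo_subset_Ioc_self
  have hder : ∀ {g : ℝ → ℝ}, DifferentiableOn ℝ g (Ioc 0 1) → ∀ r ∈ Ioo (0 : ℝ) 1,
      HasDerivAt g (derivWithin g (Ioc 0 1) r) r := fun hg r hr =>
    (hg r (hsub hr)).hasDerivWithinAt.hasDerivAt (mem_of_superset (isOpen_Ioo.mem_nhds hr) hsub)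
  have hd1 : ContDiffOn ℝ 2 (derivWithin η (Ioc 0 1)) (Ioc 0 1) :=
    hη.derivWithin hu (by norm_num)
  have hd2 : ContDiffOn ℝ 1 (derivWithin (derivWithin η (Ioc 0 1)) (Ioc 0 1)) (Ioc 0 1) :=
    hd1.derivWithin hu (by norm_num)
  have hd3 := hd2.continuousOn_derivWithin hu le_rfl
  have hb : ∀ {g : ℝ → ℝ}, ContinuousOn g (Ioc 0 1) → ∃ L, ∀ r ∈ Icc r₁ 1, |g r| ≤ L := fun hg =>
    isCompact_Icc.exists_bound_of_continuousOn (hg.mono fun r hr => ⟨hr₁.trans_le hr.1, hr.2⟩)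
  obtain ⟨L₀, h₀⟩ := hb hη.continuousOn
  obtain ⟨L₁, h₁⟩ := hb hd1.continuousOn
  obtain ⟨L₂, h₂⟩ := hb hd2.continuousOn
  obtain ⟨L₃, h₃⟩ := hb hd3
  refine ⟨_, _, _, |L₀| + |L₁| + |L₂| + |L₃|, by positivity,
    hder (hη.differentiableOn three_ne_zero), hder (hd1.differentiableOn two_ne_zero),
    hder (hd2.differentiableOn one_ne_zero), hd1.mono hsub, hd2.mono hsub, fun r hr => ?_⟩
  have := h₀ r hr
  have := h₁ r hr
  have := h₂ r hr
  have := h₃ r hr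
  have := le_abs_self L₀
  have := le_abs_self L₁
  have := le_abs_self L₂
  have := le_abs_self L₃
  have := abs_nonneg L₀
  have := abs_nonneg L₁
  have := abs_nonneg L₂
  have := abs_nonneg L₃
  refine ⟨?_, ?_, ?_, ?_⟩ <;> linarith

/-- Bounds away from the degenerate point, in terms of a bound `L` on the derivatives. -/
lemma abs_le_of_derivs_le {α a r L : ℝ} (hα : α ∈ Ioo (0 : ℝ) 1) (ha : 0 < a) (har : a ≤ r)
    (hr : r < 1) (hL : 0 ≤ L) {e e₁ e₂ : ℝ} (he : |e| ≤ L) (he₁ : |e₁| ≤ L) (he₂ : |e₂| ≤ L) :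
    |α * r ^ (α - 1) * e + r ^ α * e₁| ≤ a ^ (α - 2) * L + L ∧
      |α * r ^ (α - 1) * e + 2 * r ^ α * e₁| ≤ a ^ (α - 2) * L + 2 * L ∧
      |α * (α - 1) * r ^ (α - 2) * e + 2 * α * r ^ (α - 1) * e₁ + r ^ α * e₂| ≤
        3 * (a ^ (α - 2) * L) + L := by
  obtain ⟨hα0, hα1⟩ := hα
  have hr0 : 0 < r := ha.trans_le har
  have h0 : 0 < r ^ α := Real.rpow_pos_of_pos hr0 _
  have h1 : 0 < r ^ (α - 1) := Real.rpow_pos_of_pos hr0 _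
  have h2 : 0 < r ^ (α - 2) := Real.rpow_pos_of_pos hr0 _
  have h0' : r ^ α ≤ 1 := Real.rpow_le_one hr0.le hr.le hα0.le
  have h2' : r ^ (α - 2) ≤ a ^ (α - 2) :=
    Real.rpow_le_rpow_of_nonpos ha har (by linarith)
  have h1' : r ^ (α - 1) ≤ a ^ (α - 2) :=
    (Real.rpow_le_rpow_of_exponent_ge hr0 hr.le (by linarith)).trans h2'
  set A := a ^ (α - 2)
  have hA : 0 ≤ A := h1.le.trans h1'
  have key : ∀ {c q Q y : ℝ}, 0 ≤ c → 0 < q → q ≤ Q → |y| ≤ L → |c * q * y| ≤ c * (Q * L) := by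
    intro c q Q y hc hq hqQ hy
    rw [abs_mul, abs_mul, abs_of_nonneg hc, abs_of_pos hq, mul_assoc]
    have := hq.le.trans hqQ
    gcongr
  have hAL : 0 ≤ A * L := mul_nonneg hA hL
  have k1 := key hα0.le h1 h1' he
  have k2 := key zero_le_one h0 h0' he₁
  have k3 := key (c := α * (1 - α)) (by nlinarith) h2 h2' he
  have k4 := key (c := 2 * α) (by linarith) h1 h1' he₁
  have k5 := key zero_le_one h0 h0' he₂
  rw [abs_le] at k1 k2 k3 k4 k5
  have m1 : α * (A * L) ≤ A * L := mul_le_of_le_one_left hAL hα1.le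
  have m2 : α * (1 - α) * (A * L) ≤ A * L := mul_le_of_le_one_left hAL (by nlinarith)
  simp only [abs_le]
  refine ⟨⟨?_, ?_⟩, ⟨?_, ?_⟩, ⟨?_, ?_⟩⟩ <;> linarith

lemma abs_le_gammaConst_sub_one {η : ℝ → ℝ} {K : ℝ} (hK : ∀ r ∈ Ioc (0 : ℝ) 1, |η r| ≤ K)
    {r : ℝ} (hr : r ∈ Ioc (0 : ℝ) 1) : |η r| ≤ gammaConst η - 1 := by
  have : |η r| ≤ sSup ((fun r => |η r|) '' Ioc (0 : ℝ) 1) :=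
    le_csSup ⟨K, by rintro _ ⟨x, hx, rfl⟩; exact hK x hx⟩ ⟨r, hr, rfl⟩
  rw [gammaConst]
  linarith

set_option maxHeartbeats 400000 in
/-- The weight of the Carleman estimate satisfies the abstract assumptions. -/
theorem exists_spatialWeight {α a b : ℝ} (hα : α ∈ Ioo (0 : ℝ) 1) (ha : 0 < a) (hab : a < b)
    (hb : b ≤ 1) {η : ℝ → ℝ} (hη : ContDiffOn ℝ 3 η (Ioc 0 1))
    (hη1 : ∀ r ∈ Ioc (0 : ℝ) ((2 * a + b) / 3), η r = r ^ (2 - α))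
    (hη3 : ∀ r ∈ Icc ((a + 2 * b) / 3) 1, η r = (1 - r) * r ^ (-α)) :
    ∃ (B D : ℝ) (e e₁ e₂ χ χ₁ : ℝ → ℝ), SpatialWeight α a b ((a + 2 * b) / 3) B D
      (fun r => gammaConst η - η r) e e₁ e₂ χ χ₁ := by
  obtain ⟨hα0, hα1⟩ := id hα
  have hc1 : 1 ≤ (2 - α) ^ 2 := by nlinarith
  have hc4 : (2 - α) ^ 2 ≤ 4 := by nlinarith
  have hc2 : α ≤ 2 * (2 - α) ^ 2 * (2 - α) ^ 2 := by nlinarith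
  set r₁ := (2 * a + b) / 3 with hr₁
  set r₂ := (a + 2 * b) / 3 with hr₂
  have ha1 : a < r₁ := by rw [hr₁]; linarith
  have h12 : r₁ < r₂ := by rw [hr₁, hr₂]; linarith
  have h2b : r₂ < b := by rw [hr₂]; linarith
  have h21 : r₂ < 1 := h2b.trans_le hb
  have h01 : 0 < r₁ := ha.trans ha1
  obtain ⟨e, e₁, e₂, L, hL, de, de₁, de₂, ce, ce₁, hbd⟩ := exists_derivs_of_contDiffOn hη h01
  obtain ⟨χ, Lχ, hLχ, cχ, χ0, χi, χ1, dχ⟩ := exists_cutoff hab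
  have hA0 : 0 < a ^ (α - 2) := Real.rpow_pos_of_pos ha _
  have hbd' := fun (r : ℝ) (h : r₁ ≤ r) (h' : r < 1) =>
    let H := hbd r ⟨h, h'.le⟩
    abs_le_of_derivs_le hα ha (ha1.le.trans h) h' hL H.2.1 H.2.2.1 H.2.2.2
  have hAL : 0 ≤ a ^ (α - 2) * L := by positivity
  set R := a ^ (α - 2) * L
  have hγ : ∀ r ∈ Ioc (0 : ℝ) 1, |η r| ≤ gammaConst η - 1 := by
    refine fun r hr => abs_le_gammaConst_sub_one (K := max 1 L) (fun r hr => ?_) hr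
    rcases le_or_gt r r₁ with h | h
    · rw [hη1 r ⟨hr.1, h⟩, abs_of_nonneg (Real.rpow_nonneg hr.1.le _)]
      exact (Real.rpow_le_one hr.1.le hr.2 (by linarith)).trans (le_max_left _ _)
    · exact (hbd r ⟨h.le, hr.2⟩).1.trans (le_max_right _ _)
  have hγ1 : 1 ≤ gammaConst η := by
    linarith [(abs_nonneg _).trans (hγ 1 ⟨one_pos, le_rfl⟩)]
  set γ := gammaConst η
  have sub : Ioo (0 : ℝ) r₁ ⊆ Ioo 0 1 := Ioo_subset_Ioo_right (h12.trans h21).le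
  have sub' : Ioo r₂ 1 ⊆ Ioo (0 : ℝ) 1 := Ioo_subset_Ioo_left (h01.trans h12).le
  -- explicit derivatives near the degenerate point
  have hp : ∀ (p : ℝ) {r : ℝ}, 0 < r → HasDerivAt (fun x : ℝ => x ^ p) (p * r ^ (p - 1)) r :=
    fun p r hr => Real.hasDerivAt_rpow_const (Or.inl hr.ne')
  have fe : EqOn e (fun r => (2 - α) * r ^ (1 - α)) (Ioo 0 r₁) := by
    refine eqOn_of_hasDerivAt isOpen_Ioo (fun r hr => hη1 r ⟨hr.1, hr.2.le⟩)
      (fun r hr => de r (sub hr)) fun r hr => (hp (2 - α) hr.1).congr_deriv ?_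
    rw [show 2 - α - 1 = 1 - α by ring]
  have fe₁ : EqOn e₁ (fun r => (2 - α) * ((1 - α) * r ^ (-α))) (Ioo 0 r₁) := by
    refine eqOn_of_hasDerivAt isOpen_Ioo fe
      (fun r hr => de₁ r (sub hr)) fun r hr => ((hp (1 - α) hr.1).const_mul _).congr_deriv ?_
    rw [show 1 - α - 1 = -α by ring]
  have fe₂ : EqOn e₂ (fun r => (2 - α) * ((1 - α) * (-α * r ^ (-α - 1)))) (Ioo 0 r₁) :=
    eqOn_of_hasDerivAt isOpen_Ioo fe₁ (fun r hr => de₂ r (sub hr))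
      fun r hr => ((hp (-α) hr.1).const_mul _).const_mul _
  -- explicit derivatives near the right end point
  have ge : EqOn e (fun r => -r ^ (-α) - α * (1 - r) * r ^ (-α - 1)) (Ioo r₂ 1) := by
    refine eqOn_of_hasDerivAt isOpen_Ioo (fun r hr => hη3 r ⟨hr.1.le, hr.2.le⟩)
      (fun r hr => de r (sub' hr)) fun r hr =>
        (((hasDerivAt_id r).const_sub 1).mul (hp (-α) (sub' hr).1)).congr_deriv ?_
    simp only [id]; ring
  have ge₁ : EqOn e₁ (fun r => 2 * α * r ^ (-α - 1) + α * (α + 1) * (1 - r) * r ^ (-α - 2))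
      (Ioo r₂ 1) := by
    refine eqOn_of_hasDerivAt isOpen_Ioo ge
      (fun r hr => de₁ r (sub' hr)) fun r hr => ((hp (-α) (sub' hr).1).neg.sub
        ((((hasDerivAt_id r).const_sub 1).const_mul α).mul
          (hp (-α - 1) (sub' hr).1))).congr_deriv ?_
    simp only [id]
    rw [show -α - 1 - 1 = -α - 2 by ring]; ring
  have zA := fun (r : ℝ) (hr : r ∈ Ioo 0 r₁) =>
    power_weight_identities hr.1 (fe hr) (fe₁ hr) (fe₂ hr)
  have zC := fun (r : ℝ) (hr : r ∈ Ioo r₂ 1) =>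
    boundary_weight_bounds hα (sub' hr) (ge hr) (ge₁ hr)
  have hin : ∀ r ∈ Icc r₁ r₂, (Ioo a b).indicator (1 : ℝ → ℝ) r = 1 := fun r hr =>
    indicator_of_mem (show r ∈ Ioo a b from ⟨ha1.trans_le hr.1, hr.2.trans_lt h2b⟩) 1
  have hin0 : ∀ r, 0 ≤ (Ioo a b).indicator (1 : ℝ → ℝ) r := fun r =>
    indicator_nonneg (fun _ _ => zero_le_one) r
  have hin1 : ∀ r, (Ioo a b).indicator (1 : ℝ → ℝ) r ≤ 1 := fun r =>
    indicator_le_self' (fun _ _ => zero_le_one) r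
  have hpow : ∀ r, a ≤ r → r < 1 → a ^ 2 ≤ r ^ (2 - α) := fun r h h' => by
    calc a ^ 2 ≤ r ^ 2 := by gcongr
      _ = r ^ (2 : ℝ) := (Real.rpow_two r).symm
      _ ≤ r ^ (2 - α) :=
        Real.rpow_le_rpow_of_exponent_ge (ha.trans_le h) h'.le (by linarith)
  set B := 3 + R + 2 * L + Lχ + 2 * γ with hB
  have hB0 : 0 ≤ B := by positivity
  set D := 4 + (2 * L ^ 2 * (R + 2 * L) + 1) + (3 * R + L + B ^ 2) ^ 2 / a ^ 2 + L ^ 2 / a ^ 2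
    with hD
  have hD1 : 4 ≤ D := by
    rw [hD]
    have : 0 ≤ 2 * L ^ 2 * (R + 2 * L) + 1 + (3 * R + L + B ^ 2) ^ 2 / a ^ 2 + L ^ 2 / a ^ 2 := by
      positivity
    linarith
  have hD2 : 2 * L ^ 2 * (R + 2 * L) + 1 ≤ D := by
    rw [hD]
    have : 0 ≤ 4 + (3 * R + L + B ^ 2) ^ 2 / a ^ 2 + L ^ 2 / a ^ 2 := by positivity
    linarith
  have hD3 : (3 * R + L + B ^ 2) ^ 2 ≤ D * a ^ 2 := by
    rw [← div_le_iff₀ (by positivity), hD]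
    have : 0 ≤ 4 + (2 * L ^ 2 * (R + 2 * L) + 1) + L ^ 2 / a ^ 2 := by positivity
    linarith
  have hD4 : L ^ 2 ≤ D * a ^ 2 := by
    rw [← div_le_iff₀ (by positivity), hD]
    have : 0 ≤ 4 + (2 * L ^ 2 * (R + 2 * L) + 1) + (3 * R + L + B ^ 2) ^ 2 / a ^ 2 := by
      positivity
    linarith
  have hχB : ∀ r, |deriv χ r| ≤ B * (Ioo a b).indicator 1 r := fun r =>
    (dχ r).trans (mul_le_mul_of_nonneg_right (by rw [hB]; linarith) (hin0 r))
  have hχB' : ∀ r, |B * deriv χ r| ≤ B ^ 2 := fun r => by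
    rw [abs_mul, abs_of_nonneg hB0, sq]
    exact mul_le_mul_of_nonneg_left
      ((hχB r).trans (mul_le_of_le_one_right hB0 (hin1 r))) hB0
  have hcross : ∀ r, a ≤ r → r < 1 → ∀ X, |X| ≤ 3 * R + L →
      r ^ α * (X + B * deriv χ r) ^ 2 ≤ D * r ^ (2 - α) := fun r h h' X hX => by
    have h0 : 0 ≤ r ^ α := Real.rpow_nonneg (ha.le.trans h) _
    have h1 : r ^ α ≤ 1 := Real.rpow_le_one (ha.le.trans h) h'.le hα0.le
    have h2 : |X + B * deriv χ r| ≤ 3 * R + L + B ^ 2 :=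
      (abs_add_le _ _).trans (add_le_add hX (hχB' r))
    calc r ^ α * (X + B * deriv χ r) ^ 2 ≤ 1 * (3 * R + L + B ^ 2) ^ 2 := by
          rw [← sq_abs (X + _)]; gcongr
      _ ≤ D * a ^ 2 := by rw [one_mul]; exact hD3
      _ ≤ D * r ^ (2 - α) := by gcongr; exact hpow r h h'
  clear_value D R γ
  refine ⟨B, D, e, e₁, e₂, χ, deriv χ, by linarith, by linarith, h21, ha,
    fun r hr => (de r hr).const_sub γ, de₁, de₂,
    fun r _ => (cχ.differentiable one_ne_zero r).hasDerivAt,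
    contDiffOn_const.sub ((hη.mono Ioo_subset_Ioc_self).of_le (by norm_num)), ce, ce₁,
    cχ.contDiffOn, fun r hr => ?_, fun r hr => ?_, fun r hr => ?_, fun r hr => ?_, fun r hr => ?_,
    fun r hr => ?_, fun r hr => ?_, fun r hr => ?_, fun r _ => χ0 r, fun r _ => χi r,
    fun r _ => hχB r, fun r hr hr2 => by linarith [(zC r ⟨hr2, hr.2⟩).1]⟩
  · linarith [(abs_le.1 (hγ r ⟨hr.1, hr.2.le⟩)).2]
  · rw [hB]; linarith [(abs_le.1 (hγ r ⟨hr.1, hr.2.le⟩)).1]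
  · rcases lt_or_ge r r₁ with h | h
    · have h1 : r ^ (1 - α) ≤ 1 := Real.rpow_le_one hr.1.le hr.2.le (by linarith)
      have h0 : 0 ≤ r ^ (1 - α) := Real.rpow_nonneg hr.1.le _
      rw [fe ⟨hr.1, h⟩, abs_of_nonneg (mul_nonneg (by linarith) h0), hB]
      have : (2 - α) * r ^ (1 - α) ≤ 2 * 1 := by gcongr; linarith
      linarith
    · rw [hB]; linarith [(hbd r ⟨h, hr.2.le⟩).2.1]
  · rcases lt_or_ge r r₁ with h | h
    · rw [(zA r ⟨hr.1, h⟩).1, abs_of_nonneg (by linarith), hB]; linarith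
    · rw [hB]; linarith [(hbd' r h hr.2).1]
  · have hBχ : 0 ≤ B * χ r := mul_nonneg hB0 (χ0 r)
    rcases lt_or_ge r r₁ with h | h
    · rw [(zA r ⟨hr.1, h⟩).2.1]; linarith
    rcases lt_or_ge r₂ r with h' | h'
    · linarith [(zC r ⟨h', hr.2⟩).2]
    · rw [χ1 r ⟨h, h'⟩, hB]; linarith [(abs_le.1 (hbd' r h hr.2).2.1).1]
  · have h0 : 0 < r ^ α := Real.rpow_pos_of_pos hr.1 _
    have hpl : r ^ (2 - α) ≤ r ^ α := Real.rpow_le_rpow_of_exponent_ge hr.1 hr.2.le (by linarith)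
    have h3 : 0 < r ^ (2 - α) := Real.rpow_pos_of_pos hr.1 _
    have hDi : 0 ≤ D * (Ioo a b).indicator 1 r := mul_nonneg (by linarith) (hin0 r)
    rcases lt_or_ge r r₁ with h | h
    · have z := zA r ⟨hr.1, h⟩
      rw [z.2.1, mul_assoc 2, z.2.2.1]
      have h2 := mul_le_mul_of_nonneg_right hc2 h3.le
      linarith
    rcases lt_or_ge r₂ r with h' | h'
    · obtain ⟨z1, z2⟩ := zC r ⟨h', hr.2⟩
      have h5 : 1 ≤ e r ^ 2 := by rw [one_le_sq_iff_one_le_abs, le_abs]; right; linarith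
      have h6 : α * r ^ (2 - α) ≤ α * r ^ α := by gcongr
      have h7 : 0 < α * r ^ α := by positivity
      calc α * r ^ (2 - α) ≤ 2 * r ^ α * 1 * (3 * α) + 0 := by linarith
        _ ≤ _ := by gcongr
    · rw [hin r ⟨h, h'⟩, mul_one]
      have h4 : r ^ α ≤ 1 := Real.rpow_le_one hr.1.le hr.2.le hα0.le
      have h5 := (hbd' r h hr.2).2.1
      have h6 : |2 * r ^ α * e r ^ 2 * (α * r ^ (α - 1) * e r + 2 * r ^ α * e₁ r)| ≤
          2 * 1 * L ^ 2 * (R + 2 * L) := by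
        rw [abs_mul, abs_of_nonneg (by positivity), ← sq_abs (e r)]
        have := (hbd r ⟨h, hr.2.le⟩).2.1
        gcongr
      have h7 : α * r ^ (2 - α) ≤ 1 := mul_le_one₀ hα1.le h3.le (hpl.trans h4)
      linarith [(abs_le.1 h6).1]
  · rcases lt_or_ge r r₁ with h | h
    · rw [(zA r ⟨hr.1, h⟩).2.2.2]
      rcases lt_or_ge r a with h' | h'
      · have : deriv χ r = 0 := by
          simpa [indicator_of_notMem (fun h : r ∈ Ioo a b => h'.not_gt h.1)] using dχ r
        rw [this]
        have := Real.rpow_nonneg hr.1.le (2 - α)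
        simp only [mul_zero, add_zero, ne_eq, OfNat.ofNat_ne_zero, not_false_eq_true, zero_pow]
        exact mul_nonneg (by linarith) this
      · exact hcross r h' hr.2 0 (by rw [abs_zero]; positivity)
    · exact hcross r (ha1.le.trans h) hr.2 _ (hbd' r h hr.2).2.2
  · rcases lt_or_ge r r₁ with h | h
    · rw [(zA r ⟨hr.1, h⟩).2.2.1]
      have : (2 - α) ^ 2 ≤ D := hc4.trans hD1
      have := Real.rpow_nonneg hr.1.le (2 - α)
      gcongr
    · have h1 : r ^ α ≤ 1 := Real.rpow_le_one hr.1.le hr.2.le hα0.le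
      have h0 : 0 ≤ r ^ α := Real.rpow_nonneg hr.1.le _
      have h2 := (hbd r ⟨h, hr.2.le⟩).2.1
      calc r ^ α * e r ^ 2 ≤ 1 * L ^ 2 := by rw [← sq_abs (e r)]; gcongr
        _ ≤ D * a ^ 2 := by rw [one_mul]; exact hD4
        _ ≤ D * r ^ (2 - α) := by gcongr; exact hpow r (ha1.le.trans h) hr.2

lemma setIntegral_prod_eq_iterated {F : ℝ × ℝ → ℝ} {s t : Set ℝ}
    (hF : IntegrableOn F (s ×ˢ t)) : ∫ x in s ×ˢ t, F x = ∫ y in t, ∫ x in s, F (x, y) := by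
  rw [IntegrableOn, Measure.volume_eq_prod, ← Measure.prod_restrict] at hF
  rw [Measure.volume_eq_prod, ← Measure.prod_restrict, integral_prod_symm F hF]

lemma setIntegral_prod_eq_mul_iterated {F : ℝ × ℝ → ℝ} {G : ℝ → ℝ → ℝ} {s t : Set ℝ} {c : ℝ}
    (hs : MeasurableSet s) (ht : MeasurableSet t) (hF : IntegrableOn F (s ×ˢ t))
    (hFG : ∀ x ∈ s, ∀ y ∈ t, F (x, y) = c * G y x) :
    ∫ x in s ×ˢ t, F x = c * ∫ y in t, ∫ x in s, G y x := by
  rw [setIntegral_prod_eq_iterated hF, ← integral_const_mul]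
  refine setIntegral_congr_fun ht fun y hy => ?_
  rw [← integral_const_mul]
  exact setIntegral_congr_fun hs fun x hx => hFG x hx y hy

/-- Smallness of the time derivatives of the temporal weight needed in the Carleman estimate. -/
lemma exists_small_parameter {α B D : ℝ} (hα : α ∈ Ioo (0 : ℝ) 1) (hB : 0 ≤ B) (hD : 0 ≤ D) :
    ∃ ε : ℝ, 0 < ε ∧ ε ≤ 1 ∧ ε * (2 * D / α + 4 * D + B / 2) ≤ α / 2 ∧
      ε * B / 2 ≤ α * (1 - α) ^ 2 / 8 := by
  obtain ⟨hα0, hα1⟩ := hα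
  have h1 : 0 < 1 - α := sub_pos.2 hα1
  set K := 2 * D / α + 4 * D + B / 2 + 1 with hK
  have hK0 : 0 < K := by positivity
  have hBK : B / 2 ≤ K := by
    have : 0 ≤ 2 * D / α := by positivity
    rw [hK]; linarith
  have hα2 : α * (1 - α) ^ 2 / 8 ≤ α / 2 := by
    linarith [mul_le_of_le_one_right hα0.le (pow_le_one₀ h1.le (by linarith) : (1 - α) ^ 2 ≤ 1)]
  have hα3 : 0 < α * (1 - α) ^ 2 / 8 := by positivity
  have hε : α * (1 - α) ^ 2 / 8 / K * K = α * (1 - α) ^ 2 / 8 := div_mul_cancel₀ _ hK0.ne'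
  have hε0 : 0 < α * (1 - α) ^ 2 / 8 / K := by positivity
  refine ⟨α * (1 - α) ^ 2 / 8 / K, hε0, ?_, ?_, ?_⟩
  · rw [div_le_one hK0]
    have : 0 ≤ 2 * D / α + 4 * D + B / 2 := by positivity
    rw [hK]; linarith
  · calc _ ≤ α * (1 - α) ^ 2 / 8 / K * K := by gcongr; rw [hK]; linarith
      _ ≤ α / 2 := hε.trans_le hα2
  · calc _ = α * (1 - α) ^ 2 / 8 / K * (B / 2) := by ring
      _ ≤ α * (1 - α) ^ 2 / 8 / K * K := by gcongr
      _ = _ := hε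

end

/-- **Carleman estimate for the degenerate parabolic operator
`∂_t − ∂_r(r^α ∂_r ·) + n²` on `(0,1) × (0,T)`** (Theorem 4.1 of the paper),
stated for classical solutions that are smooth up to the boundary. -/
theorem stmt_11 (α a b : ℝ) (hα : α ∈ Set.Ioo (0 : ℝ) 1)
    (ha : 0 < a) (hab : a < b) (hb : b ≤ 1)
    (η : ℝ → ℝ) (hηC3 : ContDiffOn ℝ 3 η (Set.Ioc 0 1))
    (hη1 : ∀ r ∈ Set.Ioc (0 : ℝ) ((2 * a + b) / 3), η r = r ^ (2 - α))
    (hη2 : ∀ r ∈ Set.Ioo ((2 * a + b) / 3) ((a + 2 * b) / 3), 0 < η r)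
    (hη3 : ∀ r ∈ Set.Icc ((a + 2 * b) / 3) 1, η r = (1 - r) * r ^ (-α)) :
    ∃ C : ℝ, 0 < C ∧ ∃ s₀ : ℝ, 1 ≤ s₀ ∧
      ∀ T : ℝ, 0 < T → ∀ n : ℕ, ∀ s : ℝ, s₀ * max 1 (T ^ 16) ≤ s →
        ∀ f : ℝ → ℝ → ℝ,
          IntegrableOn (fun p : ℝ × ℝ => (f p.1 p.2) ^ 2)
            (Set.Ioo 0 1 ×ˢ Set.Ioo 0 T) →
        ∀ φ : ℝ → ℝ → ℝ,
          ContDiffOn ℝ (⊤ : ℕ∞) (fun p : ℝ × ℝ => φ p.1 p.2) (Set.Icc 0 1 ×ˢ Set.Icc 0 T) →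
          (∀ t ∈ Set.Icc (0 : ℝ) T, φ 0 t = 0 ∧ φ 1 t = 0) →
          (∀ r ∈ Set.Ioo (0 : ℝ) 1, ∀ t ∈ Set.Ioo (0 : ℝ) T,
            deriv (fun τ => φ r τ) t
              - deriv (fun x => x ^ α * deriv (fun y => φ y t) x) r
              + (n : ℝ) ^ 2 * φ r t = f r t) →
          s * (∫ t in Set.Ioo (0 : ℝ) T, ∫ r in Set.Ioo (0 : ℝ) 1,
                thetaWeight T t * r ^ α * (deriv (fun y => φ y t) r) ^ 2 *
                  Real.exp (-2 * s * xiWeight η T r t))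
            + s ^ 3 * (∫ t in Set.Ioo (0 : ℝ) T, ∫ r in Set.Ioo (0 : ℝ) 1,
                (thetaWeight T t) ^ 3 * r ^ (2 - α) * (φ r t) ^ 2 *
                  Real.exp (-2 * s * xiWeight η T r t))
          ≤ C * (∫ t in Set.Ioo (0 : ℝ) T, ∫ r in Set.Ioo (0 : ℝ) 1,
                (f r t) ^ 2 * Real.exp (-2 * s * xiWeight η T r t))
            + C * s ^ 3 * (∫ t in Set.Ioo (0 : ℝ) T, ∫ r in Set.Ioo a b,
                (thetaWeight T t) ^ 3 * (φ r t) ^ 2 *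
                  Real.exp (-2 * s * xiWeight η T r t)) := by
  obtain ⟨B, D, e, e₁, e₂, χ, χ₁, hw⟩ := exists_spatialWeight hα ha hab hb hηC3 hη1 hη3
  have hB := hw.one_le_B
  have hD := hw.D_nonneg
  have hα0 := hα.1
  obtain ⟨ε, hε, hε1, hε2, hε3⟩ := exists_small_parameter hα (zero_le_one.trans hB) hD
  have hκ : 0 < α / (2 * (2 * D + 1)) := by positivity
  set κ := α / (2 * (2 * D + 1))
  set K := D + B + 4 * B ^ 3 + 3 * B ^ 2
  have hK : 0 ≤ K := by positivity
  refine ⟨(2 + K) / κ, by positivity, 100 / ε, by rw [one_le_div hε]; linarith, ?_⟩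
  intro T hT n s hs f hf φ hφ hbc hpde
  obtain ⟨M, φr, φt, φrr, φrt, hcd⟩ := exists_classicalData hT
    (hφ.of_le (by norm_cast)) hbc
  have ht := temporalWeight_mul_thetaWeight hT hε hε1 hs
  have key := carleman_estimate_of_weights hα hb hw ht hcd (sq_nonneg (n : ℝ)) hε2 hε3
    (fun r hr t ht => by
      rw [← hpde r hr t ht, (hcd.hasDerivAt_t r hr t ht).deriv,
        hcd.deriv_rpow_mul_deriv hr ht]) hf
  obtain ⟨i1, i2, i4⟩ := integrableOn_carleman_terms hα hw ht hcd
  have i3 := integrableOn_mul_exp_neg hw ht hf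
  have hexp : ∀ r t, Real.exp (-(2 * (s * thetaWeight T t * (gammaConst η - η r)))) =
      Real.exp (-2 * s * xiWeight η T r t) := fun r t => by
    rw [xiWeight]; congr 1; ring
  have hI := fun (u v : ℝ) => measurableSet_Ioo (a := u) (b := v)
  have hsub : Set.Ioo a b ×ˢ Set.Ioo 0 T ⊆ Set.Ioo 0 1 ×ˢ Set.Ioo 0 T :=
    Set.prod_mono (Set.Ioo_subset_Ioo ha.le hb) subset_rfl
  have e1 := setIntegral_prod_eq_mul_iterated (c := s) (G := fun t r =>
      thetaWeight T t * r ^ α * (deriv (fun y => φ y t) r) ^ 2 *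
        Real.exp (-2 * s * xiWeight η T r t)) (hI 0 1) (hI 0 T) i1 fun r hr t ht => by
    simp only [hexp, (hcd.hasDerivAt_r r hr t ht).deriv]; ring
  have e2 := setIntegral_prod_eq_mul_iterated (c := s ^ 3) (G := fun t r =>
      thetaWeight T t ^ 3 * r ^ (2 - α) * φ r t ^ 2 *
        Real.exp (-2 * s * xiWeight η T r t)) (hI 0 1) (hI 0 T) i2 fun r hr t ht => by
    simp only [hexp]; ring
  have e3 := setIntegral_prod_eq_mul_iterated (c := 1) (G := fun t r =>
      f r t ^ 2 * Real.exp (-2 * s * xiWeight η T r t)) (hI 0 1) (hI 0 T) i3 fun r hr t ht => by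
    simp only [hexp, one_mul]
  have e4 := setIntegral_prod_eq_mul_iterated (c := s ^ 3) (G := fun t r =>
      thetaWeight T t ^ 3 * φ r t ^ 2 *
        Real.exp (-2 * s * xiWeight η T r t)) (hI a b) (hI 0 T) (i4.mono_set hsub)
        fun r hr t ht => by
    simp only [hexp]; ring
  have p3 := setIntegral_nonneg ((hI 0 1).prod (hI 0 T)) (μ := volume) fun x _ =>
    mul_nonneg (sq_nonneg (f x.1 x.2))
      (Real.exp_pos (-(2 * (s * thetaWeight T x.2 * (gammaConst η - η x.1))))).le
  have p4 := setIntegral_nonneg ((hI a b).prod (hI 0 T)) (μ := volume) fun x hx => by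
    have := zero_le_one.trans (ht.one_le_θ hx.2)
    exact mul_nonneg (mul_nonneg (pow_nonneg this 3) (sq_nonneg (φ x.1 x.2)))
      (Real.exp_pos (-(2 * (s * thetaWeight T x.2 * (gammaConst η - η x.1))))).le
  rw [e3, one_mul] at p3
  rw [e4] at p4
  rw [e1, e2, e3, e4, one_mul] at key
  change κ * _ ≤ 2 * _ + K * _ at key
  rw [mul_assoc (_ / _), ← mul_add ((2 + K) / κ), div_mul_eq_mul_div, le_div_iff₀ hκ, mul_comm _ κ]
  linarith [mul_nonneg hK p3]
end
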